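/- Uniformly for x ≥ 2, squarefree or general d ≥ 1, 1 ≤ k ≤ R log₂ x, with r := (k−1)/log₂ x ≤ R, one has #{n ≤ x : gcd(n,d) = 1, ω(n) = k} = π_k(x)/𝔟_r(d) + O( B_R(d)·π_k(x)/log₂ x ), where 𝔟_r(d) := ∏_{p | d} (1 + r/(p−1)) and B_R(d) := ∏_{p | d} (1 − p^{−3/4})^{−R}. -/

import Mathlib

open Finset Real

/-- `π_k(x) := #{n ≤ x : ω(n) = k}`. -/
noncomputable def pik (k : ℕ) (x : ℝ) : ℕ :=
  ((Finset.Icc 1 ⌊x⌋₊).filter (fun n => n.primeFactors.card = k)).card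

/-- `𝔟_r(d) := ∏_{p ∣ d} (1 + r/(p−1))`. -/
noncomputable def bR (r : ℝ) (d : ℕ) : ℝ :=
  ∏ p ∈ d.primeFactors, (1 + r / ((p : ℝ) - 1))

/-- `B_R(d) := ∏_{p ∣ d} (1 − p^{−3/4})^{−R}`. -/
noncomputable def BR (R : ℝ) (d : ℕ) : ℝ :=
  ∏ p ∈ d.primeFactors, (1 - (p : ℝ) ^ (-(3 : ℝ)/4)) ^ (-R)

/-- The fractional part of `t` for `t > 1`, extended by zero. -/
noncomputable def fractTail (t : ℝ) : ℂ := Set.indicator (Set.Ioi 1) (fun t : ℝ => ((Int.fract t : ℝ) : ℂ)) t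

lemma norm_fractTail_le (t : ℝ) : ‖fractTail t‖ ≤ 1 := by
  unfold fractTail Set.indicator
  split_ifs
  · rw [Complex.norm_real, norm_of_nonneg (Int.fract_nonneg t)]
    exact (Int.fract_lt_one t).le
  · simp

lemma measurable_fractTail : Measurable fractTail := by
  unfold fractTail
  refine Measurable.indicator ?_ measurableSet_Ioi
  exact Complex.measurable_ofReal.comp measurable_fract

lemma mellin_fractTail_eq (s : ℂ) :
    mellin fractTail (-s) = ∫ t in Set.Ioi (1:ℝ), ((Int.fract t : ℝ) : ℂ) * (t : ℂ) ^ (-(s + 1)) := by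
  unfold mellin fractTail
  have : ∀ t : ℝ, (t : ℂ) ^ (-s - 1) • Set.indicator (Set.Ioi 1) (fun t : ℝ => ((Int.fract t : ℝ) : ℂ)) t
      = Set.indicator (Set.Ioi 1) (fun t : ℝ => ((Int.fract t : ℝ) : ℂ) * (t : ℂ) ^ (-(s + 1))) t := by
    intro t
    unfold Set.indicator
    split_ifs
    · rw [smul_eq_mul, mul_comm]; ring_nf
    · simp
  simp_rw [this]
  rw [MeasureTheory.setIntegral_indicator measurableSet_Ioi]
  congr 2
  ext t
  simp only [Set.mem_inter_iff, Set.mem_Ioi]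
  constructor
  · exact fun h => h.2
  · exact fun h => ⟨by linarith, h⟩

lemma differentiableAt_mellin_fractTail {s : ℂ} (hs : 0 < s.re) :
    DifferentiableAt ℂ (mellin fractTail) (-s) := by
  refine mellin_differentiableAt_of_isBigO_rpow (a := 0) (b := -s.re - 1) ?_ ?_ (by simpa using hs) ?_
    (by simp)
  · have hb : MeasureTheory.LocallyIntegrable fractTail := by
      refine (MeasureTheory.locallyIntegrable_const (1:ℂ)).mono
        measurable_fractTail.aestronglyMeasurable ?_
      exact Filter.Eventually.of_forall fun t => by simpa using norm_fractTail_le t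
    exact hb.locallyIntegrableOn _
  · refine Asymptotics.IsBigO.of_bound 1 (Filter.Eventually.of_forall fun t => ?_)
    simpa using norm_fractTail_le t
  · refine Asymptotics.IsBigO.of_bound 1 ?_
    filter_upwards [Ioo_mem_nhdsGT (zero_lt_one)] with t ht
    have : fractTail t = 0 := by
      unfold fractTail
      rw [Set.indicator_of_notMem]
      simp only [Set.mem_Ioi, not_lt]; exact ht.2.le
    rw [this]; simp

lemma norm_mellin_fractTail_le {s : ℂ} (hs : 1 / 2 ≤ s.re) : ‖mellin fractTail (-s)‖ ≤ 2 := by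
  rw [mellin_fractTail_eq]
  calc _ ≤ ∫ t in Set.Ioi (1:ℝ), t ^ (-(3/2) : ℝ) := by
        refine MeasureTheory.norm_integral_le_of_norm_le
          (integrableOn_Ioi_rpow_of_lt (by norm_num) zero_lt_one) ?_
        refine (MeasureTheory.ae_restrict_mem measurableSet_Ioi).mono fun t ht => ?_
        have ht' : (1:ℝ) < t := ht
        rw [norm_mul, Complex.norm_real, norm_of_nonneg (Int.fract_nonneg t),
          Complex.norm_cpow_eq_rpow_re_of_pos (by linarith)]
        calc _ ≤ 1 * t ^ (-(3/2) : ℝ) := by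
              gcongr
              · exact (Int.fract_lt_one t).le
              · exact ht'.le
              · simp; linarith
          _ = _ := one_mul _
    _ = 2 := by
        rw [integral_Ioi_rpow_of_lt (by norm_num) zero_lt_one]; norm_num

lemma riemannZeta₁_eq_of_one_lt_re {s : ℂ} (hs : 1 < s.re) :
    riemannZeta₁ s = s - s * (s - 1) * mellin fractTail (-s) := by
  have hs1 : s ≠ 1 := fun h => by simp [h] at hs
  have hs1' : s - 1 ≠ 0 := sub_ne_zero_of_ne hs1
  have h1 : riemannZeta s = s * ∫ t in Set.Ioi (1 : ℝ), ((⌊t⌋₊ : ℝ) : ℂ) * (t:ℂ) ^ (-(s + 1)) := by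
    rw [← LSeries_one_eq_riemannZeta hs]
    have := LSeries_eq_mul_integral (1 : ℕ → ℂ) (r := 1) zero_le_one hs (LSeriesSummable_one_iff.mpr hs) ?_
    · rw [this]
      simp
    · refine Asymptotics.IsBigO.of_bound 1 (Filter.Eventually.of_forall fun n => ?_)
      simp
  have i1 : MeasureTheory.IntegrableOn (fun t : ℝ => (t:ℂ) ^ (-s)) (Set.Ioi 1) :=
    integrableOn_Ioi_cpow_of_lt (by simpa using hs) zero_lt_one
  have i2 : MeasureTheory.IntegrableOn (fun t : ℝ => ((Int.fract t : ℝ) : ℂ) * (t : ℂ) ^ (-(s + 1))) (Set.Ioi 1) := by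
    refine MeasureTheory.Integrable.bdd_mul (c := 1) (integrableOn_Ioi_cpow_of_lt (by simp; linarith) zero_lt_one) ?_ ?_
    · exact (Complex.measurable_ofReal.comp measurable_fract).aestronglyMeasurable
    · refine Filter.Eventually.of_forall fun t => ?_
      rw [Complex.norm_real, norm_of_nonneg (Int.fract_nonneg t)]
      exact (Int.fract_lt_one t).le
  have h2 : ∫ t in Set.Ioi (1 : ℝ), ((⌊t⌋₊ : ℝ) : ℂ) * (t:ℂ) ^ (-(s + 1))
      = 1 / (s - 1) - mellin fractTail (-s) := by
    have : 1 / (s - 1) = ∫ t in Set.Ioi (1 : ℝ), (t:ℂ) ^ (-s) := by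
      rw [integral_Ioi_cpow_of_lt (by simpa using hs) zero_lt_one]
      simp only [Complex.ofReal_one, Complex.one_cpow]
      rw [show -s + 1 = -(s-1) by ring, neg_div_neg_eq]
    rw [this, mellin_fractTail_eq, ← MeasureTheory.integral_sub i1 i2]
    refine MeasureTheory.setIntegral_congr_fun measurableSet_Ioi fun t ht => ?_
    have ht' : (1:ℝ) < t := ht
    have ht0 : (t:ℂ) ≠ 0 := by exact_mod_cast (by linarith : t ≠ 0)
    have e1 : (t:ℂ) ^ (-s) = t * (t:ℂ) ^ (-(s+1)) := by
      rw [show -s = 1 + -(s+1) by ring, Complex.cpow_add _ _ ht0, Complex.cpow_one]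
    have e2 : ((⌊t⌋₊ : ℝ)) = t - Int.fract t := by
      rw [natCast_floor_eq_intCast_floor (by linarith)]
      exact (Int.self_sub_fract t).symm
    rw [e1, e2]; push_cast; ring
  have h3 := riemannZeta_eq_inv_sub_mul hs1
  have : riemannZeta₁ s = (s-1) * riemannZeta s := by rw [h3]; field_simp
  rw [this, h1, h2]; field_simp

lemma riemannZeta₁_eq_of_re_pos {s : ℂ} (hs : 0 < s.re) :
    riemannZeta₁ s = s - s * (s - 1) * mellin fractTail (-s) := by
  have hU : IsOpen {s : ℂ | 0 < s.re} := isOpen_lt continuous_const Complex.continuous_re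
  have hpre : IsPreconnected {s : ℂ | 0 < s.re} := (convex_halfSpace_re_gt 0).isPreconnected
  have hd : DifferentiableOn ℂ (fun s : ℂ => s - s * (s - 1) * mellin fractTail (-s)) {s : ℂ | 0 < s.re} := by
    intro z hz
    have h1 : DifferentiableAt ℂ (fun s : ℂ => mellin fractTail (-s)) z :=
      (differentiableAt_mellin_fractTail hz).comp z differentiableAt_id.neg
    exact DifferentiableAt.differentiableWithinAt (by fun_prop)
  refine AnalyticOnNhd.eqOn_of_preconnected_of_eventuallyEq
    (differentiable_riemannZeta₁.differentiableOn.analyticOnNhd hU) (hd.analyticOnNhd hU)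
    hpre (z₀ := 2) (by simp) ?_ hs
  have : {s : ℂ | 1 < s.re} ∈ nhds (2:ℂ) := (isOpen_lt continuous_const Complex.continuous_re).mem_nhds (by simp)
  filter_upwards [this] with z hz using riemannZeta₁_eq_of_one_lt_re hz

lemma norm_riemannZeta₁_le {s : ℂ} (hs : 1 / 2 ≤ s.re) : ‖riemannZeta₁ s‖ ≤ 3 * (1 + ‖s‖) ^ 2 := by
  rw [riemannZeta₁_eq_of_re_pos (by linarith)]
  have h1 := norm_mellin_fractTail_le hs
  calc _ ≤ ‖s‖ + ‖s * (s - 1) * mellin fractTail (-s)‖ := norm_sub_le _ _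
    _ = ‖s‖ + ‖s‖ * ‖s - 1‖ * ‖mellin fractTail (-s)‖ := by rw [norm_mul, norm_mul]
    _ ≤ ‖s‖ + ‖s‖ * (‖s‖ + 1) * 2 := by
        gcongr
        simpa using norm_sub_le s 1
    _ ≤ _ := by nlinarith [norm_nonneg s]

lemma norm_deriv_riemannZeta₁_le {s : ℂ} (hs : 3 / 4 ≤ s.re) :
    ‖deriv riemannZeta₁ s‖ ≤ 48 * (1 + ‖s‖) ^ 2 := by
  have := Complex.norm_deriv_le_of_forall_mem_sphere_norm_le (c := s) (R := 1/4)
    (C := 12 * (1 + ‖s‖) ^ 2) (by norm_num) differentiable_riemannZeta₁.diffContOnCl ?_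
  · linarith
  · intro z hz
    rw [mem_sphere_iff_norm] at hz
    have h1 : |(z - s).re| ≤ 1/4 := hz ▸ Complex.abs_re_le_norm _
    have h2 : ‖z‖ ≤ ‖s‖ + 1/4 := by
      calc ‖z‖ = ‖s + (z - s)‖ := by ring_nf
        _ ≤ _ := by rw [← hz]; exact norm_add_le _ _
    rw [Complex.sub_re] at h1
    refine (norm_riemannZeta₁_le (by linarith [abs_le.mp h1])).trans ?_
    nlinarith [norm_nonneg s, norm_nonneg z]

lemma norm_deriv_deriv_riemannZeta₁_le {s : ℂ} (hs : 1 ≤ s.re) :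
    ‖deriv (deriv riemannZeta₁) s‖ ≤ 768 * (1 + ‖s‖) ^ 2 := by
  have := Complex.norm_deriv_le_of_forall_mem_sphere_norm_le (c := s) (R := 1/4)
    (C := 192 * (1 + ‖s‖) ^ 2) (by norm_num) differentiable_riemannZeta₁.deriv.diffContOnCl ?_
  · linarith
  · intro z hz
    rw [mem_sphere_iff_norm] at hz
    have h1 : |(z - s).re| ≤ 1/4 := hz ▸ Complex.abs_re_le_norm _
    have h2 : ‖z‖ ≤ ‖s‖ + 1/4 := by
      calc ‖z‖ = ‖s + (z - s)‖ := by ring_nf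
        _ ≤ _ := by rw [← hz]; exact norm_add_le _ _
    rw [Complex.sub_re] at h1
    refine (norm_deriv_riemannZeta₁_le (by linarith [abs_le.mp h1])).trans ?_
    nlinarith [norm_nonneg s, norm_nonneg z]

lemma one_add_norm_le {σ t : ℝ} (h1 : 1 ≤ σ) (h2 : σ ≤ 2) :
    1 + ‖(σ : ℂ) + t * Complex.I‖ ≤ 3 * (1 + |t|) := by
  have : ‖(σ : ℂ) + t * Complex.I‖ ≤ σ + |t| := by
    refine (norm_add_le _ _).trans ?_
    simp [abs_of_nonneg (by linarith : 0 ≤ σ)]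
  linarith [abs_nonneg t]

lemma norm_riemannZeta₁_strip_le {σ t : ℝ} (h1 : 1 ≤ σ) (h2 : σ ≤ 2) :
    ‖riemannZeta₁ (σ + t * Complex.I)‖ ≤ 27 * (1 + |t|) ^ 2 := by
  refine (norm_riemannZeta₁_le (by simp; linarith)).trans ?_
  have := one_add_norm_le (t := t) h1 h2
  have h0 := norm_nonneg ((σ : ℂ) + t * Complex.I)
  calc _ ≤ 3 * (3 * (1 + |t|)) ^ 2 := by gcongr
    _ = _ := by ring

lemma norm_deriv_riemannZeta₁_strip_le {σ t : ℝ} (h1 : 1 ≤ σ) (h2 : σ ≤ 2) :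
    ‖deriv riemannZeta₁ (σ + t * Complex.I)‖ ≤ 432 * (1 + |t|) ^ 2 := by
  refine (norm_deriv_riemannZeta₁_le (by simp; linarith)).trans ?_
  have := one_add_norm_le (t := t) h1 h2
  have h0 := norm_nonneg ((σ : ℂ) + t * Complex.I)
  calc _ ≤ 48 * (3 * (1 + |t|)) ^ 2 := by gcongr
    _ = _ := by ring

lemma norm_deriv_deriv_riemannZeta₁_strip_le {σ t : ℝ} (h1 : 1 ≤ σ) (h2 : σ ≤ 2) :
    ‖deriv (deriv riemannZeta₁) (σ + t * Complex.I)‖ ≤ 6912 * (1 + |t|) ^ 2 := by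
  refine (norm_deriv_deriv_riemannZeta₁_le (by simp; linarith)).trans ?_
  have := one_add_norm_le (t := t) h1 h2
  have h0 := norm_nonneg ((σ : ℂ) + t * Complex.I)
  calc _ ≤ 768 * (3 * (1 + |t|)) ^ 2 := by gcongr
    _ = _ := by ring

lemma riemannZeta₁_ne_zero {s : ℂ} (hs : 1 ≤ s.re) : riemannZeta₁ s ≠ 0 := by
  by_cases h : s = 1
  · simp [h]
  · intro h0
    have := riemannZeta_eq_inv_sub_mul h
    rw [h0, mul_zero] at this
    exact riemannZeta_ne_zero_of_one_le_re hs this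

lemma one_le_mul_norm_riemannZeta₁_pow_four {x t : ℝ} (hx : 0 < x) (hx1 : x ≤ 1) (ht : 1 ≤ |t|) :
    x ^ 3 ≤ (27 ^ 3 * 108) * (1 + |t|) ^ 2 * ‖riemannZeta₁ ((1 + x : ℝ) + t * Complex.I)‖ ^ 4 := by
  have h := DirichletCharacter.norm_LFunction_product_ge_one (1 : DirichletCharacter ℂ 1) hx t
  simp only [DirichletCharacter.LFunctionTrivChar, one_pow, DirichletCharacter.LFunction_modOne_eq] at h
  rw [norm_mul, norm_mul, norm_pow, norm_pow] at h
  have key : ∀ u : ℝ, 1 ≤ |u| → ‖riemannZeta ((1 + x : ℝ) + u * Complex.I)‖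
      ≤ ‖riemannZeta₁ ((1 + x : ℝ) + u * Complex.I)‖ := by
    intro u hu
    have him : |u| ≤ ‖((1 + x : ℝ) + u * Complex.I : ℂ) - 1‖ := by
      simpa using Complex.abs_im_le_norm (((1 + x : ℝ) + u * Complex.I : ℂ) - 1)
    have hne : ((1 + x : ℝ) + u * Complex.I : ℂ) ≠ 1 := by
      intro h; rw [h] at him; simp at him; rw [him] at hu; simp at hu; linarith
    rw [riemannZeta_eq_inv_sub_mul hne, norm_mul, norm_inv]
    have : ‖((1 + x : ℝ) + u * Complex.I : ℂ) - 1‖⁻¹ ≤ 1 := inv_le_one_of_one_le₀ (hu.trans him)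
    exact mul_le_of_le_one_left (norm_nonneg _) this
  have k1 : ‖riemannZeta (1 + x)‖ ≤ 27 / x := by
    have hne : (1 + x : ℂ) ≠ 1 := by simp [hx.ne']
    rw [riemannZeta_eq_inv_sub_mul hne, norm_mul, norm_inv]
    have := norm_riemannZeta₁_strip_le (σ := 1 + x) (t := 0) (by linarith) (by linarith)
    simp at this
    have e : ‖(1 + x : ℂ) - 1‖ = x := by simp [abs_of_pos hx]
    rw [e, div_eq_inv_mul]
    gcongr
  have k2 : ‖riemannZeta (1 + x + Complex.I * t)‖ ≤ ‖riemannZeta₁ ((1 + x : ℝ) + t * Complex.I)‖ := by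
    have := key t ht
    rwa [show (1 + x + Complex.I * t : ℂ) = ((1 + x : ℝ) + t * Complex.I : ℂ) by push_cast; ring]
  have k3 : ‖riemannZeta (1 + x + 2 * Complex.I * t)‖ ≤ 108 * (1 + |t|) ^ 2 := by
    have h2 : |2 * t| = 2 * |t| := by simp [abs_mul]
    have := (key (2 * t) (by rw [h2]; linarith)).trans
      (norm_riemannZeta₁_strip_le (by linarith) (by linarith))
    rw [h2] at this
    rw [show (1 + x + 2 * Complex.I * t : ℂ) = ((1 + x : ℝ) + (2 * t : ℝ) * Complex.I : ℂ) by push_cast; ring]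
    nlinarith [abs_nonneg t]
  have : (1:ℝ) ≤ (27 / x) ^ 3 * ‖riemannZeta₁ ((1 + x : ℝ) + t * Complex.I)‖ ^ 4 * (108 * (1 + |t|) ^ 2) := by
    refine (ge_iff_le.mp h).trans ?_
    gcongr
  have hx3 : 0 < x ^ 3 := by positivity
  calc x ^ 3 = x ^ 3 * 1 := by ring
    _ ≤ x ^ 3 * ((27 / x) ^ 3 * ‖riemannZeta₁ ((1 + x : ℝ) + t * Complex.I)‖ ^ 4 * (108 * (1 + |t|) ^ 2)) := by gcongr
    _ = _ := by field_simp

lemma norm_riemannZeta₁_sub_le {a b t : ℝ} (ha : 1 ≤ a) (hb : b ≤ 2) (hab : a ≤ b) :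
    ‖riemannZeta₁ (b + t * Complex.I) - riemannZeta₁ (a + t * Complex.I)‖
      ≤ 432 * (1 + |t|) ^ 2 * (b - a) := by
  have := Convex.norm_image_sub_le_of_norm_deriv_le (𝕜 := ℝ) (f := fun σ : ℝ => riemannZeta₁ (σ + t * Complex.I))
    (s := Set.Icc 1 2) (C := 432 * (1 + |t|) ^ 2) (x := a) (y := b) ?_ ?_ (convex_Icc 1 2)
    ⟨ha, hab.trans hb⟩ ⟨ha.trans hab, hb⟩
  · simpa [abs_of_nonneg (sub_nonneg.mpr hab)] using this
  · intro x _
    have h1 : HasDerivAt (fun σ : ℝ => (σ : ℂ) + t * Complex.I) 1 x :=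
      (Complex.ofRealCLM.hasDerivAt (x := x)).add_const _
    exact ((differentiable_riemannZeta₁ _).hasDerivAt.comp x h1).differentiableAt
  · intro x hx
    have h1 : HasDerivAt (fun σ : ℝ => (σ : ℂ) + t * Complex.I) 1 x :=
      (Complex.ofRealCLM.hasDerivAt (x := x)).add_const _
    have h2 : HasDerivAt (fun σ : ℝ => riemannZeta₁ (σ + t * Complex.I)) _ x :=
      (differentiable_riemannZeta₁ _).hasDerivAt.comp x h1
    rw [h2.deriv, mul_one]
    exact norm_deriv_riemannZeta₁_strip_le hx.1 hx.2

lemma exists_le_norm_riemannZeta₁ : ∃ c : ℝ, 0 < c ∧ ∀ σ t : ℝ, 1 < σ → σ ≤ 2 →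
    c ≤ ‖riemannZeta₁ (σ + t * Complex.I)‖ * (1 + |t|) ^ 8 := by
  obtain ⟨c₁, hc₁, H₁⟩ : ∃ c : ℝ, 0 < c ∧ ∀ p ∈ Set.Icc (1:ℝ) 2 ×ˢ Set.Icc (-1:ℝ) 1,
      c ≤ ‖riemannZeta₁ (p.1 + p.2 * Complex.I)‖ := by
    have hK : IsCompact (Set.Icc (1:ℝ) 2 ×ˢ Set.Icc (-1:ℝ) 1) := isCompact_Icc.prod isCompact_Icc
    have hcont : ContinuousOn (fun p : ℝ × ℝ => ‖riemannZeta₁ (p.1 + p.2 * Complex.I)‖)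
        (Set.Icc (1:ℝ) 2 ×ˢ Set.Icc (-1:ℝ) 1) := by
      have := differentiable_riemannZeta₁.continuous
      fun_prop
    obtain ⟨p, hp, hmin⟩ := hK.exists_isMinOn ⟨(1, 0), by simp⟩ hcont
    refine ⟨_, norm_pos_iff.mpr (riemannZeta₁_ne_zero (s := p.1 + p.2 * Complex.I) ?_), fun q hq => hmin hq⟩
    simpa using hp.1.1
  set c₀ : ℝ := 1 / (27 ^ 3 * 108) with hc₀
  set κ : ℝ := c₀ / (16 * 432 ^ 4) with hκ
  have hκ0 : 0 < κ := by positivity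
  have hκ1 : κ ≤ 1 := by rw [hκ, hc₀]; norm_num
  refine ⟨min c₁ (432 * κ), by positivity, fun σ t h1 h2 => ?_⟩
  by_cases ht : |t| ≤ 1
  · refine (min_le_left _ _).trans ((H₁ (σ, t) ⟨⟨h1.le, h2⟩, abs_le.mp ht⟩).trans ?_)
    refine le_mul_of_one_le_right (norm_nonneg _) (one_le_pow₀ ?_)
    linarith [abs_nonneg t]
  · push Not at ht
    refine (min_le_right _ _).trans ?_
    set w := 1 + |t| with hw
    have hw1 : 1 ≤ w := by linarith
    have hw0 : 0 < w := by linarith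
    set δ := κ / w ^ 10 with hδ
    have hδ0 : 0 < δ := by positivity
    have hδ1 : δ ≤ 1 := (div_le_one (by positivity)).mpr (hκ1.trans (one_le_pow₀ hw1))
    -- the bound away from the line
    have far : ∀ x, δ ≤ x → x ≤ 1 → 2 * 432 * w ^ 2 * δ ≤ ‖riemannZeta₁ ((1 + x : ℝ) + t * Complex.I)‖ := by
      intro x hx hx1
      have h := one_le_mul_norm_riemannZeta₁_pow_four (hδ0.trans_le hx) hx1 ht.le
      rw [← hw] at h
      refine le_of_pow_le_pow_left₀ (n := 4) (by norm_num) (norm_nonneg _) ?_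
      have h3 : δ ^ 3 ≤ x ^ 3 := by gcongr
      have hd : δ * w ^ 10 = κ := by rw [hδ]; field_simp
      have h4 : δ ^ 3 ≤ (27 ^ 3 * 108) * w ^ 2 * ‖riemannZeta₁ ((1 + x : ℝ) + t * Complex.I)‖ ^ 4 := h3.trans h
      have h5 : (27 ^ 3 * 108) * w ^ 2 * (2 * 432 * w ^ 2 * δ) ^ 4 = δ ^ 3 := by
        calc _ = (27 ^ 3 * 108 * (16 * 432 ^ 4)) * (δ * w ^ 10) * δ ^ 3 := by ring
          _ = δ ^ 3 := by rw [hd, hκ, hc₀]; field_simp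
      rw [← h5] at h4
      exact le_of_mul_le_mul_left h4 (by positivity)
    have main : 432 * w ^ 2 * δ ≤ ‖riemannZeta₁ (σ + t * Complex.I)‖ := by
      by_cases hx : δ ≤ σ - 1
      · have := far (σ - 1) hx (by linarith)
        rw [show 1 + (σ - 1) = σ by ring] at this
        refine le_trans ?_ this
        nlinarith [show 0 < w ^ 2 * δ by positivity]
      · push Not at hx
        have h5 := far δ le_rfl hδ1
        have h6 := norm_riemannZeta₁_sub_le (t := t) h1.le (b := 1 + δ) (by linarith) (by linarith)
        have h7 := norm_sub_norm_le (riemannZeta₁ ((1 + δ : ℝ) + t * Complex.I)) (riemannZeta₁ (σ + t * Complex.I))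
        have h8 : 432 * w ^ 2 * (1 + δ - σ) ≤ 432 * w ^ 2 * δ := by gcongr; linarith
        linarith
    calc 432 * κ = 432 * w ^ 2 * δ * w ^ 8 := by rw [hδ]; field_simp
      _ ≤ _ := by gcongr

/-- The regular part `-(ζ'/ζ)(s)/s - 1/(s-1)`. -/
noncomputable def zetaLogDerivReg (s : ℂ) : ℂ := -(1 + deriv riemannZeta₁ s / riemannZeta₁ s) / s

lemma zetaLogDerivReg_eq {s : ℂ} (hs : 1 < s.re) :
    zetaLogDerivReg s = -deriv riemannZeta s / riemannZeta s / s - 1 / (s - 1) := by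
  have h1 : s ≠ 1 := fun h => by simp [h] at hs
  have h0 : s ≠ 0 := fun h => by simp [h] at hs; linarith
  have h1' := sub_ne_zero_of_ne h1
  have hz := riemannZeta₁_ne_zero hs.le
  rw [deriv_riemannZeta_eq_neg_inv_sub_sq_mul_add h1, riemannZeta_eq_inv_sub_mul h1, zetaLogDerivReg]
  field_simp
  ring

/-- The derivative of `zetaLogDerivReg`. -/
noncomputable def zetaLogDerivReg' (s : ℂ) : ℂ :=
  (1 + deriv riemannZeta₁ s / riemannZeta₁ s) / s ^ 2
    - (deriv (deriv riemannZeta₁) s / riemannZeta₁ s - (deriv riemannZeta₁ s / riemannZeta₁ s) ^ 2) / s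

lemma hasDerivAt_zetaLogDerivReg {s : ℂ} (hs : 1 < s.re) :
    HasDerivAt zetaLogDerivReg (zetaLogDerivReg' s) s := by
  have h0 : s ≠ 0 := fun h => by simp [h] at hs; linarith
  have hz := riemannZeta₁_ne_zero hs.le
  have h1 := (differentiable_riemannZeta₁ s).hasDerivAt
  have h2 := (differentiable_riemannZeta₁.deriv s).hasDerivAt
  have := (((h2.div h1 hz).const_add 1).neg).div (hasDerivAt_id s) h0
  refine HasDerivAt.congr_deriv (f := zetaLogDerivReg) this ?_
  simp only [zetaLogDerivReg', id, Pi.neg_apply, Pi.div_apply]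
  field_simp
  ring

lemma exists_norm_zetaLogDerivReg_le : ∃ C : ℝ, 0 < C ∧ ∀ σ t : ℝ, 1 < σ → σ ≤ 2 →
    ‖zetaLogDerivReg (σ + t * Complex.I)‖ ≤ C * (1 + |t|) ^ 20 ∧
    ‖zetaLogDerivReg' (σ + t * Complex.I)‖ ≤ C * (1 + |t|) ^ 20 := by
  obtain ⟨c, hc, H⟩ := exists_le_norm_riemannZeta₁
  refine ⟨2 * (1 + 432 / c) ^ 2 + 6912 / c, by positivity, fun σ t h1 h2 => ?_⟩
  set s : ℂ := σ + t * Complex.I with hs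
  have hre : s.re = σ := by simp [hs]
  set w := 1 + |t| with hw
  have hw1 : 1 ≤ w := by linarith [abs_nonneg t]
  have hw0 : 0 < w := by linarith
  have hn : 1 ≤ ‖s‖ := by
    have := Complex.abs_re_le_norm s
    rw [hre, abs_of_pos (by linarith)] at this; linarith
  have hZ := H σ t h1 h2
  rw [← hs, ← hw] at hZ
  have hZ0 : 0 < ‖riemannZeta₁ s‖ := norm_pos_iff.mpr (riemannZeta₁_ne_zero (by linarith))
  have hd := norm_deriv_riemannZeta₁_strip_le (t := t) h1.le h2
  have hdd := norm_deriv_deriv_riemannZeta₁_strip_le (t := t) h1.le h2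
  rw [← hs, ← hw] at hd hdd
  have q1 : ‖deriv riemannZeta₁ s / riemannZeta₁ s‖ ≤ 432 / c * w ^ 10 := by
    rw [norm_div, div_le_iff₀ hZ0]
    calc _ ≤ 432 * w ^ 2 := hd
      _ = 432 / c * w ^ 2 * c := by field_simp
      _ ≤ 432 / c * w ^ 2 * (‖riemannZeta₁ s‖ * w ^ 8) := by gcongr
      _ = _ := by ring
  have q2 : ‖deriv (deriv riemannZeta₁) s / riemannZeta₁ s‖ ≤ 6912 / c * w ^ 10 := by
    rw [norm_div, div_le_iff₀ hZ0]
    calc _ ≤ 6912 * w ^ 2 := hdd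
      _ = 6912 / c * w ^ 2 * c := by field_simp
      _ ≤ 6912 / c * w ^ 2 * (‖riemannZeta₁ s‖ * w ^ 8) := by gcongr
      _ = _ := by ring
  have hw10 : 1 ≤ w ^ 10 := one_le_pow₀ hw1
  have e20 : w ^ 20 = w ^ 10 * w ^ 10 := by ring
  have q3 : ‖1 + deriv riemannZeta₁ s / riemannZeta₁ s‖ ≤ (1 + 432 / c) * w ^ 10 := by
    refine (norm_add_le _ _).trans ?_
    rw [norm_one]; nlinarith
  have hA : 1 ≤ 1 + 432 / c := by linarith [show 0 < 432 / c by positivity]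
  have hB : 0 < 6912 / c := by positivity
  constructor
  · rw [zetaLogDerivReg, norm_div, norm_neg]
    refine (div_le_self (norm_nonneg _) hn).trans (q3.trans ?_)
    rw [e20, ← mul_assoc]
    have hAA : 1 + 432 / c ≤ 2 * (1 + 432 / c) ^ 2 + 6912 / c := by nlinarith
    calc (1 + 432 / c) * w ^ 10 = (1 + 432 / c) * w ^ 10 * 1 := by ring
      _ ≤ (2 * (1 + 432 / c) ^ 2 + 6912 / c) * w ^ 10 * w ^ 10 :=
        mul_le_mul (mul_le_mul_of_nonneg_right hAA (by positivity)) hw10 zero_le_one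
          (by positivity)
  · rw [zetaLogDerivReg']
    refine (norm_sub_le _ _).trans ?_
    have r1 : ‖(1 + deriv riemannZeta₁ s / riemannZeta₁ s) / s ^ 2‖ ≤ (1 + 432 / c) * w ^ 10 := by
      rw [norm_div]
      refine (div_le_self (norm_nonneg _) ?_).trans q3
      rw [norm_pow]; exact one_le_pow₀ hn
    have r2 : ‖(deriv (deriv riemannZeta₁) s / riemannZeta₁ s
        - (deriv riemannZeta₁ s / riemannZeta₁ s) ^ 2) / s‖
        ≤ 6912 / c * w ^ 10 + (432 / c * w ^ 10) ^ 2 := by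
      rw [norm_div]
      refine (div_le_self (norm_nonneg _) hn).trans ((norm_sub_le _ _).trans ?_)
      rw [norm_pow]
      gcongr
    have hD : 0 < 432 / c := by positivity
    calc _ ≤ (1 + 432 / c) * w ^ 10 + (6912 / c * w ^ 10 + (432 / c * w ^ 10) ^ 2) := add_le_add r1 r2
      _ ≤ (1 + 432 / c) * (w ^ 10 * w ^ 10) + (6912 / c * (w ^ 10 * w ^ 10) + (432 / c) ^ 2 * (w ^ 10 * w ^ 10)) := by
        have : w ^ 10 ≤ w ^ 10 * w ^ 10 := le_mul_of_one_le_right (by positivity) hw10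
        gcongr
        apply le_of_eq; ring
      _ ≤ _ := by
        rw [e20]
        have : 0 < w ^ 10 * w ^ 10 := by positivity
        nlinarith [mul_pos hD this, mul_pos (mul_pos hD hD) this]

/-- The normalised error term `ψ(e^v) e^{-v} - 1` in the prime number theorem. -/
noncomputable def psiErr (v : ℝ) : ℝ := Chebyshev.psi (exp v) * exp (-v) - 1

lemma measurable_psiErr : Measurable psiErr := by
  unfold psiErr
  exact ((Chebyshev.psi_mono.measurable.comp measurable_exp).mul (by fun_prop)).sub_const 1

lemma abs_psiErr_le (v : ℝ) : |psiErr v| ≤ 6 := by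
  have h1 := Chebyshev.psi_le_const_mul_self (exp_pos v).le
  have h2 := Chebyshev.psi_nonneg (exp v)
  have h4 : log 4 ≤ 2 := by
    rw [show (4:ℝ) = 2 ^ 2 by norm_num, log_pow]
    have := log_two_lt_d9
    norm_num; linarith
  have e1 : exp v * exp (-v) = 1 := by rw [← exp_add]; simp
  have h3 : Chebyshev.psi (exp v) * exp (-v) ≤ log 4 + 4 := by
    calc _ ≤ (log 4 + 4) * exp v * exp (-v) := by gcongr
      _ = _ := by rw [mul_assoc, e1, mul_one]
  have h5 : 0 ≤ Chebyshev.psi (exp v) * exp (-v) := by positivity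
  rw [psiErr, abs_le]
  constructor <;> linarith

lemma norm_cexp_neg_mul_ofReal (z : ℂ) (v : ℝ) : ‖Complex.exp (-z * v)‖ = exp (-z.re * v) := by
  rw [Complex.norm_exp]; simp

lemma integrableOn_psiErr_mul_cexp {z : ℂ} (hz : 0 < z.re) :
    MeasureTheory.IntegrableOn (fun v : ℝ => (psiErr v : ℂ) * Complex.exp (-z * v)) (Set.Ioi 0) := by
  have h := (exp_neg_integrableOn_Ioi 0 hz).const_mul 6
  refine h.mono' ?_ ?_
  · exact ((Complex.measurable_ofReal.comp measurable_psiErr).mul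
      (by fun_prop)).aestronglyMeasurable
  · filter_upwards with v
    rw [norm_mul, norm_cexp_neg_mul_ofReal, Complex.norm_real]
    gcongr
    exact abs_psiErr_le v

lemma exp_image_Ioi_zero : Real.exp '' Set.Ioi 0 = Set.Ioi 1 := by
  ext x
  simp only [Set.mem_image, Set.mem_Ioi]
  constructor
  · rintro ⟨y, hy, rfl⟩
    exact one_lt_exp_iff.mpr hy
  · intro hx
    exact ⟨log x, log_pos hx, exp_log (by linarith)⟩

lemma psi_eq_sum_Icc_one (x : ℝ) :
    Chebyshev.psi x = ∑ n ∈ Icc 1 ⌊x⌋₊, ArithmeticFunction.vonMangoldt n := by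
  rw [Chebyshev.psi]
  refine Finset.sum_congr ?_ fun _ _ => rfl
  ext; simp; omega

lemma integral_psiErr_mul_cexp {s : ℂ} (hs : 1 < s.re) :
    ∫ v in Set.Ioi (0 : ℝ), (psiErr v : ℂ) * Complex.exp (-(s - 1) * v) = zetaLogDerivReg s := by
  have h0 : s ≠ 0 := fun h => by simp [h] at hs; linarith
  have hd : ∀ x ∈ Set.Ioi (0:ℝ), HasDerivWithinAt Real.exp (Real.exp x) (Set.Ioi 0) x :=
    fun x _ => (Real.hasDerivAt_exp x).hasDerivWithinAt
  have hinj : Set.InjOn Real.exp (Set.Ioi 0) := Real.exp_injective.injOn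
  -- the substitution `x = e^v`
  set F : ℝ → ℂ := fun x => ((Chebyshev.psi x - x : ℝ) : ℂ) * (x : ℂ) ^ (-(s + 1)) with hF
  have hpt : ∀ v : ℝ, |Real.exp v| • F (Real.exp v) = (psiErr v : ℂ) * Complex.exp (-(s - 1) * v) := by
    intro v
    have e1 : ((Real.exp v : ℝ) : ℂ) ^ (-(s + 1)) = Complex.exp (-(s + 1) * v) := by
      rw [Complex.cpow_def_of_ne_zero (by exact_mod_cast (exp_pos v).ne'), ← Complex.ofReal_log (exp_pos v).le,
        log_exp, mul_comm]
    have e2 : Complex.exp (-(s + 1) * v) = Complex.exp (-(s - 1) * v) * Complex.exp (-v) * Complex.exp (-v) := by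
      rw [← Complex.exp_add, ← Complex.exp_add]; congr 1; ring
    have e3 : Complex.exp v * Complex.exp (-v) = 1 := by rw [← Complex.exp_add]; simp
    rw [hF, abs_of_pos (exp_pos v), Complex.real_smul]
    simp only [psiErr]
    rw [e1, e2]
    push_cast
    linear_combination (Complex.exp (-(s - 1) * v) * (Chebyshev.psi (exp v) * Complex.exp (-v)
      - 1 - Complex.exp v * Complex.exp (-v))) * e3
  have hsub : ∫ x in Set.Ioi (1:ℝ), F x
      = ∫ v in Set.Ioi (0 : ℝ), (psiErr v : ℂ) * Complex.exp (-(s - 1) * v) := by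
    rw [← exp_image_Ioi_zero, MeasureTheory.integral_image_eq_integral_abs_deriv_smul
      measurableSet_Ioi hd hinj]
    simp_rw [hpt]
  have hFint : MeasureTheory.IntegrableOn F (Set.Ioi 1) := by
    rw [← exp_image_Ioi_zero, MeasureTheory.integrableOn_image_iff_integrableOn_abs_deriv_smul
      measurableSet_Ioi hd hinj]
    simp_rw [hpt]
    exact integrableOn_psiErr_mul_cexp (by simpa using hs)
  have hpow : MeasureTheory.IntegrableOn (fun x : ℝ => (x : ℂ) ^ (-s)) (Set.Ioi 1) :=
    integrableOn_Ioi_cpow_of_lt (by simpa using hs) one_pos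
  have hpowi : ∫ x in Set.Ioi (1:ℝ), (x : ℂ) ^ (-s) = 1 / (s - 1) := by
    rw [integral_Ioi_cpow_of_lt (by simpa using hs) one_pos]
    have : s - 1 ≠ 0 := sub_ne_zero_of_ne (fun h => by simp [h] at hs)
    have h' : -s + 1 ≠ 0 := by intro h; apply this; linear_combination -h
    simp
    field_simp
    ring
  have hL := LSeries_eq_mul_integral_of_nonneg (fun n => ArithmeticFunction.vonMangoldt n) zero_le_one hs
    (by
      refine Asymptotics.IsBigO.of_bound (log 4 + 4) ?_
      filter_upwards with n
      have := Chebyshev.psi_le_const_mul_self (Nat.cast_nonneg n)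
      rw [psi_eq_sum_Icc_one, Nat.floor_natCast] at this
      rw [Real.norm_eq_abs, abs_of_nonneg (Finset.sum_nonneg fun _ _ => ArithmeticFunction.vonMangoldt_nonneg)]
      simpa using this)
    (fun n => ArithmeticFunction.vonMangoldt_nonneg)
  rw [ArithmeticFunction.LSeries_vonMangoldt_eq_deriv_riemannZeta_div hs] at hL
  rw [← hsub, zetaLogDerivReg_eq hs, hL, mul_div_cancel_left₀ _ h0, ← hpowi]
  rw [eq_sub_iff_add_eq, ← MeasureTheory.integral_add hFint hpow]
  refine MeasureTheory.setIntegral_congr_fun measurableSet_Ioi fun x hx => ?_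
  have hx0 : (0:ℝ) < x := lt_trans one_pos hx
  have hx' : (x : ℂ) ≠ 0 := by exact_mod_cast hx0.ne'
  have e1 : (x : ℂ) ^ (-s) = x * (x : ℂ) ^ (-(s + 1)) := by
    rw [neg_add, ← sub_eq_add_neg, Complex.cpow_sub _ _ hx', Complex.cpow_one]; field_simp
  have e2 : (∑ k ∈ Icc 1 ⌊x⌋₊, ((ArithmeticFunction.vonMangoldt k : ℝ) : ℂ)) = (Chebyshev.psi x : ℂ) := by
    rw [psi_eq_sum_Icc_one]
    push_cast
    rfl
  simp only [hF]
  rw [e1, e2]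
  push_cast
  ring

lemma one_add_abs_pow_mul_exp_le {T : ℝ} (hT : 1 ≤ T) (t : ℝ) :
    (1 + |t|) ^ 21 * exp (-(1 / (2 * T ^ 2)) * t ^ 2)
      ≤ 84 ^ 21 * T ^ 21 * exp (-(1 / (4 * T ^ 2)) * t ^ 2) := by
  have hT0 : 0 < T := by linarith
  have h1 : 1 + |t| ≤ T * (84 * exp ((t / T) ^ 2 / 84)) := by
    have h2 := add_one_le_exp ((t / T) ^ 2 / 84)
    have h3 : |t| = T * |t / T| := by rw [abs_div, abs_of_pos hT0]; field_simp
    have h4 : 1 + |t / T| ≤ 84 * exp ((t / T) ^ 2 / 84) := by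
      nlinarith [sq_abs (t / T), sq_nonneg (|t / T| - 1)]
    rw [h3]
    calc 1 + T * |t / T| ≤ T * (1 + |t / T|) := by nlinarith
      _ ≤ _ := by gcongr
  have e : exp ((t / T) ^ 2 / 84) ^ 21 = exp ((t / T) ^ 2 / 4) := by
    rw [← exp_nat_mul]; congr 1; push_cast; ring
  calc _ ≤ (T * (84 * exp ((t / T) ^ 2 / 84))) ^ 21 * exp (-(1 / (2 * T ^ 2)) * t ^ 2) := by gcongr
    _ = 84 ^ 21 * T ^ 21 * (exp ((t / T) ^ 2 / 84) ^ 21 * exp (-(1 / (2 * T ^ 2)) * t ^ 2)) := by ring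
    _ = _ := by
      rw [e, ← exp_add]; congr 2; field_simp; ring

lemma measurable_zetaLogDerivReg' : Measurable zetaLogDerivReg' := by
  have h0 := differentiable_riemannZeta₁.continuous.measurable
  have h1 := differentiable_riemannZeta₁.deriv.continuous.measurable
  have h2 := differentiable_riemannZeta₁.deriv.deriv.continuous.measurable
  unfold zetaLogDerivReg'
  fun_prop

lemma exists_norm_integral_gaussian_mul_zetaLogDerivReg_le : ∃ C : ℝ, 0 < C ∧ ∀ T u ε : ℝ, 1 ≤ T → 0 < u →
    0 < ε → ε ≤ 1 →
    ‖∫ t : ℝ, Complex.exp (-((1 / (2 * T ^ 2) : ℝ) : ℂ) * t ^ 2) *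
      zetaLogDerivReg ((1 + ε : ℝ) + t * Complex.I) * Complex.exp (Complex.I * u * t)‖
      ≤ C * T ^ 22 / u := by
  obtain ⟨C, hC, H⟩ := exists_norm_zetaLogDerivReg_le
  refine ⟨2 * C * 84 ^ 21 * √(4 * π), by positivity, fun T u ε hT hu hε hε1 => ?_⟩
  have hT0 : 0 < T := by linarith
  set b : ℝ := 1 / (2 * T ^ 2) with hb
  have hb0 : 0 < b := by positivity
  have hb1 : 2 * b ≤ 1 := by
    rw [hb, mul_one_div, div_le_one (by positivity)]; nlinarith
  set B : ℝ → ℝ := fun t => 2 * C * 84 ^ 21 * T ^ 21 * exp (-(1 / (4 * T ^ 2)) * t ^ 2) with hB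
  have hBint : MeasureTheory.Integrable B :=
    (integrable_exp_neg_mul_sq (by positivity)).const_mul _
  set g : ℝ → ℂ := fun t => zetaLogDerivReg ((1 + ε : ℝ) + t * Complex.I) with hg
  set g' : ℝ → ℂ := fun t => zetaLogDerivReg' ((1 + ε : ℝ) + t * Complex.I) with hg'
  set U : ℝ → ℂ := fun t => Complex.exp (-(b : ℂ) * t ^ 2) * g t with hU
  set U' : ℝ → ℂ := fun t => Complex.exp (-(b : ℂ) * t ^ 2) * (-(b : ℂ) * (2 * t)) * g t
    + Complex.exp (-(b : ℂ) * t ^ 2) * (g' t * Complex.I) with hU'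
  set V : ℝ → ℂ := fun t => Complex.exp (Complex.I * u * t) / (Complex.I * u) with hV
  set V' : ℝ → ℂ := fun t => Complex.exp (Complex.I * u * t) with hV'
  have hIu : Complex.I * u ≠ 0 := by
    simp [hu.ne']
  have hgd : ∀ t, HasDerivAt g (g' t * Complex.I) t := by
    intro t
    have h1 := hasDerivAt_zetaLogDerivReg (s := (1 + ε : ℝ) + t * Complex.I) (by simp [hε])
    have h2 : HasDerivAt (fun t : ℝ => ((1 + ε : ℝ) : ℂ) + t * Complex.I) Complex.I t := by
      have := ((hasDerivAt_id t).ofReal_comp.mul_const Complex.I).const_add ((1 + ε : ℝ) : ℂ)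
      simpa using this
    exact h1.comp t h2
  have hUd : ∀ t, HasDerivAt U (U' t) t := by
    intro t
    have h1 : HasDerivAt (fun t : ℝ => Complex.exp (-(b : ℂ) * t ^ 2))
        (Complex.exp (-(b : ℂ) * t ^ 2) * (-(b : ℂ) * (2 * t))) t := by
      have h0 : HasDerivAt (fun z : ℂ => Complex.exp (-(b : ℂ) * z ^ 2))
        (Complex.exp (-(b : ℂ) * (t : ℂ) ^ 2) * (-(b : ℂ) * (2 * t))) (t : ℂ) := by
        have := (((hasDerivAt_id (t : ℂ)).pow 2).const_mul (-(b : ℂ))).cexp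
        simpa using this
      exact h0.comp_ofReal
    exact h1.mul (hgd t)
  have hVd : ∀ t, HasDerivAt V (V' t) t := by
    intro t
    have h0 : HasDerivAt (fun z : ℂ => Complex.exp (Complex.I * u * z) / (Complex.I * u))
        (Complex.exp (Complex.I * u * t)) (t : ℂ) := by
      have := (((hasDerivAt_id (t : ℂ)).const_mul (Complex.I * u)).cexp).div_const (Complex.I * u)
      refine this.congr_deriv ?_
      simp only [mul_one, id]
      exact mul_div_cancel_right₀ _ hIu
    exact h0.comp_ofReal
  have hexpn : ∀ t : ℝ, ‖Complex.exp (-(b : ℂ) * t ^ 2)‖ = exp (-b * t ^ 2) := by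
    intro t
    rw [Complex.norm_exp]; congr 1
    rw [← Complex.ofReal_pow, ← Complex.ofReal_neg, ← Complex.ofReal_mul, Complex.ofReal_re]
  have hV'n : ∀ t, ‖V' t‖ = 1 := by
    intro t
    simp only [hV']
    rw [show Complex.I * u * t = ((u * t : ℝ) : ℂ) * Complex.I by push_cast; ring,
      Complex.norm_exp_ofReal_mul_I]
  have hVn : ∀ t, ‖V t‖ = 1 / u := by
    intro t
    have : V t = V' t / (Complex.I * u) := rfl
    rw [this, norm_div, hV'n, norm_mul]
    simp [abs_of_pos hu]
  have hgn := fun t => H (1 + ε) t (by linarith) (by linarith)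
  have hBle : ∀ t : ℝ, 2 * C * (1 + |t|) ^ 21 * exp (-b * t ^ 2) ≤ B t := by
    intro t
    have := one_add_abs_pow_mul_exp_le hT t
    rw [← hb] at this
    calc _ = 2 * C * ((1 + |t|) ^ 21 * exp (-b * t ^ 2)) := by ring
      _ ≤ 2 * C * (84 ^ 21 * T ^ 21 * exp (-(1 / (4 * T ^ 2)) * t ^ 2)) := by gcongr
      _ = _ := by rw [hB]; ring
  have hUn : ∀ t, ‖U t‖ ≤ B t := by
    intro t
    refine le_trans ?_ (hBle t)
    rw [hU, norm_mul, hexpn]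
    have h2 : ‖g t‖ ≤ C * (1 + |t|) ^ 20 := (hgn t).1
    have h3 : (1:ℝ) ≤ 1 + |t| := by linarith [abs_nonneg t]
    have h4 : C * (1 + |t|) ^ 20 ≤ 2 * C * (1 + |t|) ^ 21 := by
      have : (1 + |t|) ^ 20 ≤ (1 + |t|) ^ 21 := pow_le_pow_right₀ h3 (by norm_num)
      have : 0 < (1 + |t|) ^ 20 := by positivity
      nlinarith
    rw [mul_comm]
    gcongr
    exact h2.trans h4
  have hU'n : ∀ t, ‖U' t‖ ≤ B t := by
    intro t
    refine le_trans ?_ (hBle t)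
    have h2 : ‖g t‖ ≤ C * (1 + |t|) ^ 20 := (hgn t).1
    have h2' : ‖g' t‖ ≤ C * (1 + |t|) ^ 20 := (hgn t).2
    have h5 : ‖-(b : ℂ) * (2 * t)‖ ≤ |t| := by
      rw [norm_mul, norm_neg, norm_mul, Complex.norm_real, Complex.norm_real, norm_eq_abs, norm_eq_abs,
        abs_of_pos hb0]
      simp only [Complex.norm_ofNat]
      nlinarith [abs_nonneg t]
    have h3 : (1:ℝ) ≤ 1 + |t| := by linarith [abs_nonneg t]
    have hp : 0 < (1 + |t|) ^ 20 := by positivity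
    rw [hU']
    refine (norm_add_le _ _).trans ?_
    rw [norm_mul, norm_mul, norm_mul (Complex.exp _) (g' t * _), norm_mul (g' t), hexpn, Complex.norm_I,
      mul_one]
    calc _ ≤ exp (-b * t ^ 2) * |t| * (C * (1 + |t|) ^ 20) + exp (-b * t ^ 2) * (C * (1 + |t|) ^ 20) := by
          gcongr
      _ = exp (-b * t ^ 2) * (C * (1 + |t|) ^ 21) := by ring
      _ ≤ _ := by
        have : 0 < exp (-b * t ^ 2) * (C * (1 + |t|) ^ 21) := by positivity
        linarith
  have hUc : Continuous U := continuous_iff_continuousAt.mpr fun t => (hUd t).continuousAt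
  have hVc : Continuous V := continuous_iff_continuousAt.mpr fun t => (hVd t).continuousAt
  have hV'c : Continuous V' := by fun_prop
  have hgc : Continuous g := continuous_iff_continuousAt.mpr fun t => (hgd t).continuousAt
  have hg'm : Measurable g' := measurable_zetaLogDerivReg'.comp (by fun_prop)
  have hU'm : Measurable U' := by
    have := hgc.measurable
    fun_prop
  have i1 : MeasureTheory.Integrable (U * V') := by
    refine hBint.mono' (hUc.mul hV'c).aestronglyMeasurable ?_
    filter_upwards with t
    rw [Pi.mul_apply, norm_mul, hV'n, mul_one]; exact hUn t
  have i2 : MeasureTheory.Integrable (U' * V) := by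
    refine (hBint.mul_const (1 / u)).mono' (hU'm.mul hVc.measurable).aestronglyMeasurable ?_
    filter_upwards with t
    rw [Pi.mul_apply, norm_mul, hVn]; gcongr; exact hU'n t
  have i3 : MeasureTheory.Integrable (U * V) := by
    refine (hBint.mul_const (1 / u)).mono' (hUc.mul hVc).aestronglyMeasurable ?_
    filter_upwards with t
    rw [Pi.mul_apply, norm_mul, hVn]; gcongr; exact hUn t
  have key := MeasureTheory.integral_mul_deriv_eq_deriv_mul_of_integrable
    (fun t _ => hUd t) (fun t _ => hVd t) i1 i2 i3
  change ‖∫ t : ℝ, U t * V' t‖ ≤ _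
  rw [key, norm_neg]
  refine (MeasureTheory.norm_integral_le_of_norm_le (hBint.mul_const (1 / u)) ?_).trans ?_
  · filter_upwards with t
    rw [norm_mul, hVn]; gcongr; exact hU'n t
  · rw [MeasureTheory.integral_mul_const, hB, MeasureTheory.integral_const_mul, integral_gaussian]
    have : √(π / (1 / (4 * T ^ 2))) = √(4 * π) * T := by
      rw [show π / (1 / (4 * T ^ 2)) = (4 * π) * T ^ 2 by field_simp, sqrt_mul (by positivity),
        sqrt_sq hT0.le]
    rw [this]
    apply le_of_eq
    ring

lemma integral_gaussian_fourier {T : ℝ} (hT : 0 < T) (y : ℝ) :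
    ∫ t : ℝ, Complex.exp (-((1 / (2 * T ^ 2) : ℝ) : ℂ) * t ^ 2) * Complex.exp (Complex.I * y * t)
      = ((√(2 * π) * T * exp (-(T ^ 2 / 2) * y ^ 2) : ℝ) : ℂ) := by
  have h := fourierIntegral_gaussian (b := ((1 / (2 * T ^ 2) : ℝ) : ℂ))
    (by rw [Complex.ofReal_re]; positivity) (y : ℂ)
  simp_rw [mul_comm (Complex.exp (Complex.I * _ * _))] at h
  rw [h]
  have e1 : (π / ((1 / (2 * T ^ 2) : ℝ) : ℂ)) ^ (1 / 2 : ℂ) = ((√(2 * π) * T : ℝ) : ℂ) := by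
    have : (π : ℂ) / ((1 / (2 * T ^ 2) : ℝ) : ℂ) = ((2 * π * T ^ 2 : ℝ) : ℂ) := by
      rw [← Complex.ofReal_div]; congr 1; field_simp
    rw [this, show (1 / 2 : ℂ) = ((1 / 2 : ℝ) : ℂ) by norm_num, ← Complex.ofReal_cpow (by positivity),
      ← sqrt_eq_rpow, sqrt_mul (by positivity), sqrt_sq hT.le]
  rw [e1]
  push_cast
  congr 2
  field_simp
  ring

lemma integral_psiErr_mul_gaussian {T u ε : ℝ} (hT : 0 < T) (hε : 0 < ε) :
    ((√(2 * π) * T * ∫ v in Set.Ioi (0 : ℝ), psiErr v * exp (-ε * v) * exp (-(T ^ 2 / 2) * (u - v) ^ 2) : ℝ) : ℂ)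
    = ∫ t : ℝ, Complex.exp (-((1 / (2 * T ^ 2) : ℝ) : ℂ) * t ^ 2) *
      zetaLogDerivReg ((1 + ε : ℝ) + t * Complex.I) * Complex.exp (Complex.I * u * t) := by
  set b : ℝ := 1 / (2 * T ^ 2) with hb
  have hb0 : 0 < b := by positivity
  have hswap := MeasureTheory.integral_integral_swap (μ := MeasureTheory.volume.restrict (Set.Ioi (0:ℝ)))
    (ν := MeasureTheory.volume) (f := fun v t : ℝ => (psiErr v : ℂ) * Complex.exp (-(ε : ℂ) * v) *
      (Complex.exp (-(b : ℂ) * t ^ 2) * Complex.exp (Complex.I * (u - v : ℝ) * t))) (by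
    have h1 : MeasureTheory.Integrable (fun v : ℝ => 6 * exp (-ε * v))
        (MeasureTheory.volume.restrict (Set.Ioi (0:ℝ))) := (exp_neg_integrableOn_Ioi 0 hε).const_mul 6
    have h2 : MeasureTheory.Integrable (fun t : ℝ => exp (-b * t ^ 2)) := integrable_exp_neg_mul_sq hb0
    refine (h1.mul_prod h2).mono' ?_ ?_
    · have := Complex.measurable_ofReal.comp measurable_psiErr
      apply Measurable.aestronglyMeasurable
      simp only [Function.uncurry_def]
      refine Measurable.mul (Measurable.mul (this.comp measurable_fst) (by fun_prop)) (by fun_prop)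
    · filter_upwards with p
      simp only [Function.uncurry_def, norm_mul]
      rw [show Complex.I * (u - p.1 : ℝ) * p.2 = (((u - p.1) * p.2 : ℝ) : ℂ) * Complex.I by push_cast; ring,
        Complex.norm_exp_ofReal_mul_I, mul_one, norm_cexp_neg_mul_ofReal, ← Complex.ofReal_pow,
        norm_cexp_neg_mul_ofReal, Complex.norm_real, Complex.ofReal_re, Complex.ofReal_re]
      gcongr
      exact abs_psiErr_le _)
  have hL : ∀ v : ℝ, ∫ t : ℝ, (psiErr v : ℂ) * Complex.exp (-(ε : ℂ) * v) *
      (Complex.exp (-(b : ℂ) * t ^ 2) * Complex.exp (Complex.I * (u - v : ℝ) * t))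
      = ((√(2 * π) * T * (psiErr v * exp (-ε * v) * exp (-(T ^ 2 / 2) * (u - v) ^ 2)) : ℝ) : ℂ) := by
    intro v
    rw [MeasureTheory.integral_const_mul, integral_gaussian_fourier hT]
    push_cast
    ring
  have hRt : ∀ t : ℝ, ∫ v in Set.Ioi (0:ℝ), (psiErr v : ℂ) * Complex.exp (-(ε : ℂ) * v) *
      (Complex.exp (-(b : ℂ) * t ^ 2) * Complex.exp (Complex.I * (u - v : ℝ) * t))
      = Complex.exp (-(b : ℂ) * t ^ 2) *
      zetaLogDerivReg ((1 + ε : ℝ) + t * Complex.I) * Complex.exp (Complex.I * u * t) := by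
    intro t
    rw [← integral_psiErr_mul_cexp (by simp [hε]), mul_right_comm, mul_comm (_ * _) (∫ _ in _, _),
      ← MeasureTheory.integral_mul_const]
    congr 1
    ext v
    have : Complex.exp (-(ε : ℂ) * v) * Complex.exp (Complex.I * (u - v : ℝ) * t)
        = Complex.exp (-(((1 + ε : ℝ) : ℂ) + t * Complex.I - 1) * v) * Complex.exp (Complex.I * u * t) := by
      rw [← Complex.exp_add, ← Complex.exp_add]; congr 1; push_cast; ring
    linear_combination (psiErr v : ℂ) * Complex.exp (-(b : ℂ) * t ^ 2) * this
  simp_rw [hL, hRt] at hswap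
  rw [← hswap, integral_complex_ofReal, MeasureTheory.integral_const_mul]

lemma exists_abs_integral_psiErr_mul_gaussian_le : ∃ C : ℝ, 0 < C ∧ ∀ T u : ℝ, 1 ≤ T → 0 < u →
    T * |∫ v in Set.Ioi (0 : ℝ), psiErr v * exp (-(T ^ 2 / 2) * (u - v) ^ 2)| ≤ C * T ^ 22 / u := by
  obtain ⟨C, hC, H⟩ := exists_norm_integral_gaussian_mul_zetaLogDerivReg_le
  refine ⟨C, hC, fun T u hT hu => ?_⟩
  have hT0 : 0 < T := by linarith
  have hlim : Filter.Tendsto (fun ε : ℝ => ∫ v in Set.Ioi (0 : ℝ), psiErr v * exp (-ε * v) *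
      exp (-(T ^ 2 / 2) * (u - v) ^ 2)) (nhdsWithin 0 (Set.Ioi 0))
      (nhds (∫ v in Set.Ioi (0 : ℝ), psiErr v * exp (-(T ^ 2 / 2) * (u - v) ^ 2))) := by
    refine MeasureTheory.tendsto_integral_filter_of_dominated_convergence
      (fun v => 6 * exp (-(T ^ 2 / 2) * (u - v) ^ 2)) ?_ ?_ ?_ ?_
    · filter_upwards with ε
      exact ((measurable_psiErr.mul (by fun_prop)).mul (by fun_prop)).aestronglyMeasurable
    · filter_upwards [self_mem_nhdsWithin] with ε hε
      filter_upwards [MeasureTheory.ae_restrict_mem measurableSet_Ioi] with v hv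
      rw [norm_mul, norm_mul, norm_eq_abs, norm_eq_abs, norm_eq_abs, abs_exp, abs_exp]
      have h1 : exp (-ε * v) ≤ 1 := by
        rw [exp_le_one_iff]
        have := mul_pos (Set.mem_Ioi.mp hε) (Set.mem_Ioi.mp hv)
        linarith
      have := abs_psiErr_le v
      calc _ ≤ 6 * 1 * exp (-(T ^ 2 / 2) * (u - v) ^ 2) := by gcongr
        _ = _ := by ring
    · have := (integrable_exp_neg_mul_sq (b := T ^ 2 / 2) (by positivity)).comp_sub_left u
      exact (this.const_mul 6).integrableOn
    · filter_upwards with v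
      have : Filter.Tendsto (fun ε : ℝ => exp (-ε * v)) (nhdsWithin 0 (Set.Ioi 0)) (nhds 1) := by
        have h : Continuous fun ε : ℝ => exp (-ε * v) := by fun_prop
        have := h.tendsto 0
        simp only [neg_zero, zero_mul, exp_zero] at this
        exact this.mono_left nhdsWithin_le_nhds
      have h := (this.const_mul (psiErr v)).mul_const (exp (-(T ^ 2 / 2) * (u - v) ^ 2))
      rwa [mul_one] at h
  refine le_of_tendsto ((hlim.abs).const_mul T) ?_
  filter_upwards [self_mem_nhdsWithin, mem_nhdsWithin_of_mem_nhds (Iio_mem_nhds one_pos)] with ε hε hε1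
  have h1 := H T u ε hT hu hε (le_of_lt hε1)
  rw [← integral_psiErr_mul_gaussian hT0 hε, Complex.norm_real, norm_eq_abs, abs_mul, abs_of_pos (by positivity)] at h1
  refine le_trans ?_ h1
  have h2 : 1 ≤ √(2 * π) := by
    rw [one_le_sqrt]; linarith [pi_gt_three]
  gcongr
  nlinarith

lemma psiErr_add_one (v : ℝ) : psiErr v + 1 = Chebyshev.psi (exp v) * exp (-v) := by
  rw [psiErr]; ring

lemma neg_one_le_psiErr (v : ℝ) : -1 ≤ psiErr v := by
  have := psiErr_add_one v
  have h : 0 ≤ Chebyshev.psi (exp v) * exp (-v) := mul_nonneg (Chebyshev.psi_nonneg _) (exp_pos _).le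
  linarith

lemma psiErr_add_one_mul_exp_le {v w : ℝ} (h : v ≤ w) :
    (psiErr v + 1) * exp (-(w - v)) ≤ psiErr w + 1 := by
  rw [psiErr_add_one, psiErr_add_one]
  have : Chebyshev.psi (exp v) ≤ Chebyshev.psi (exp w) := Chebyshev.psi_mono (exp_le_exp.mpr h)
  calc _ = Chebyshev.psi (exp v) * exp (-w) := by rw [mul_assoc, ← exp_add]; congr 2; ring
    _ ≤ _ := by gcongr

/-- A smoothed lower bound forces positivity of the smoothed average. -/
lemma le_mul_integral_mul_gaussian {f : ℝ → ℝ} {T u a M : ℝ} (hT : 0 < T)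
    (hf : MeasureTheory.IntegrableOn (fun v => f v * exp (-(T ^ 2 / 2) * (u - v) ^ 2)) (Set.Ioi 0))
    (hM : 0 ≤ M)
    (h0 : ∀ v, v ≤ 0 → a - M * (u - v) ^ 2 ≤ 0)
    (h : ∀ v, 0 < v → a - M * (u - v) ^ 2 ≤ f v) :
    √(2 * π) * a - M * (8 * √π / T ^ 2) ≤ T * ∫ v in Set.Ioi (0 : ℝ), f v * exp (-(T ^ 2 / 2) * (u - v) ^ 2) := by
  have g1 : MeasureTheory.Integrable (fun v : ℝ => exp (-(T ^ 2 / 2) * (u - v) ^ 2)) :=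
    (integrable_exp_neg_mul_sq (b := T ^ 2 / 2) (by positivity)).comp_sub_left u
  have g2 : MeasureTheory.Integrable (fun v : ℝ => exp (-(T ^ 2 / 4) * (u - v) ^ 2)) :=
    (integrable_exp_neg_mul_sq (b := T ^ 2 / 4) (by positivity)).comp_sub_left u
  have i1 : ∫ v : ℝ, exp (-(T ^ 2 / 2) * (u - v) ^ 2) = √(2 * π) / T := by
    rw [MeasureTheory.integral_sub_left_eq_self (fun v : ℝ => exp (-(T ^ 2 / 2) * v ^ 2)), integral_gaussian,
      show π / (T ^ 2 / 2) = 2 * π / T ^ 2 by field_simp, sqrt_div (by positivity), sqrt_sq hT.le]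
  have i2 : ∫ v : ℝ, exp (-(T ^ 2 / 4) * (u - v) ^ 2) = 2 * √π / T := by
    rw [MeasureTheory.integral_sub_left_eq_self (fun v : ℝ => exp (-(T ^ 2 / 4) * v ^ 2)), integral_gaussian,
      show π / (T ^ 2 / 4) = 2 ^ 2 * π / T ^ 2 by field_simp; norm_num, sqrt_div (by positivity), sqrt_sq hT.le,
      sqrt_mul (by positivity), sqrt_sq (by norm_num)]
  have key : ∀ v, a * exp (-(T ^ 2 / 2) * (u - v) ^ 2) - M * (4 / T ^ 2) * exp (-(T ^ 2 / 4) * (u - v) ^ 2)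
      ≤ (a - M * (u - v) ^ 2) * exp (-(T ^ 2 / 2) * (u - v) ^ 2) := by
    intro v
    have e : exp (-(T ^ 2 / 4) * (u - v) ^ 2) = exp ((T ^ 2 / 4) * (u - v) ^ 2) * exp (-(T ^ 2 / 2) * (u - v) ^ 2) := by
      rw [← exp_add]; congr 1; ring
    have e2 : (u - v) ^ 2 ≤ 4 / T ^ 2 * exp ((T ^ 2 / 4) * (u - v) ^ 2) := by
      have := add_one_le_exp ((T ^ 2 / 4) * (u - v) ^ 2)
      calc (u - v) ^ 2 = 4 / T ^ 2 * ((T ^ 2 / 4) * (u - v) ^ 2) := by field_simp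
        _ ≤ _ := by gcongr; linarith
    rw [e]
    have e3 := mul_le_mul_of_nonneg_right (mul_le_mul_of_nonneg_left e2 hM) (exp_pos (-(T ^ 2 / 2) * (u - v) ^ 2)).le
    nlinarith [e3]
  have hle : ∫ v : ℝ, (a * exp (-(T ^ 2 / 2) * (u - v) ^ 2) - M * (4 / T ^ 2) * exp (-(T ^ 2 / 4) * (u - v) ^ 2))
      ≤ ∫ v in Set.Ioi (0 : ℝ), f v * exp (-(T ^ 2 / 2) * (u - v) ^ 2) := by
    rw [← MeasureTheory.integral_indicator measurableSet_Ioi]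
    refine MeasureTheory.integral_mono ((g1.const_mul a).sub (g2.const_mul _))
      (hf.integrable_indicator measurableSet_Ioi) fun v => ?_
    refine (key v).trans ?_
    by_cases hv : 0 < v
    · rw [Set.indicator_of_mem (Set.mem_Ioi.mpr hv)]
      exact mul_le_mul_of_nonneg_right (h v hv) (exp_pos _).le
    · rw [Set.indicator_of_notMem (by simpa using hv)]
      exact mul_nonpos_of_nonpos_of_nonneg (h0 v (not_lt.mp hv)) (exp_pos _).le
  rw [MeasureTheory.integral_sub (g1.const_mul a) (g2.const_mul _), MeasureTheory.integral_const_mul,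
    MeasureTheory.integral_const_mul, i1, i2] at hle
  calc _ = T * (a * (√(2 * π) / T) - M * (4 / T ^ 2) * (2 * √π / T)) := by field_simp; ring
    _ ≤ _ := by gcongr

lemma integrableOn_psiErr_mul_gaussian {T : ℝ} (hT : 0 < T) (u : ℝ) :
    MeasureTheory.IntegrableOn (fun v => psiErr v * exp (-(T ^ 2 / 2) * (u - v) ^ 2)) (Set.Ioi 0) := by
  have g1 : MeasureTheory.Integrable (fun v : ℝ => exp (-(T ^ 2 / 2) * (u - v) ^ 2)) :=
    (integrable_exp_neg_mul_sq (b := T ^ 2 / 2) (by positivity)).comp_sub_left u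
  refine (g1.const_mul 6).integrableOn.mono' ?_ ?_
  · exact (measurable_psiErr.mul (by fun_prop)).aestronglyMeasurable
  · filter_upwards with v
    rw [norm_mul, norm_eq_abs, norm_eq_abs, abs_exp]
    gcongr
    exact abs_psiErr_le v

lemma psiErr_lower_parabola {u h v : ℝ} (hh : 0 < h) (hu : psiErr u = h) :
    h / 2 - (1 + h / 2) * (4 / (h / 14) ^ 2) * (u + h / 28 - v) ^ 2 ≤ psiErr v := by
  have h6 : h ≤ 6 := by have := abs_psiErr_le u; rw [hu, abs_of_pos hh] at this; exact this
  by_cases hv : (h / 28) ^ 2 ≤ (u + h / 28 - v) ^ 2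
  · have : 1 ≤ (4 / (h / 14) ^ 2) * (u + h / 28 - v) ^ 2 := by
      calc (1:ℝ) = (4 / (h / 14) ^ 2) * (h / 28) ^ 2 := by field_simp; norm_num
        _ ≤ _ := by gcongr
    have h1 := neg_one_le_psiErr v
    nlinarith
  · have hv' := abs_lt_of_sq_lt_sq (not_le.mp hv) (by positivity)
    rw [abs_lt] at hv'
    have h1 := psiErr_add_one_mul_exp_le (v := u) (w := v) (by linarith [hv'.2])
    have h2 := add_one_le_exp (-(v - u))
    rw [hu] at h1
    have h3 : (h + 1) * (1 - h / 14) ≤ (h + 1) * exp (-(v - u)) := by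
      gcongr; linarith [hv'.1]
    have h4 : 0 ≤ (1 + h / 2) * (4 / (h / 14) ^ 2) * (u + h / 28 - v) ^ 2 := by positivity
    nlinarith

lemma psiErr_upper_parabola {u h v : ℝ} (hh : 0 < h) (hu : psiErr u = -h) :
    h / 2 - (6 + h / 2) * (4 / (h / 4) ^ 2) * (u - h / 8 - v) ^ 2 ≤ -psiErr v := by
  have h6 : h ≤ 1 := by have := neg_one_le_psiErr u; linarith
  by_cases hv : (h / 8) ^ 2 ≤ (u - h / 8 - v) ^ 2
  · have : 1 ≤ (4 / (h / 4) ^ 2) * (u - h / 8 - v) ^ 2 := by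
      calc (1:ℝ) = (4 / (h / 4) ^ 2) * (h / 8) ^ 2 := by field_simp; norm_num
        _ ≤ _ := by gcongr
    have h1 := (abs_le.mp (abs_psiErr_le v)).2
    nlinarith
  · have hv' := abs_lt_of_sq_lt_sq (not_le.mp hv) (by positivity)
    rw [abs_lt] at hv'
    have h1 := psiErr_add_one_mul_exp_le (v := v) (w := u) (by linarith [hv'.1])
    have h2 := add_one_le_exp (-(u - v))
    rw [hu] at h1
    have h5 := neg_one_le_psiErr v
    have h3 : (psiErr v + 1) * (1 - h / 4) ≤ (psiErr v + 1) * exp (-(u - v)) := by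
      gcongr
      · linarith
      · linarith [hv'.2]
    have h4 : 0 ≤ (6 + h / 2) * (4 / (h / 4) ^ 2) * (u - h / 8 - v) ^ 2 := by positivity
    nlinarith

lemma exists_abs_psiErr_pow_three_le : ∃ K : ℝ, 0 < K ∧ ∀ T u : ℝ, 1 ≤ T → 1 ≤ u →
    |psiErr u| ^ 3 ≤ K * (T ^ 22 / u + 1 / T ^ 2) := by
  obtain ⟨C, hC, H⟩ := exists_abs_integral_psiErr_mul_gaussian_le
  refine ⟨144 * C + 100352, by positivity, fun T u hT hu => ?_⟩
  have hT0 : 0 < T := by linarith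
  have hpi : √π ≤ 2 := by
    rw [sqrt_le_left (by norm_num)]; linarith [pi_lt_four]
  have h2pi : 1 ≤ √(2 * π) := by
    rw [one_le_sqrt]; linarith [pi_gt_three]
  have hX : 0 < T ^ 22 / u := by positivity
  have hY : 0 < 1 / T ^ 2 := by positivity
  -- from a lower bound for the smoothed average to a bound for the cube
  have fin : ∀ h M A : ℝ, 0 < h → h ≤ 6 → M * h ^ 2 ≤ 3136 → 0 ≤ M →
      √(2 * π) * (h / 2) - M * (8 * √π / T ^ 2) ≤ A → A ≤ 2 * C * (T ^ 22 / u) →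
      h ^ 3 ≤ (144 * C + 100352) * (T ^ 22 / u + 1 / T ^ 2) := by
    intro h M A hh h6 hM hM0 h1 h2
    have e1 : M * (8 * √π / T ^ 2) ≤ M * (16 * (1 / T ^ 2)) := by
      gcongr
      rw [mul_one_div]; gcongr; linarith
    have e2 : h / 2 ≤ √(2 * π) * (h / 2) := by nlinarith
    have e3 : h / 2 ≤ 2 * C * (T ^ 22 / u) + M * (16 * (1 / T ^ 2)) := by linarith
    have e4 : h ^ 2 ≤ 36 := by nlinarith
    calc h ^ 3 = 2 * h ^ 2 * (h / 2) := by ring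
      _ ≤ 2 * h ^ 2 * (2 * C * (T ^ 22 / u) + M * (16 * (1 / T ^ 2))) := by gcongr
      _ = (4 * C) * h ^ 2 * (T ^ 22 / u) + 32 * (M * h ^ 2) * (1 / T ^ 2) := by ring
      _ ≤ (4 * C) * 36 * (T ^ 22 / u) + 32 * 3136 * (1 / T ^ 2) := by gcongr
      _ ≤ _ := by nlinarith [mul_pos hC hY]
  rcases lt_trichotomy (psiErr u) 0 with hneg | hzero | hpos
  · obtain ⟨h, hh⟩ : ∃ h, h = -psiErr u := ⟨_, rfl⟩
    have hh0 : 0 < h := by linarith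
    have hu' : psiErr u = -h := by linarith
    have h1 : h ≤ 1 := by linarith [neg_one_le_psiErr u]
    rw [abs_of_neg hneg, ← hh]
    have hM : (6 + h / 2) * (4 / (h / 4) ^ 2) * h ^ 2 = 64 * (6 + h / 2) := by field_simp; norm_num
    refine fin h ((6 + h / 2) * (4 / (h / 4) ^ 2)) _ hh0 (by linarith) (by rw [hM]; linarith) (by positivity)
      (le_mul_integral_mul_gaussian (f := fun v => -psiErr v) (u := u - h / 8) hT0 ?_ (by positivity) ?_
        fun v _ => psiErr_upper_parabola hh0 hu') ?_
    · simpa using (integrableOn_psiErr_mul_gaussian hT0 (u - h / 8)).neg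
    · intro v hv
      have e : (h / 8) ^ 2 ≤ (u - h / 8 - v) ^ 2 := by gcongr; linarith
      have : (6 + h / 2) * (4 / (h / 4) ^ 2) * (h / 8) ^ 2 ≤ (6 + h / 2) * (4 / (h / 4) ^ 2) * (u - h / 8 - v) ^ 2 := by
        gcongr
      rw [show (6 + h / 2) * (4 / (h / 4) ^ 2) * (h / 8) ^ 2 = 6 + h / 2 by field_simp; norm_num] at this
      linarith
    · have := H T (u - h / 8) hT (by linarith)
      simp only [neg_mul, MeasureTheory.integral_neg]
      simp only [neg_mul] at this
      refine le_trans ?_ (this.trans ?_)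
      · gcongr; exact neg_le_abs _
      · rw [mul_assoc, mul_comm 2, mul_assoc, mul_div_assoc]
        gcongr
        rw [div_mul_eq_mul_div, div_le_div_iff₀ (by linarith) (by linarith)]
        have : 0 < T ^ 22 := by positivity
        nlinarith
  · rw [hzero]; simp; positivity
  · obtain ⟨h, hh⟩ : ∃ h, h = psiErr u := ⟨_, rfl⟩
    have hh0 : 0 < h := by linarith
    have h6 : h ≤ 6 := by have := (abs_le.mp (abs_psiErr_le u)).2; linarith
    rw [abs_of_pos hpos, ← hh]
    have hM : (1 + h / 2) * (4 / (h / 14) ^ 2) * h ^ 2 = 784 * (1 + h / 2) := by field_simp; norm_num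
    refine fin h ((1 + h / 2) * (4 / (h / 14) ^ 2)) _ hh0 (by linarith) (by rw [hM]; linarith) (by positivity)
      (le_mul_integral_mul_gaussian (f := psiErr) (u := u + h / 28) hT0
        (integrableOn_psiErr_mul_gaussian hT0 _) (by positivity) ?_
        fun v _ => psiErr_lower_parabola hh0 hh.symm) ?_
    · intro v hv
      have e : (h / 28) ^ 2 ≤ (u + h / 28 - v) ^ 2 := by gcongr; linarith
      have : (1 + h / 2) * (4 / (h / 14) ^ 2) * (h / 28) ^ 2 ≤ (1 + h / 2) * (4 / (h / 14) ^ 2) * (u + h / 28 - v) ^ 2 := by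
        gcongr
      rw [show (1 + h / 2) * (4 / (h / 14) ^ 2) * (h / 28) ^ 2 = 1 + h / 2 by field_simp; norm_num] at this
      linarith
    · have := H T (u + h / 28) hT (by linarith)
      refine le_trans ?_ (this.trans ?_)
      · gcongr; exact le_abs_self _
      · rw [mul_assoc, mul_comm 2, mul_assoc, mul_div_assoc]
        gcongr
        rw [div_mul_eq_mul_div, div_le_div_iff₀ (by linarith) (by linarith)]
        have : 0 < T ^ 22 := by positivity
        nlinarith

/-- The prime number theorem with a weak error term. -/
theorem exists_abs_psi_sub_le : ∃ C : ℝ, 0 < C ∧ ∀ y : ℝ, 1 ≤ y →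
    |Chebyshev.psi y - y| ≤ C * y * (1 + log y) ^ (-(1 / 36) : ℝ) := by
  obtain ⟨K, hK, H⟩ := exists_abs_psiErr_pow_three_le
  have main : ∀ u : ℝ, 1 ≤ u → |psiErr u| ≤ (2 * K + 1) * u ^ (-(1 / 36) : ℝ) := by
    intro u hu
    have hu0 : 0 < u := by linarith
    have h := H (u ^ (1 / 24 : ℝ)) u (one_le_rpow hu (by norm_num)) hu
    have e1 : (u ^ (1 / 24 : ℝ)) ^ 22 / u = u ^ (-(1 / 12) : ℝ) := by
      rw [← rpow_natCast, ← rpow_mul hu0.le]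
      nth_rewrite 2 [← rpow_one u]
      rw [← rpow_sub hu0]; norm_num
    have e2 : 1 / (u ^ (1 / 24 : ℝ)) ^ 2 = u ^ (-(1 / 12) : ℝ) := by
      rw [← rpow_natCast, ← rpow_mul hu0.le, one_div, ← rpow_neg hu0.le]; norm_num
    rw [e1, e2] at h
    have e3 : (u ^ (-(1 / 36) : ℝ)) ^ 3 = u ^ (-(1 / 12) : ℝ) := by
      rw [← rpow_natCast, ← rpow_mul hu0.le]; norm_num
    refine le_of_pow_le_pow_left₀ (n := 3) (by norm_num) (by positivity) (h.trans ?_)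
    rw [mul_pow, e3]
    have : 0 < u ^ (-(1 / 12) : ℝ) := by positivity
    have h2 : 2 * K ≤ (2 * K + 1) ^ 3 := by nlinarith [sq_nonneg (2 * K + 1), mul_pos hK hK, mul_pos (mul_pos hK hK) hK]
    nlinarith
  refine ⟨2 * (2 * K + 7), by positivity, fun y hy => ?_⟩
  have hy0 : 0 < y := by linarith
  have hl : 0 ≤ log y := log_nonneg hy
  have e0 : |Chebyshev.psi y - y| = y * |psiErr (log y)| := by
    rw [psiErr, exp_log hy0, exp_neg, exp_log hy0, ← abs_of_pos hy0, ← abs_mul, abs_of_pos hy0]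
    congr 1; field_simp
  have e1 : |psiErr (log y)| ≤ 2 * (2 * K + 7) * (1 + log y) ^ (-(1 / 36) : ℝ) := by
    have h2 : (2:ℝ) ^ (-(1 / 36) : ℝ) ≥ 1 / 2 := by
      have h := rpow_le_rpow_of_exponent_le (x := 2) (y := -1) (z := -(1 / 36)) (by norm_num) (by norm_num)
      rw [rpow_neg_one] at h
      linarith
    rcases le_total (log y) 1 with h1 | h1
    · have : (2:ℝ) ^ (-(1 / 36) : ℝ) ≤ (1 + log y) ^ (-(1 / 36) : ℝ) :=
        rpow_le_rpow_of_nonpos (by linarith) (by linarith) (by norm_num)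
      have := abs_psiErr_le (log y)
      nlinarith
    · have h3 : (2 * log y) ^ (-(1 / 36) : ℝ) ≤ (1 + log y) ^ (-(1 / 36) : ℝ) :=
        rpow_le_rpow_of_nonpos (by linarith) (by linarith) (by norm_num)
      rw [mul_rpow (by norm_num) hl] at h3
      have h4 : 0 < log y ^ (-(1 / 36) : ℝ) := by positivity
      have := main (log y) h1
      have h5 : 1 / 2 * log y ^ (-(1 / 36) : ℝ) ≤ (1 + log y) ^ (-(1 / 36) : ℝ) :=
        (mul_le_mul_of_nonneg_right h2 h4.le).trans h3
      nlinarith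
  rw [e0]
  calc _ ≤ y * (2 * (2 * K + 7) * (1 + log y) ^ (-(1 / 36) : ℝ)) := by gcongr
    _ = _ := by ring

/-- The prime powers up to `z`. -/
noncomputable def primePows (z : ℝ) : Finset ℕ := (Icc 1 ⌊z⌋₊).filter IsPrimePow

lemma mem_primePows {z : ℝ} {q : ℕ} (hz : 0 ≤ z) :
    q ∈ primePows z ↔ (q : ℝ) ≤ z ∧ IsPrimePow q := by
  simp only [primePows, mem_filter, mem_Icc, Nat.le_floor_iff hz]
  exact ⟨fun h => ⟨h.1.2, h.2⟩, fun h => ⟨⟨h.2.one_lt.le, h.1⟩, h.2⟩⟩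

lemma one_add_log_sq_le {z : ℝ} (hz : 1 ≤ z) : (1 + log z) ^ 2 ≤ 16 * √z := by
  have hz0 : 0 < z := by linarith
  have h1 : log z = 4 * log (z ^ (1 / 4 : ℝ)) := by rw [log_rpow hz0]; ring
  have h2 : 1 ≤ z ^ (1 / 4 : ℝ) := one_le_rpow hz (by norm_num)
  have h3 := log_le_sub_one_of_pos (show 0 < z ^ (1 / 4 : ℝ) by positivity)
  have h4 : √z = (z ^ (1 / 4 : ℝ)) ^ 2 := by
    rw [← rpow_natCast, ← rpow_mul hz0.le, sqrt_eq_rpow]; norm_num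
  have h5 := log_nonneg hz
  rw [h4]
  calc (1 + log z) ^ 2 ≤ (4 * z ^ (1 / 4 : ℝ)) ^ 2 := by
        gcongr; linarith
    _ = _ := by ring

lemma exists_abs_sum_log_primePows_sub_le : ∃ C : ℝ, 0 < C ∧ ∀ z : ℝ, 1 ≤ z →
    |∑ q ∈ primePows z, log q - z| ≤ C * z * (1 + log z) ^ (-(1 / 36) : ℝ) := by
  obtain ⟨C, hC, hpsi⟩ := exists_abs_psi_sub_le
  obtain ⟨C₂, h₂⟩ := Chebyshev.psi_sub_theta_le_mul_sqrt
  refine ⟨C + 32 * |C₂|, by positivity, fun z hz => ?_⟩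
  have hl := log_nonneg hz
  have hz0 : 0 < z := by linarith
  have hl2 : 1 / 2 < log 2 := by have := log_two_gt_d9; linarith
  have e1 : Chebyshev.psi z = ∑ q ∈ primePows z, ArithmeticFunction.vonMangoldt q := by
    rw [psi_eq_sum_Icc_one, primePows, sum_filter]
    refine sum_congr rfl fun n _ => ?_
    split_ifs with h
    · rfl
    · simp [ArithmeticFunction.vonMangoldt_apply, h]
  have e2 : ∑ q ∈ primePows z, log q - Chebyshev.psi z =
      ∑ q ∈ primePows z, (log q - ArithmeticFunction.vonMangoldt q) := by
    rw [e1, sum_sub_distrib]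
  have e3 : Chebyshev.psi z - Chebyshev.theta z =
      ∑ q ∈ primePows z, if q.Prime then 0 else ArithmeticFunction.vonMangoldt q := by
    rw [Chebyshev.psi_sub_theta_eq_sum_not_prime, primePows, sum_filter, sum_filter]
    refine sum_congr rfl fun n _ => ?_
    split_ifs <;> simp_all [ArithmeticFunction.vonMangoldt_apply]
  have lo : 0 ≤ ∑ q ∈ primePows z, log q - Chebyshev.psi z := by
    rw [e2]
    refine sum_nonneg fun q _ => ?_
    have := ArithmeticFunction.vonMangoldt_le_log (n := q)
    linarith
  have hi : ∑ q ∈ primePows z, log q - Chebyshev.psi z ≤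
      2 * log z * (Chebyshev.psi z - Chebyshev.theta z) := by
    rw [e2, e3, mul_sum]
    refine sum_le_sum fun q hq => ?_
    obtain ⟨hqz, hq⟩ := (mem_primePows hz0.le).1 hq
    have hq0 : (0 : ℝ) < q := by exact_mod_cast hq.pos
    split_ifs with hp
    · rw [ArithmeticFunction.vonMangoldt_apply_prime hp]; simp
    · rw [ArithmeticFunction.vonMangoldt_apply, if_pos hq]
      have hm : (2 : ℝ) ≤ q.minFac := by
        exact_mod_cast (Nat.minFac_prime (hq.one_lt.ne')).two_le
      have h1 : log 2 ≤ log q.minFac := log_le_log (by norm_num) hm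
      have h2 : log q ≤ log z := log_le_log hq0 hqz
      nlinarith
  have h3 : Chebyshev.psi z - Chebyshev.theta z ≤ |C₂| * √z :=
    (h₂ z).trans (mul_le_mul_of_nonneg_right (le_abs_self _) (sqrt_nonneg _))
  have h4 : 2 * log z * (|C₂| * √z) ≤ 32 * |C₂| * z * (1 + log z) ^ (-(1 / 36) : ℝ) := by
    have h5 : (1 + log z) ^ (-1 : ℝ) ≤ (1 + log z) ^ (-(1 / 36) : ℝ) :=
      rpow_le_rpow_of_exponent_le (by linarith) (by norm_num)
    have h6 : log z * √z ≤ 16 * z * (1 + log z) ^ (-1 : ℝ) := by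
      rw [rpow_neg_one, ← div_eq_mul_inv, le_div_iff₀ (by linarith)]
      have h7 := one_add_log_sq_le hz
      have h8 := mul_self_sqrt hz0.le
      have h9 := sqrt_nonneg z
      nlinarith
    calc 2 * log z * (|C₂| * √z) = 2 * |C₂| * (log z * √z) := by ring
      _ ≤ 2 * |C₂| * (16 * z * (1 + log z) ^ (-(1 / 36) : ℝ)) := by
        exact mul_le_mul_of_nonneg_left (h6.trans (by gcongr)) (by positivity)
      _ = _ := by ring
  have h7 := hpsi z hz
  have h8 : 2 * log z * (Chebyshev.psi z - Chebyshev.theta z) ≤ 2 * log z * (|C₂| * √z) := by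
    gcongr
  calc _ = |(∑ q ∈ primePows z, log q - Chebyshev.psi z) + (Chebyshev.psi z - z)| := by
        congr 1; ring
    _ ≤ |∑ q ∈ primePows z, log q - Chebyshev.psi z| + |Chebyshev.psi z - z| := abs_add_le _ _
    _ ≤ 32 * |C₂| * z * (1 + log z) ^ (-(1 / 36) : ℝ) + C * z * (1 + log z) ^ (-(1 / 36) : ℝ) := by
        rw [abs_of_nonneg lo]; linarith
    _ = _ := by ring

lemma sum_primePows_filter_minFac_le {g : ℕ → ℝ} (hg : ∀ n, 0 ≤ g n) (P : Finset ℕ) (z : ℝ) :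
    ∑ q ∈ primePows z with q.minFac ∈ P, g q ≤
      ∑ p ∈ P, ∑ a ∈ Icc 1 (Nat.log 2 ⌊z⌋₊), g (p ^ a) := by
  set s := (primePows z).filter (fun q => q.minFac ∈ P) with hs
  have hpp : ∀ q ∈ s, IsPrimePow q := fun q hq => by
    simp only [hs, primePows, mem_filter] at hq; exact hq.1.2
  have hid : ∀ q ∈ s, q.minFac ^ q.factorization q.minFac = q := fun q hq =>
    (hpp q hq).minFac_pow_factorization_eq
  let φ : ℕ → ℕ × ℕ := fun q => (q.minFac, q.factorization q.minFac)
  have hinj : Set.InjOn φ s := fun a ha b hb hab => by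
    rw [← hid a ha, ← hid b hb]
    have h1 := congrArg Prod.fst hab
    have h2 := congrArg Prod.snd hab
    simp only [φ] at h1 h2
    rw [h2, h1]
  calc ∑ q ∈ s, g q = ∑ x ∈ s.image φ, g (x.1 ^ x.2) := by
        rw [sum_image hinj]
        exact sum_congr rfl fun q hq => by simp only [φ]; rw [hid q hq]
    _ ≤ ∑ x ∈ P ×ˢ Icc 1 (Nat.log 2 ⌊z⌋₊), g (x.1 ^ x.2) := by
        refine sum_le_sum_of_subset_of_nonneg (fun x hx => ?_) (fun _ _ _ => hg _)
        obtain ⟨q, hq, rfl⟩ := mem_image.1 hx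
        have hq1 := hpp q hq
        have hp := Nat.minFac_prime hq1.one_lt.ne'
        have hq2 := hq
        simp only [hs, primePows, mem_filter, mem_Icc] at hq2
        simp only [φ, mem_product, mem_Icc]
        refine ⟨hq2.2, hp.factorization_pos_of_dvd hq1.pos.ne' (Nat.minFac_dvd q), ?_⟩
        refine Nat.le_log_of_pow_le one_lt_two ?_
        calc 2 ^ _ ≤ q.minFac ^ _ := Nat.pow_le_pow_left hp.two_le _
          _ = q := hid q hq
          _ ≤ _ := hq2.1.1.2
    _ = _ := sum_product ..

lemma natLog_two_floor_le {z : ℝ} (hz : 1 ≤ z) : (Nat.log 2 ⌊z⌋₊ : ℝ) ≤ 2 * log z := by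
  have h1 : (2 : ℝ) ^ Nat.log 2 ⌊z⌋₊ ≤ z := by
    have h2 := Nat.pow_log_le_self 2 (Nat.floor_pos.2 hz).ne'
    exact (by exact_mod_cast h2 : (2 : ℝ) ^ Nat.log 2 ⌊z⌋₊ ≤ (⌊z⌋₊ : ℝ)).trans
      (Nat.floor_le (by linarith))
  have h3 := log_le_log (by positivity) h1
  rw [log_pow] at h3
  have hl2 : 1 / 2 < log 2 := by have := log_two_gt_d9; linarith
  have : (0 : ℝ) ≤ Nat.log 2 ⌊z⌋₊ := by positivity
  nlinarith

lemma sum_log_primePows_filter_minFac_le (P : Finset ℕ) {z : ℝ} (hz : 1 ≤ z) :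
    ∑ q ∈ primePows z with q.minFac ∈ P, log q ≤ 2 * #P * log z ^ 2 := by
  have hl := log_nonneg hz
  have key := sum_primePows_filter_minFac_le (g := fun q => if (q : ℝ) ≤ z then log q else 0)
    (fun n => by split_ifs <;> [exact log_natCast_nonneg n; exact le_rfl]) P z
  calc ∑ q ∈ primePows z with q.minFac ∈ P, log q
      = ∑ q ∈ primePows z with q.minFac ∈ P, if (q : ℝ) ≤ z then log q else 0 := by
        refine sum_congr rfl fun q hq => ?_
        rw [if_pos ((mem_primePows (by linarith)).1 (mem_filter.1 hq).1).1]
    _ ≤ _ := key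
    _ ≤ ∑ p ∈ P, ∑ a ∈ Icc 1 (Nat.log 2 ⌊z⌋₊), log z := by
        refine sum_le_sum fun p _ => sum_le_sum fun a _ => ?_
        split_ifs with h
        · rcases Nat.eq_zero_or_pos (p ^ a) with h0 | h0
          · rw [h0]; simpa using hl
          · exact log_le_log (by exact_mod_cast h0) h
        · exact hl
    _ = #P * (Nat.log 2 ⌊z⌋₊ * log z) := by simp
    _ ≤ #P * (2 * log z * log z) := by gcongr; exact natLog_two_floor_le hz
    _ = _ := by ring

lemma sum_Icc_one_inv_pow_le {p : ℕ} (hp : 2 ≤ p) (E : ℕ) :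
    ∑ a ∈ Icc 1 E, (1 : ℝ) / (p : ℝ) ^ a ≤ 2 / p := by
  have hp' : (2 : ℝ) ≤ p := by exact_mod_cast hp
  have h : ∑ a ∈ Icc 1 E, (1 : ℝ) / (p : ℝ) ^ a ≤ 1 / (p - 1) * (1 - 1 / (p : ℝ) ^ E) := by
    induction E with
    | zero => simp
    | succ E ih =>
      rw [sum_Icc_succ_top (by omega)]
      have : (0 : ℝ) < p - 1 := by linarith
      have hpp : (0 : ℝ) < p := by linarith
      refine (add_le_add_left ih _).trans (le_of_eq ?_)
      field_simp
      ring
  refine h.trans ?_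
  have : (0 : ℝ) < p - 1 := by linarith
  have h2 : 0 < 1 / (p : ℝ) ^ E := by positivity
  calc 1 / ((p : ℝ) - 1) * (1 - 1 / (p : ℝ) ^ E) ≤ 1 / ((p : ℝ) - 1) * 1 := by
        gcongr; linarith
    _ ≤ 2 / p := by
        rw [mul_one, div_le_div_iff₀ this (by linarith)]; linarith

lemma sum_inv_primePows_filter_minFac_le {P : Finset ℕ} (hP : ∀ p ∈ P, p.Prime) (z : ℝ) :
    ∑ q ∈ primePows z with q.minFac ∈ P, (1 : ℝ) / q ≤ ∑ p ∈ P, (2 : ℝ) / p := by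
  refine (sum_primePows_filter_minFac_le (g := fun q => 1 / (q : ℝ)) (fun _ => by positivity)
    P z).trans (sum_le_sum fun p hp => ?_)
  simpa using sum_Icc_one_inv_pow_le (hP p hp).two_le _

lemma sum_inv_primePows_mul_minFac_le (z : ℝ) :
    ∑ q ∈ primePows z, (1 : ℝ) / (q * q.minFac) ≤ 4 := by
  set P := (Icc 2 ⌊z⌋₊).filter Nat.Prime with hP
  have e : (primePows z).filter (fun q => q.minFac ∈ P) = primePows z := by
    refine filter_true_of_mem fun q hq => ?_
    simp only [primePows, mem_filter, mem_Icc] at hq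
    have hp := Nat.minFac_prime hq.2.one_lt.ne'
    simp only [hP, mem_filter, mem_Icc]
    exact ⟨⟨hp.two_le, (Nat.minFac_le hq.2.pos).trans hq.1.2⟩, hp⟩
  have h1 : ∀ p ∈ P, p.Prime := fun p hp => (mem_filter.1 hp).2
  rw [← e]
  refine (sum_primePows_filter_minFac_le (g := fun q => 1 / ((q : ℝ) * q.minFac))
    (fun _ => by positivity) P z).trans ?_
  calc ∑ p ∈ P, ∑ a ∈ Icc 1 (Nat.log 2 ⌊z⌋₊), 1 / (((p ^ a : ℕ) : ℝ) * ((p ^ a).minFac : ℕ))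
      = ∑ p ∈ P, (1 / (p : ℝ)) * ∑ a ∈ Icc 1 (Nat.log 2 ⌊z⌋₊), 1 / (p : ℝ) ^ a := by
        refine sum_congr rfl fun p hp => ?_
        rw [mul_sum]
        refine sum_congr rfl fun a ha => ?_
        rw [(h1 p hp).pow_minFac (by have := mem_Icc.1 ha; omega)]
        push_cast
        rw [div_mul_div_comm, mul_comm (p : ℝ), one_mul]
    _ ≤ ∑ p ∈ P, (1 / (p : ℝ)) * (2 / p) := by
        gcongr with p hp
        exact sum_Icc_one_inv_pow_le (h1 p hp).two_le _
    _ ≤ ∑ p ∈ Icc 2 ⌊z⌋₊, (1 / (p : ℝ)) * (2 / p) :=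
        sum_le_sum_of_subset_of_nonneg (filter_subset _ _) (fun _ _ _ => by positivity)
    _ ≤ 4 := by
        have : ∀ n : ℕ, ∑ p ∈ Icc 2 n, (1 / (p : ℝ)) * (2 / p) ≤ 4 - 2 / n := by
          intro n
          induction n with
          | zero => simp
          | succ n ih =>
            rcases Nat.eq_zero_or_pos n with rfl | hn
            · simp; norm_num
            rw [sum_Icc_succ_top (by omega)]
            refine (add_le_add_left ih _).trans ?_
            push_cast
            have hn' : (0 : ℝ) < n := by exact_mod_cast hn
            rw [← sub_nonneg]
            have : (4 - 2 / ((n : ℝ) + 1)) - (4 - 2 / (n : ℝ) + 1 / (n + 1) * (2 / (n + 1)))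
              = 2 / (n * (n + 1) ^ 2) := by
              field_simp; ring
            rw [this]
            positivity
        have h2 := this ⌊z⌋₊
        have : (0 : ℝ) ≤ 2 / (⌊z⌋₊ : ℝ) := by positivity
        linarith

lemma exists_sum_log_primePows_le : ∃ C : ℝ, 0 < C ∧ ∀ z : ℝ, 1 ≤ z →
    ∑ q ∈ primePows z, log q ≤ C * z := by
  obtain ⟨C, hC, h⟩ := exists_abs_sum_log_primePows_sub_le
  refine ⟨C + 1, by linarith, fun z hz => ?_⟩
  have h1 := (abs_le.1 (h z hz)).2
  have h2 : (1 + log z) ^ (-(1 / 36) : ℝ) ≤ 1 :=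
    rpow_le_one_of_one_le_of_nonpos (by linarith [log_nonneg hz]) (by norm_num)
  have h3 : C * z * (1 + log z) ^ (-(1 / 36) : ℝ) ≤ C * z * 1 := by gcongr
  linarith

lemma exists_abs_sum_inv_primePows_sub_le : ∃ C : ℝ, 0 < C ∧ ∀ z : ℝ, 1 ≤ z →
    |∑ q ∈ primePows z, (1 : ℝ) / q - log (1 + log z)| ≤ C := by
  obtain ⟨C, hC, hpsi⟩ := exists_abs_sum_log_primePows_sub_le
  have hl2 : 1 / 2 < log 2 := by have := log_two_gt_d9; linarith
  have hl2' : log 2 < 1 := by have := log_two_lt_d9; linarith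
  set M : ℝ := |log (log 2) - 1 / log 2| with hM
  refine ⟨2 * (C + 1) + 2 + M + 700 * C + 2, by positivity, fun z hz => ?_⟩
  have hz0 : 0 < z := by linarith
  have hlz := log_nonneg hz
  rcases lt_or_ge z 2 with hz2 | hz2
  · have e : primePows z = ∅ := by
      refine eq_empty_of_forall_notMem fun q hq => ?_
      have := (mem_primePows hz0.le).1 hq
      have h2 : (2 : ℝ) ≤ q := by exact_mod_cast this.2.one_lt
      linarith [this.1]
    have h1 : log z ≤ log 2 := log_le_log hz0 hz2.le
    have h2 := log_nonneg (show 1 ≤ 1 + log z by linarith)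
    have h3 := log_le_sub_one_of_pos (show 0 < 1 + log z by linarith)
    have h4 : 0 ≤ M := abs_nonneg _
    rw [e, sum_empty, zero_sub, abs_neg, abs_of_nonneg h2]
    linarith
  have hlz2 : log 2 ≤ log z := log_le_log (by norm_num) hz2
  set c : ℕ → ℝ := fun k => if IsPrimePow k then log k else 0 with hc
  set f : ℝ → ℝ := fun t => 1 / (t * log t) with hf
  set f' : ℝ → ℝ := fun t => -((log t + 1) / (t * log t) ^ 2) with hf'
  have hpos : ∀ t : ℝ, 2 ≤ t → 0 < t ∧ log 2 ≤ log t ∧ 0 < log t := fun t ht => by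
    have : log 2 ≤ log t := log_le_log (by norm_num) ht
    exact ⟨by linarith, this, by linarith⟩
  have hder : ∀ t : ℝ, 2 ≤ t → HasDerivAt f (f' t) t := fun t ht => by
    obtain ⟨h0, -, h1⟩ := hpos t ht
    have h := ((hasDerivAt_id t).mul (hasDerivAt_log h0.ne')).inv (mul_pos h0 h1).ne'
    have e : f = (id * log)⁻¹ := by ext; simp [hf]
    rw [e]
    refine h.congr_deriv ?_
    simp only [hf', id, Pi.mul_apply]
    field_simp
  have hsum : ∀ t : ℝ, ∑ k ∈ Icc 0 ⌊t⌋₊, c k = ∑ q ∈ primePows t, log q := fun t => by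
    rw [primePows, sum_filter, Icc_eq_cons_Ioc (Nat.zero_le _), sum_cons]
    simp only [hc, not_isPrimePow_zero, if_false, zero_add]
    rfl
  have hcont : ContinuousOn f' (Set.Icc 2 z) := by
    have hlog : ContinuousOn log (Set.Icc 2 z) :=
      continuousOn_log.mono fun t ht => (hpos t ht.1).1.ne'
    refine ((hlog.add continuousOn_const).div ((continuousOn_id.mul hlog).pow 2)
      fun t ht => ?_).neg
    obtain ⟨h0, -, h1⟩ := hpos t ht.1
    exact (pow_pos (mul_pos h0 h1) 2).ne'
  have hdeq : Set.EqOn (deriv f) f' (Set.Icc 2 z) := fun t ht => (hder t ht.1).deriv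
  have hint : MeasureTheory.IntegrableOn (deriv f) (Set.Icc 2 z) :=
    (hcont.congr hdeq).integrableOn_Icc
  have abel := sum_mul_eq_sub_integral_mul₁ c (f := f) (by simp [hc]) (by simp [hc]) z
    (fun t ht => (hder t ht.1).differentiableAt) hint
  have e1 : ∑ k ∈ Icc 0 ⌊z⌋₊, f k * c k = ∑ q ∈ primePows z, (1 : ℝ) / q := by
    rw [primePows, sum_filter, Icc_eq_cons_Ioc (Nat.zero_le _), sum_cons]
    simp only [hc, not_isPrimePow_zero, if_false, mul_zero, zero_add]
    refine sum_congr rfl fun k _ => ?_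
    split_ifs with hk
    · have h1 : (1 : ℝ) < k := by exact_mod_cast hk.one_lt
      have h2 := log_pos h1
      simp only [hf]; field_simp
    · simp
  rw [e1, hsum, ← intervalIntegral.integral_of_le hz2] at abel
  -- the integral
  have hI : IntervalIntegrable (fun t => deriv f t * ∑ k ∈ Icc 0 ⌊t⌋₊, c k)
      MeasureTheory.volume 2 z := by
    rw [intervalIntegrable_iff_integrableOn_Icc_of_le hz2]
    exact integrableOn_mul_sum_Icc c (by norm_num) hint
  set G : ℝ → ℝ := fun t => log (log t) - 1 / log t with hG
  set G' : ℝ → ℝ := fun t => (log t + 1) / (t * log t ^ 2) with hG'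
  set H : ℝ → ℝ := fun t => -(324 * C) * (1 + log t) ^ (-(1 / 36) : ℝ) with hH
  set H' : ℝ → ℝ := fun t => 9 * C * ((1 + log t) ^ (-(1 / 36) - 1 : ℝ) / t) with hH'
  have hGd : ∀ t : ℝ, 2 ≤ t → HasDerivAt G (G' t) t := fun t ht => by
    obtain ⟨h0, -, h1⟩ := hpos t ht
    have h := ((hasDerivAt_log h0.ne').log h1.ne').sub ((hasDerivAt_log h0.ne').inv h1.ne')
    have e : G = (fun y => log (log y)) - log⁻¹ := by ext; simp [hG]
    rw [e]
    refine h.congr_deriv ?_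
    simp only [hG']
    field_simp
    ring
  have hHd : ∀ t : ℝ, 2 ≤ t → HasDerivAt H (H' t) t := fun t ht => by
    obtain ⟨h0, -, h1⟩ := hpos t ht
    have h := (((hasDerivAt_log h0.ne').const_add 1).rpow_const (p := (-(1 / 36) : ℝ))
      (Or.inl (by positivity))).const_mul (-(324 * C))
    refine h.congr_deriv ?_
    simp only [hH']
    field_simp
    ring
  have hlogc : ContinuousOn log (Set.uIcc 2 z) := by
    rw [Set.uIcc_of_le hz2]
    exact continuousOn_log.mono fun t ht => (hpos t ht.1).1.ne'
  have hGc : ContinuousOn G' (Set.uIcc 2 z) := by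
    refine (hlogc.add continuousOn_const).div (continuousOn_id.mul (hlogc.pow 2)) fun t ht => ?_
    rw [Set.uIcc_of_le hz2] at ht
    obtain ⟨h0, -, h1⟩ := hpos t ht.1
    exact (mul_pos h0 (pow_pos h1 2)).ne'
  have hHc : ContinuousOn H' (Set.uIcc 2 z) := by
    refine continuousOn_const.mul (((continuousOn_const.add hlogc).rpow_const fun t ht => ?_).div
      continuousOn_id fun t ht => ?_)
    all_goals
      rw [Set.uIcc_of_le hz2] at ht
      obtain ⟨h0, -, h1⟩ := hpos t ht.1
    · exact Or.inl (show 1 + log t ≠ 0 by positivity)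
    · exact h0.ne'
  have ftG : ∫ t in 2..z, G' t = G z - G 2 :=
    intervalIntegral.integral_eq_sub_of_hasDerivAt
      (fun t ht => hGd t (by rw [Set.uIcc_of_le hz2] at ht; exact ht.1)) hGc.intervalIntegrable
  have ftH : ∫ t in 2..z, H' t = H z - H 2 :=
    intervalIntegral.integral_eq_sub_of_hasDerivAt
      (fun t ht => hHd t (by rw [Set.uIcc_of_le hz2] at ht; exact ht.1)) hHc.intervalIntegrable
  have bd : ∀ t ∈ Set.Icc 2 z, |-(deriv f t * ∑ k ∈ Icc 0 ⌊t⌋₊, c k) - G' t| ≤ H' t := by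
    intro t ht
    obtain ⟨h0, h2, h1⟩ := hpos t ht.1
    rw [hdeq ht, hsum]
    have e : -(f' t * ∑ q ∈ primePows t, log q) - G' t =
        (log t + 1) / (t * log t) ^ 2 * (∑ q ∈ primePows t, log q - t) := by
      simp only [hf', hG']; field_simp
    rw [e, abs_mul, abs_of_nonneg (by positivity)]
    have h3 := hpsi t (by linarith [ht.1])
    have h4 : (log t + 1) ≤ 3 * log t := by linarith
    calc _ ≤ (log t + 1) / (t * log t) ^ 2 * (C * t * (1 + log t) ^ (-(1 / 36) : ℝ)) := by gcongr
      _ = C * (1 + log t) ^ (-(1 / 36) : ℝ) / (t * (1 + log t)) * ((log t + 1) / log t) ^ 2 := by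
        field_simp; ring
      _ ≤ C * (1 + log t) ^ (-(1 / 36) : ℝ) / (t * (1 + log t)) * 3 ^ 2 := by
        gcongr; rwa [div_le_iff₀ h1]
      _ = H' t := by
        simp only [hH']; rw [rpow_sub_one (by positivity)]; field_simp; norm_num
  have i1 : ∫ t in 2..z, (G' t - H' t) ≤ ∫ t in 2..z, -(deriv f t * ∑ k ∈ Icc 0 ⌊t⌋₊, c k) :=
    intervalIntegral.integral_mono_on hz2 (hGc.sub hHc).intervalIntegrable hI.neg
      fun t ht => by have := (abs_le.1 (bd t ht)).1; linarith
  have i2 : ∫ t in 2..z, -(deriv f t * ∑ k ∈ Icc 0 ⌊t⌋₊, c k) ≤ ∫ t in 2..z, (G' t + H' t) :=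
    intervalIntegral.integral_mono_on hz2 hI.neg (hGc.add hHc).intervalIntegrable
      fun t ht => by have := (abs_le.1 (bd t ht)).2; linarith
  rw [intervalIntegral.integral_neg,
    intervalIntegral.integral_sub hGc.intervalIntegrable hHc.intervalIntegrable, ftG, ftH] at i1
  rw [intervalIntegral.integral_neg,
    intervalIntegral.integral_add hGc.intervalIntegrable hHc.intervalIntegrable, ftG, ftH] at i2
  have b1 : ∀ t : ℝ, 2 ≤ t → |H t| ≤ 324 * C := fun t ht => by
    obtain ⟨h0, h2, h1⟩ := hpos t ht
    have : (1 + log t) ^ (-(1 / 36) : ℝ) ≤ 1 :=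
      rpow_le_one_of_one_le_of_nonpos (by linarith) (by norm_num)
    simp only [hH]
    rw [abs_mul, abs_neg, abs_of_nonneg (by positivity : (0:ℝ) ≤ 324 * C),
      abs_of_nonneg (by positivity)]
    nlinarith
  have hH1 := abs_le.1 (b1 z hz2)
  have hH2 := abs_le.1 (b1 2 le_rfl)
  have hp0 := hpsi z hz
  have hfz : 0 ≤ f z * ∑ q ∈ primePows z, log q ∧
      f z * ∑ q ∈ primePows z, log q ≤ 2 * (C + 1) := by
    have h0 : 0 ≤ ∑ q ∈ primePows z, log q := sum_nonneg fun q _ => log_natCast_nonneg q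
    have h1 : ∑ q ∈ primePows z, log q ≤ (C + 1) * z := by
      have h2 : (1 + log z) ^ (-(1 / 36) : ℝ) ≤ 1 :=
        rpow_le_one_of_one_le_of_nonpos (by linarith) (by norm_num)
      have h3 : C * z * (1 + log z) ^ (-(1 / 36) : ℝ) ≤ C * z * 1 := by gcongr
      linarith [(abs_le.1 hp0).2]
    have hl : 0 < log z := by linarith
    refine ⟨by positivity, ?_⟩
    calc f z * ∑ q ∈ primePows z, log q ≤ f z * ((C + 1) * z) := by gcongr
      _ = (C + 1) * (1 / log z) := by simp only [hf]; field_simp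
      _ ≤ (C + 1) * 2 := by
        gcongr; rw [div_le_iff₀ hl]; linarith
      _ = _ := by ring
  have hG2 : |G 2| = M := rfl
  have hG2' := abs_le.1 hG2.le
  have hl : 0 < log z := by linarith
  have hinv : 0 ≤ 1 / log z ∧ 1 / log z ≤ 2 :=
    ⟨by positivity, by rw [div_le_iff₀ hl]; linarith⟩
  have hGz : G z = log (log z) - 1 / log z := rfl
  have hll : log (log z) ≤ log (1 + log z) ∧ log (1 + log z) ≤ log (log z) + 1 / log z := by
    refine ⟨log_le_log hl (by linarith), ?_⟩
    have h1 : 1 + log z = log z * (1 + 1 / log z) := by field_simp; ring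
    have h2 := log_le_sub_one_of_pos (show 0 < 1 + 1 / log z by positivity)
    rw [h1, log_mul hl.ne' (by positivity)]
    linarith
  rw [abel, abs_le]
  constructor <;> linarith [hfz.1, hfz.2, hinv.1, hinv.2, hll.1, hll.2, hH1.1, hH1.2, hH2.1, hH2.2]

/-- The integers `n ≤ x` with exactly `k` prime factors, none of them in `P`. -/
noncomputable def levelSet (P : Finset ℕ) (k : ℕ) (x : ℝ) : Finset ℕ :=
  (Icc 1 ⌊x⌋₊).filter (fun n => Disjoint n.primeFactors P ∧ #n.primeFactors = k)

/-- The number of elements of `levelSet P k x`, as a real number. -/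
noncomputable def levelCount (P : Finset ℕ) (k : ℕ) (x : ℝ) : ℝ := #(levelSet P k x)

/-- The sum of the reciprocals of the elements of `levelSet P k x`. -/
noncomputable def levelSum (P : Finset ℕ) (k : ℕ) (x : ℝ) : ℝ :=
  ∑ n ∈ levelSet P k x, (1 : ℝ) / n

lemma mem_levelSet {P : Finset ℕ} {k : ℕ} {x : ℝ} {n : ℕ} (hx : 0 ≤ x) :
    n ∈ levelSet P k x ↔
      n ≠ 0 ∧ (n : ℝ) ≤ x ∧ Disjoint n.primeFactors P ∧ #n.primeFactors = k := by
  simp only [levelSet, mem_filter, mem_Icc, Nat.le_floor_iff hx, Nat.one_le_iff_ne_zero]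
  tauto

lemma sum_levelSet_succ_eq (P : Finset ℕ) (k : ℕ) {x : ℝ} (hx : 0 ≤ x) (H : ℕ → ℕ → ℝ) :
    ∑ n ∈ levelSet P (k + 1) x, ∑ p ∈ n.primeFactors,
        H (p ^ n.factorization p) (n / p ^ n.factorization p) =
      ∑ m ∈ levelSet P k x,
        ∑ q ∈ primePows (x / m) with q.minFac ∉ m.primeFactors ∪ P, H q m := by
  rw [sum_sigma', sum_sigma']
  refine sum_bij' (fun s _ => ⟨s.1 / s.2 ^ s.1.factorization s.2, s.2 ^ s.1.factorization s.2⟩)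
    (fun s _ => ⟨s.2 * s.1, s.2.minFac⟩) ?_ ?_ ?_ ?_ ?_
  · rintro ⟨n, p⟩ h
    simp only [mem_sigma, mem_levelSet hx] at h
    obtain ⟨⟨hn0, hnx, hd, hk⟩, hp⟩ := h
    have hpp := Nat.prime_of_mem_primeFactors hp
    have hv : n.factorization p ≠ 0 :=
      (hpp.factorization_pos_of_dvd hn0 (Nat.dvd_of_mem_primeFactors hp)).ne'
    have hmul := Nat.ordProj_mul_ordCompl_eq_self n p
    have hm0 : n / p ^ n.factorization p ≠ 0 := (Nat.ordCompl_pos p hn0).ne'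
    have hpf : (n / p ^ n.factorization p).primeFactors = n.primeFactors.erase p :=
      by rw [← Nat.support_factorization, Nat.factorization_ordCompl, Finsupp.support_erase]; rfl
    have hmx : ((n / p ^ n.factorization p : ℕ) : ℝ) ≤ x :=
      le_trans (by exact_mod_cast Nat.div_le_self _ _) hnx
    simp only [mem_sigma, mem_levelSet hx, mem_filter, mem_union, not_or,
      mem_primePows (div_nonneg hx (Nat.cast_nonneg _))]
    refine ⟨⟨hm0, hmx, ?_, ?_⟩, ⟨?_, ?_⟩, ?_, ?_⟩
    · rw [hpf]; exact disjoint_of_subset_left (erase_subset _ _) hd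
    · rw [hpf, card_erase_of_mem hp, hk]; rfl
    · rw [le_div_iff₀ (by exact_mod_cast Nat.pos_of_ne_zero hm0)]
      rw [← Nat.cast_mul, hmul]; exact hnx
    · exact hpp.isPrimePow.pow hv
    · rw [hpp.pow_minFac hv, hpf]; simp
    · rw [hpp.pow_minFac hv]; exact disjoint_left.1 hd hp
  · rintro ⟨m, q⟩ h
    simp only [mem_sigma, mem_levelSet hx, mem_filter, mem_union, not_or,
      mem_primePows (div_nonneg hx (Nat.cast_nonneg _))] at h
    obtain ⟨⟨hm0, hmx, hd, hk⟩, ⟨hqx, hq⟩, hqm, hqP⟩ := h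
    have hpp := Nat.minFac_prime hq.one_lt.ne'
    have hpf : (q * m).primeFactors = insert q.minFac m.primeFactors := by
      rw [Nat.primeFactors_mul hq.pos.ne' hm0]
      conv_lhs => rw [← hq.minFac_pow_factorization_eq]
      rw [Nat.primeFactors_prime_pow _ hpp, insert_eq]
      exact (hpp.factorization_pos_of_dvd hq.pos.ne' (Nat.minFac_dvd q)).ne'
    simp only [mem_sigma, mem_levelSet hx]
    refine ⟨⟨mul_ne_zero hq.pos.ne' hm0, ?_, ?_, ?_⟩, ?_⟩
    · rw [le_div_iff₀ (by exact_mod_cast Nat.pos_of_ne_zero hm0)] at hqx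
      exact_mod_cast hqx
    · rw [hpf, disjoint_insert_left]; exact ⟨hqP, hd⟩
    · rw [hpf, card_insert_of_notMem hqm, hk]
    · rw [hpf]; exact mem_insert_self _ _
  · rintro ⟨n, p⟩ h
    simp only [mem_sigma, mem_levelSet hx] at h
    obtain ⟨⟨hn0, hnx, hd, hk⟩, hp⟩ := h
    have hpp := Nat.prime_of_mem_primeFactors hp
    have hv : n.factorization p ≠ 0 :=
      (hpp.factorization_pos_of_dvd hn0 (Nat.dvd_of_mem_primeFactors hp)).ne'
    simp only [Nat.ordProj_mul_ordCompl_eq_self, hpp.pow_minFac hv]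
  · rintro ⟨m, q⟩ h
    simp only [mem_sigma, mem_levelSet hx, mem_filter, mem_union, not_or,
      mem_primePows (div_nonneg hx (Nat.cast_nonneg _))] at h
    obtain ⟨⟨hm0, hmx, hd, hk⟩, ⟨hqx, hq⟩, hqm, hqP⟩ := h
    have hpp := Nat.minFac_prime hq.one_lt.ne'
    have hqm' : q.minFac ∉ m.factorization.support := hqm
    have hfac : (q * m).factorization q.minFac = q.factorization q.minFac := by
      rw [Nat.factorization_mul hq.pos.ne' hm0, Finsupp.add_apply,
        Finsupp.notMem_support_iff.1 hqm', add_zero]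
    simp only [hfac]
    rw [hq.minFac_pow_factorization_eq]
    simp only [Nat.mul_div_cancel_left m hq.pos]
  · rintro ⟨n, p⟩ _
    rfl

lemma levelCount_nonneg (P : Finset ℕ) (k : ℕ) (x : ℝ) : 0 ≤ levelCount P k x :=
  Nat.cast_nonneg _

lemma levelSum_nonneg (P : Finset ℕ) (k : ℕ) (x : ℝ) : 0 ≤ levelSum P k x :=
  sum_nonneg fun _ _ => by positivity

lemma levelSet_mono (P : Finset ℕ) (k : ℕ) {x y : ℝ} (h : x ≤ y) :
    levelSet P k x ⊆ levelSet P k y :=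
  filter_subset_filter _ (Icc_subset_Icc_right (Nat.floor_le_floor h))

lemma levelSum_mono (P : Finset ℕ) (k : ℕ) {x y : ℝ} (h : x ≤ y) :
    levelSum P k x ≤ levelSum P k y :=
  sum_le_sum_of_subset_of_nonneg (levelSet_mono P k h) fun _ _ _ => by positivity

lemma levelCount_le (P : Finset ℕ) (k : ℕ) {x : ℝ} (hx : 0 ≤ x) : levelCount P k x ≤ x := by
  refine le_trans ?_ (Nat.floor_le hx)
  have := card_filter_le (Icc 1 ⌊x⌋₊) (fun n => Disjoint n.primeFactors P ∧ #n.primeFactors = k)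
  rw [Nat.card_Icc, Nat.add_sub_cancel] at this
  exact Nat.cast_le.2 this

lemma levelSet_zero (P : Finset ℕ) {x : ℝ} (hx : 1 ≤ x) : levelSet P 0 x = {1} := by
  ext n
  rw [mem_levelSet (by linarith), mem_singleton, card_eq_zero, Nat.primeFactors_eq_empty]
  constructor
  · rintro ⟨h0, -, -, h⟩; tauto
  · rintro rfl; simpa using hx

lemma levelCount_zero (P : Finset ℕ) {x : ℝ} (hx : 1 ≤ x) : levelCount P 0 x = 1 := by
  simp [levelCount, levelSet_zero P hx]

lemma levelSum_zero (P : Finset ℕ) {x : ℝ} (hx : 1 ≤ x) : levelSum P 0 x = 1 := by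
  simp [levelSum, levelSet_zero P hx]

lemma sum_log_levelSet_succ (P : Finset ℕ) (k : ℕ) {x : ℝ} (hx : 0 ≤ x) :
    ∑ n ∈ levelSet P (k + 1) x, log n =
      ∑ m ∈ levelSet P k x,
        ∑ q ∈ primePows (x / m) with q.minFac ∉ m.primeFactors ∪ P, log q := by
  rw [← sum_levelSet_succ_eq P k hx (fun q _ => log q)]
  refine sum_congr rfl fun n hn => ?_
  have h0 := ((mem_levelSet hx).1 hn).1
  have e : ∏ p ∈ n.primeFactors, p ^ n.factorization p = n := Nat.prod_factorization_pow_eq_self h0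
  conv_lhs => rw [← e]
  push_cast
  rw [log_prod]
  intro p hp
  have := (Nat.prime_of_mem_primeFactors hp).pos
  positivity

lemma succ_mul_levelCount (P : Finset ℕ) (k : ℕ) {x : ℝ} (hx : 0 ≤ x) :
    ((k : ℝ) + 1) * levelCount P (k + 1) x =
      ∑ m ∈ levelSet P k x,
        ∑ _q ∈ primePows (x / m) with _q.minFac ∉ m.primeFactors ∪ P, (1 : ℝ) := by
  rw [← sum_levelSet_succ_eq P k hx (fun _ _ => 1), levelCount]
  rw [sum_congr rfl (g := fun _ => (k : ℝ) + 1)]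
  · rw [sum_const, nsmul_eq_mul, mul_comm]
  · intro n hn
    simp [((mem_levelSet hx).1 hn).2.2.2]

lemma succ_mul_levelSum (P : Finset ℕ) (k : ℕ) {x : ℝ} (hx : 0 ≤ x) :
    ((k : ℝ) + 1) * levelSum P (k + 1) x =
      ∑ m ∈ levelSet P k x, 1 / (m : ℝ) *
        ∑ q ∈ primePows (x / m) with q.minFac ∉ m.primeFactors ∪ P, 1 / (q : ℝ) := by
  simp_rw [mul_sum]
  rw [← sum_levelSet_succ_eq P k hx (fun q m => 1 / (m : ℝ) * (1 / (q : ℝ))), levelSum, mul_sum]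
  refine sum_congr rfl fun n hn => ?_
  rw [sum_congr rfl (g := fun _ => 1 / (n : ℝ))]
  · simp [((mem_levelSet hx).1 hn).2.2.2]
  · intro p hp
    rw [one_div_mul_one_div, ← Nat.cast_mul, mul_comm, Nat.ordProj_mul_ordCompl_eq_self]

lemma sum_levelSet_succ_inv_mul_sum_inv_le (P : Finset ℕ) (k : ℕ) {x : ℝ} (hx : 0 ≤ x) :
    ∑ n ∈ levelSet P (k + 1) x, 1 / (n : ℝ) * ∑ p ∈ n.primeFactors, 1 / (p : ℝ) ≤
      4 * levelSum P k x := by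
  have h := sum_levelSet_succ_eq P k hx (fun q m => 1 / (m : ℝ) * (1 / ((q : ℝ) * q.minFac)))
  calc _ = _ := by
        refine (sum_congr rfl fun n hn => ?_)
        rw [mul_sum]
        refine sum_congr rfl fun p hp => ?_
        have hpp := Nat.prime_of_mem_primeFactors hp
        have h0 := ((mem_levelSet hx).1 hn).1
        have hv : n.factorization p ≠ 0 :=
          (hpp.factorization_pos_of_dvd h0 (Nat.dvd_of_mem_primeFactors hp)).ne'
        rw [hpp.pow_minFac hv, one_div_mul_one_div, one_div_mul_one_div, ← mul_assoc,
          ← Nat.cast_mul (n / _), mul_comm (n / _), Nat.ordProj_mul_ordCompl_eq_self]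
    _ = _ := h
    _ ≤ ∑ m ∈ levelSet P k x, 1 / (m : ℝ) * 4 := by
        refine sum_le_sum fun m _ => ?_
        rw [← mul_sum]
        gcongr
        refine le_trans ?_ (sum_inv_primePows_mul_minFac_le (x / m))
        exact sum_le_sum_of_subset_of_nonneg (filter_subset _ _) fun _ _ _ => by positivity
    _ = _ := by rw [← sum_mul, levelSum, mul_comm]

/-- The weight governing the size of `levelCount P j t` for `t ≤ x`. -/
noncomputable def levelWeight (P : Finset ℕ) (x : ℝ) : ℕ → ℝ
  | 0 => 1
  | j + 1 => levelSum P j x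

lemma levelWeight_nonneg (P : Finset ℕ) (x : ℝ) (j : ℕ) : 0 ≤ levelWeight P x j := by
  cases j
  · exact zero_le_one
  · exact levelSum_nonneg ..

lemma one_add_log_le_two_mul_sqrt {t : ℝ} (ht : 1 ≤ t) : 1 + log t ≤ 2 * √t := by
  have h0 : 0 < t := by linarith
  have h1 := log_le_sub_one_of_pos (sqrt_pos.2 h0)
  rw [log_sqrt h0.le] at h1
  linarith

lemma levelCount_succ_le_mul_levelSum (P : Finset ℕ) (k : ℕ) {t : ℝ} (ht : 0 ≤ t) :
    levelCount P (k + 1) t ≤ t * levelSum P k t := by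
  have h : ((k : ℝ) + 1) * levelCount P (k + 1) t ≤ t * levelSum P k t := by
    rw [succ_mul_levelCount P k ht, levelSum, mul_sum]
    refine sum_le_sum fun m _ => ?_
    rw [sum_const, nsmul_eq_mul, mul_one, mul_one_div]
    refine le_trans ?_ (Nat.floor_le (div_nonneg ht (Nat.cast_nonneg m)))
    refine Nat.cast_le.2 ((card_filter_le _ _).trans ((card_filter_le _ _).trans ?_))
    simp
  have h2 := levelCount_nonneg P (k + 1) t
  have : (0 : ℝ) ≤ k := by positivity
  nlinarith

lemma one_le_div_of_mem_levelSet {P : Finset ℕ} {k : ℕ} {x : ℝ} {n : ℕ} (hx : 0 ≤ x)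
    (h : n ∈ levelSet P k x) : (0 : ℝ) < n ∧ 1 ≤ x / n := by
  have h1 := (mem_levelSet hx).1 h
  have h2 : (0 : ℝ) < n := by exact_mod_cast Nat.pos_of_ne_zero h1.1
  exact ⟨h2, by rw [le_div_iff₀ h2]; linarith⟩

lemma exists_levelCount_le : ∃ C : ℝ, 0 < C ∧ ∀ (P : Finset ℕ) (j : ℕ) (x t : ℝ), 1 ≤ t → t ≤ x →
    levelCount P j t ≤ C * levelWeight P x j * t / (1 + log t) := by
  obtain ⟨C, hC, hpsi⟩ := exists_sum_log_primePows_le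
  refine ⟨4 + 4 * C, by positivity, fun P j x t ht htx => ?_⟩
  have hl := log_nonneg ht
  have ht0 : 0 < t := by linarith
  have hs := one_add_log_le_two_mul_sqrt ht
  have hs1 : 1 ≤ √t := one_le_sqrt.2 ht
  have hss := mul_self_sqrt ht0.le
  have hst : √t * (1 + log t) ≤ 2 * t := by nlinarith
  rw [le_div_iff₀ (by linarith)]
  cases j with
  | zero =>
    rw [levelCount_zero P ht, levelWeight]
    nlinarith
  | succ j =>
    simp only [levelWeight]
    set A := levelSum P j x with hA
    have hA0 : 0 ≤ A := levelSum_nonneg ..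
    have hAt : levelSum P j t ≤ A := levelSum_mono _ _ htx
    have hN := levelCount_succ_le_mul_levelSum P j ht0.le
    have hN' : levelCount P (j + 1) t ≤ t * A := hN.trans (by gcongr)
    rcases le_or_gt (log t) 1 with h1 | h1
    · have h0 : 0 ≤ t * A := by positivity
      have := mul_le_mul hN' (show 1 + log t ≤ 2 by linarith) (by linarith) h0
      nlinarith [mul_nonneg hC.le h0]
    · have hlog : ∑ n ∈ levelSet P (j + 1) t, log n ≤ C * t * A := by
        rw [sum_log_levelSet_succ P j ht0.le]
        calc _ ≤ ∑ m ∈ levelSet P j t, C * t * (1 / (m : ℝ)) := by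
              refine sum_le_sum fun m hm => ?_
              refine le_trans (sum_le_sum_of_subset_of_nonneg (filter_subset _ _)
                fun _ _ _ => log_natCast_nonneg _) ?_
              refine (hpsi _ (one_le_div_of_mem_levelSet ht0.le hm).2).trans (le_of_eq (by ring))
          _ = C * t * levelSum P j t := by rw [← mul_sum, levelSum]
          _ ≤ _ := by gcongr
      have hsq : levelCount P (j + 1) √t ≤ √t * A :=
        (levelCount_succ_le_mul_levelSum P j (sqrt_nonneg t)).trans (by
          gcongr
          exact levelSum_mono _ _ ((sqrt_le_left (by linarith)).2 (by nlinarith) |>.trans htx))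
      have hsplit : levelCount P (j + 1) t * (log t / 2) ≤
          levelCount P (j + 1) √t * (log t / 2) + C * t * A := by
        refine le_trans ?_ (add_le_add_right hlog _)
        simp only [levelCount]
        rw [← nsmul_eq_mul, ← nsmul_eq_mul, ← sum_const, ← sum_const]
        have hsub : levelSet P (j + 1) √t ⊆ levelSet P (j + 1) t :=
          levelSet_mono _ _ (sqrt_le_left (by linarith) |>.2 (by nlinarith))
        rw [← sum_sdiff hsub, ← sum_sdiff (f := fun n : ℕ => log n) hsub]
        have h2 : 0 ≤ ∑ n ∈ levelSet P (j + 1) √t, log n :=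
          sum_nonneg fun _ _ => log_natCast_nonneg _
        have h3 : ∑ n ∈ levelSet P (j + 1) t \ levelSet P (j + 1) √t, log t / 2 ≤
            ∑ n ∈ levelSet P (j + 1) t \ levelSet P (j + 1) √t, log n := by
          refine sum_le_sum fun n hn => ?_
          rw [mem_sdiff, mem_levelSet ht0.le, mem_levelSet (sqrt_nonneg _)] at hn
          obtain ⟨⟨a, b, c⟩, d⟩ := hn
          have : √t < n := by
            by_contra! h
            exact d ⟨a, h, c⟩
          rw [← log_sqrt ht0.le]
          exact log_le_log (by positivity) this.le
        linarith
      have hh : levelCount P (j + 1) t * (1 + log t) ≤ 4 * (levelCount P (j + 1) t * (log t / 2)) := by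
        have := levelCount_nonneg P (j + 1) t
        nlinarith
      have h5 : levelCount P (j + 1) √t * (log t / 2) ≤ t * A := by
        calc _ ≤ √t * A * (log t / 2) := by gcongr
          _ = (√t * log t) / 2 * A := by ring
          _ ≤ t * A := by gcongr; nlinarith
      calc _ ≤ _ := hh
        _ ≤ 4 * (t * A + C * t * A) := by linarith
        _ = _ := by ring

lemma sum_levelSet_le_sum_dyadic (P : Finset ℕ) (j : ℕ) {y B : ℝ} (hy : 1 ≤ y)
    (hN : ∀ t, 1 ≤ t → t ≤ y → levelCount P j t ≤ B * t / (1 + log t))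
    {f : ℝ → ℝ} {F : ℕ → ℝ} (hF : ∀ i, 0 ≤ F i)
    (hfF : ∀ (i : ℕ) (z : ℝ), 2 ^ i ≤ z → z < 2 ^ (i + 1) → z ≤ y → f z ≤ F i) :
    ∑ n ∈ levelSet P j y, f (y / n) ≤
      ∑ i ∈ range (Nat.log 2 ⌊y⌋₊ + 1), F i * (B * (y / 2 ^ i) / (1 + log (y / 2 ^ i))) := by
  have hy0 : 0 < y := by linarith
  have hz : ∀ n ∈ levelSet P j y, (0 : ℝ) < n ∧ 1 ≤ y / n ∧ y / n ≤ y := fun n hn => by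
    have h := one_le_div_of_mem_levelSet hy0.le hn
    have h1 : (1 : ℝ) ≤ n := by exact_mod_cast Nat.one_le_iff_ne_zero.2 ((mem_levelSet hy0.le).1 hn).1
    exact ⟨h.1, h.2, div_le_self hy0.le h1⟩
  have hmaps : ∀ n ∈ levelSet P j y,
      Nat.log 2 ⌊y / n⌋₊ ∈ range (Nat.log 2 ⌊y⌋₊ + 1) := fun n hn =>
    mem_range.2 (Nat.lt_succ_of_le (Nat.log_mono_right (Nat.floor_le_floor (hz n hn).2.2)))
  rw [← sum_fiberwise_of_maps_to hmaps]
  refine sum_le_sum fun i hi => ?_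
  have h2i : (2 : ℝ) ^ i ≤ y := by
    have := Nat.pow_le_of_le_log (b := 2) (Nat.floor_pos.2 hy).ne' (Nat.lt_succ_iff.1 (mem_range.1 hi))
    exact (by exact_mod_cast this : (2 : ℝ) ^ i ≤ (⌊y⌋₊ : ℝ)).trans (Nat.floor_le hy0.le)
  have h1i : (1 : ℝ) ≤ 2 ^ i := one_le_pow₀ (by norm_num)
  have hfib : ∀ n ∈ levelSet P j y, Nat.log 2 ⌊y / n⌋₊ = i →
      (2 : ℝ) ^ i ≤ y / n ∧ y / n < 2 ^ (i + 1) := fun n hn he => by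
    obtain ⟨h0, h1, -⟩ := hz n hn
    have hf : ⌊y / n⌋₊ ≠ 0 := (Nat.floor_pos.2 h1).ne'
    constructor
    · have := Nat.pow_log_le_self 2 hf
      rw [he] at this
      exact (by exact_mod_cast this : (2 : ℝ) ^ i ≤ (⌊y / n⌋₊ : ℝ)).trans
        (Nat.floor_le (by linarith))
    · have := Nat.lt_pow_succ_log_self one_lt_two ⌊y / n⌋₊
      rw [he] at this
      refine (Nat.lt_floor_add_one _).trans_le ?_
      exact_mod_cast this
  calc _ ≤ ∑ n ∈ (levelSet P j y).filter (fun n : ℕ => Nat.log 2 ⌊y / n⌋₊ = i), F i := by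
        refine sum_le_sum fun n hn => ?_
        rw [mem_filter] at hn
        have := hfib n hn.1 hn.2
        exact hfF i _ this.1 this.2 (hz n hn.1).2.2
    _ = F i * #((levelSet P j y).filter fun n : ℕ => Nat.log 2 ⌊y / n⌋₊ = i) := by
        rw [sum_const, nsmul_eq_mul, mul_comm]
    _ ≤ F i * levelCount P j (y / 2 ^ i) := by
        refine mul_le_mul_of_nonneg_left (Nat.cast_le.2 (card_le_card fun n hn => ?_)) (hF i)
        rw [mem_filter] at hn
        have h := (mem_levelSet hy0.le).1 hn.1
        have h3 := (hfib n hn.1 hn.2).1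
        have h0 := (hz n hn.1).1
        rw [mem_levelSet (by positivity)]
        refine ⟨h.1, ?_, h.2.2⟩
        rw [le_div_iff₀ h0] at h3
        rw [le_div_iff₀ (by positivity)]; linarith
    _ ≤ _ := by
        refine mul_le_mul_of_nonneg_left (hN _ ?_ (div_le_self hy0.le h1i)) (hF i)
        rw [le_div_iff₀ (by positivity)]; linarith

lemma sum_levelSet_le_weighted (P : Finset ℕ) (j : ℕ) {y B : ℝ} (hy : 1 ≤ y) (hB : 0 ≤ B)
    (hN : ∀ t, 1 ≤ t → t ≤ y → levelCount P j t ≤ B * t / (1 + log t))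
    {f : ℝ → ℝ} {F : ℕ → ℝ} (hF : ∀ i, 0 ≤ F i)
    (hfF : ∀ (i : ℕ) (z : ℝ), 2 ^ i ≤ z → z < 2 ^ (i + 1) → z ≤ y → f z ≤ F i) :
    ∑ n ∈ levelSet P j y, f (y / n) ≤
      B * y / (1 + log y) * ∑ i ∈ range (Nat.log 2 ⌊y⌋₊ + 1), F i / 2 ^ i * (1 + i) := by
  refine (sum_levelSet_le_sum_dyadic P j hy hN hF hfF).trans ?_
  rw [mul_sum]
  refine sum_le_sum fun i hi => ?_
  have hy0 : 0 < y := by linarith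
  have h2i : (2 : ℝ) ^ i ≤ y := by
    have := Nat.pow_le_of_le_log (b := 2) (Nat.floor_pos.2 hy).ne' (Nat.lt_succ_iff.1 (mem_range.1 hi))
    exact (by exact_mod_cast this : (2 : ℝ) ^ i ≤ (⌊y⌋₊ : ℝ)).trans (Nat.floor_le hy0.le)
  have hl2 : log 2 ≤ 1 := by have := log_two_lt_d9; linarith
  have hl : log (y / 2 ^ i) = log y - i * log 2 := by
    rw [log_div hy0.ne' (by positivity), log_pow]
  have hl0 : 0 ≤ log (y / 2 ^ i) := log_nonneg (by rw [le_div_iff₀ (by positivity)]; linarith)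
  have hly := log_nonneg hy
  have key : 1 / (1 + log (y / 2 ^ i)) ≤ (1 + i) / (1 + log y) := by
    rw [div_le_div_iff₀ (by linarith) (by linarith)]
    have : (0 : ℝ) ≤ i := by positivity
    nlinarith
  calc F i * (B * (y / 2 ^ i) / (1 + log (y / 2 ^ i)))
      = F i * B * (y / 2 ^ i) * (1 / (1 + log (y / 2 ^ i))) := by ring
    _ ≤ F i * B * (y / 2 ^ i) * ((1 + i) / (1 + log y)) := by
        have := hF i
        gcongr
    _ = _ := by ring

lemma exists_sum_levelSet_sqrt_le : ∃ C : ℝ, 0 < C ∧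
    ∀ (P : Finset ℕ) (j : ℕ) (y B : ℝ), 1 ≤ y → 0 ≤ B →
    (∀ t, 1 ≤ t → t ≤ y → levelCount P j t ≤ B * t / (1 + log t)) →
    ∑ n ∈ levelSet P j y, √(y / n) ≤ C * (B * y / (1 + log y)) := by
  set r : ℝ := √2 / 2 with hr
  have h2 : √2 < 2 := by rw [sqrt_lt' (by norm_num)]; norm_num
  have h20 : 0 < √2 := by positivity
  have hr0 : 0 < r := by positivity
  have hr1 : ‖r‖ < 1 := by rw [Real.norm_of_nonneg hr0.le, hr]; linarith
  have hs1 : Summable fun i : ℕ => (i : ℝ) ^ 1 * r ^ i := summable_pow_mul_geometric_of_norm_lt_one 1 hr1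
  have hs2 : Summable fun i : ℕ => r ^ i := summable_geometric_of_norm_lt_one hr1
  have hs : Summable fun i : ℕ => 2 * r ^ i * (1 + i) := by
    refine ((hs1.add hs2).mul_left 2).congr fun i => by ring
  refine ⟨∑' i : ℕ, 2 * r ^ i * (1 + i) + 1, ?_, fun P j y B hy hB hN => ?_⟩
  · have : 0 ≤ ∑' i : ℕ, 2 * r ^ i * (1 + i) := tsum_nonneg fun i => by positivity
    linarith
  have h := sum_levelSet_le_weighted P j hy hB hN (f := sqrt) (F := fun i => 2 * √2 ^ i)
    (fun i => by positivity) (fun i z h1 h3 _ => by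
      rw [sqrt_le_left (by positivity), mul_pow, ← pow_mul, mul_comm i, pow_mul, sq_sqrt (by norm_num)]
      have : (0 : ℝ) < 2 ^ i := by positivity
      rw [pow_succ] at h3; linarith)
  refine h.trans ?_
  have hly := log_nonneg hy
  rw [mul_comm]
  refine mul_le_mul_of_nonneg_right ?_ (by positivity)
  calc ∑ i ∈ range (Nat.log 2 ⌊y⌋₊ + 1), 2 * √2 ^ i / 2 ^ i * (1 + (i : ℝ))
      = ∑ i ∈ range (Nat.log 2 ⌊y⌋₊ + 1), 2 * r ^ i * (1 + (i : ℝ)) :=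
        sum_congr rfl fun i _ => by rw [hr, div_pow]; ring
    _ ≤ ∑' i : ℕ, 2 * r ^ i * (1 + i) := hs.sum_le_tsum _ fun i _ => by positivity
    _ ≤ _ := by linarith

lemma sum_levelSet_filter_div_lt_le (P : Finset ℕ) (j : ℕ) {y B Z : ℝ} (hy : 1 ≤ y) (hB : 0 ≤ B)
    (hZ : 1 ≤ Z) (hN : ∀ t, 1 ≤ t → t ≤ y → levelCount P j t ≤ B * t / (1 + log t)) :
    ∑ n ∈ levelSet P j y with ((n : ℕ) : ℝ) * Z > y, y / (n : ℝ) ≤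
      8 * B * y * (1 + log Z) ^ 2 / (1 + log y) := by
  have hy0 : 0 < y := by linarith
  have hly := log_nonneg hy
  have hlZ := log_nonneg hZ
  have h := sum_levelSet_le_weighted P j hy hB hN (f := fun z => if z < Z then z else 0)
    (F := fun i => if (2 : ℝ) ^ i ≤ Z then 2 ^ (i + 1) else 0)
    (fun i => by positivity) (fun i z h1 h3 _ => by
      by_cases hz : z < Z
      · simp only [if_pos hz, if_pos (h1.trans hz.le)]; exact h3.le
      · simp only [if_neg hz]; positivity)
  rw [sum_filter]
  calc _ = ∑ n ∈ levelSet P j y, if y / (n : ℝ) < Z then y / (n : ℝ) else 0 := by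
        refine sum_congr rfl fun n hn => ?_
        have h0 := (one_le_div_of_mem_levelSet hy0.le hn).1
        simp only [div_lt_iff₀ h0, gt_iff_lt, mul_comm Z]
    _ ≤ _ := h
    _ ≤ B * y / (1 + log y) * (8 * (1 + log Z) ^ 2) := by
        refine mul_le_mul_of_nonneg_left ?_ (by positivity)
        set J := Nat.log 2 ⌊Z⌋₊ with hJ
        have hJ' := natLog_two_floor_le hZ
        rw [← hJ] at hJ'
        calc _ ≤ ∑ i ∈ range (Nat.log 2 ⌊y⌋₊ + 1), if i ∈ range (J + 1) then 2 * (1 + (J : ℝ)) else 0 := by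
              refine sum_le_sum fun i _ => ?_
              by_cases h2 : (2 : ℝ) ^ i ≤ Z
              · have hi : i ≤ J := by
                  refine Nat.le_log_of_pow_le one_lt_two (Nat.le_floor ?_)
                  exact_mod_cast h2
                have hi' : (i : ℝ) ≤ J := by exact_mod_cast hi
                rw [if_pos h2, if_pos (mem_range.2 (by omega)), pow_succ, mul_comm ((2 : ℝ) ^ i),
                  mul_div_assoc, div_self (by positivity)]
                linarith
              · rw [if_neg h2]; simp only [zero_div, zero_mul]; positivity
          _ ≤ ∑ i ∈ range (J + 1), 2 * (1 + (J : ℝ)) := by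
              rw [← sum_filter]
              refine sum_le_sum_of_subset_of_nonneg (fun i hi => (mem_filter.1 hi).2)
                fun _ _ _ => by positivity
          _ = 2 * (1 + (J : ℝ)) ^ 2 := by
              rw [sum_const, card_range, nsmul_eq_mul]; push_cast; ring
          _ ≤ 2 * (2 * (1 + log Z)) ^ 2 := by gcongr; linarith
          _ = _ := by ring
    _ = _ := by ring

lemma sum_range_inv_sqrt_le (n : ℕ) : ∑ i ∈ range n, 1 / √(1 + i) ≤ 2 * √n := by
  induction n with
  | zero => simp
  | succ n ih =>
    rw [sum_range_succ]
    have h0 : (0 : ℝ) ≤ n := by positivity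
    have h1 : 0 < √(1 + (n : ℝ)) := sqrt_pos.2 (by positivity)
    have h2 := sq_sqrt h0
    have h3 := sq_sqrt (show (0 : ℝ) ≤ 1 + n by positivity)
    have h4 : √(n : ℝ) ≤ √(1 + (n : ℝ)) := sqrt_le_sqrt (by linarith)
    have : 1 / √(1 + (n : ℝ)) ≤ 2 * √(1 + (n : ℝ)) - 2 * √n := by
      rw [div_le_iff₀ h1]
      nlinarith [sqrt_nonneg (n : ℝ), sq_nonneg (√(1 + (n : ℝ)) - √n)]
    push_cast
    rw [add_comm (n : ℝ) 1]
    linarith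

lemma log_le_two_mul_sqrt {w : ℝ} (hw : 0 < w) : log w ≤ 2 * √w := by
  have h := log_le_sub_one_of_pos (sqrt_pos.2 hw)
  rw [log_sqrt hw.le] at h
  linarith

lemma sum_levelSet_log_ratio_le (P : Finset ℕ) (j : ℕ) {y B : ℝ} (hy : 1 ≤ y) (hB : 0 ≤ B)
    (hN : ∀ t, 1 ≤ t → t ≤ y → levelCount P j t ≤ B * t / (1 + log t)) :
    ∑ n ∈ levelSet P j y,
        (if y / (n : ℝ) ≤ √y then y / (n : ℝ) * log ((1 + log y) / (1 + log (y / n))) else 0) ≤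
      32 * B * y := by
  have hy0 : 0 < y := by linarith
  have hly := log_nonneg hy
  have hl2 : 1 / 2 < log 2 := by have := log_two_gt_d9; linarith
  set F : ℕ → ℝ := fun i => if (2 : ℝ) ^ i ≤ √y then
      2 ^ (i + 1) * (2 * √(2 * (1 + log y) / (1 + i))) else 0 with hF
  have h := sum_levelSet_le_sum_dyadic P j hy hN
    (f := fun z => if z ≤ √y then z * log ((1 + log y) / (1 + log z)) else 0)
    (F := F) (fun i => by simp only [hF]; positivity) (fun i z h1 h3 hzy => by
      by_cases hz : z ≤ √y
      · have h1i : (1 : ℝ) ≤ 2 ^ i := one_le_pow₀ (by norm_num)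
        have hz0 : 0 < z := by linarith
        have hlz : i * log 2 ≤ log z := by
          rw [← log_pow]; exact log_le_log (by positivity) h1
        have hi0 : (0 : ℝ) ≤ i := by positivity
        have hlz' : (1 + (i : ℝ)) / 2 ≤ 1 + log z := by nlinarith
        simp only [hF, if_pos hz, if_pos (h1.trans hz)]
        have hlz0 : 0 ≤ log z := log_nonneg (by linarith)
        have hlzy : log z ≤ log y := log_le_log hz0 hzy
        have hlog0 : 0 ≤ log ((1 + log y) / (1 + log z)) :=
          log_nonneg (by rw [le_div_iff₀ (by linarith)]; linarith)
        refine mul_le_mul h3.le ?_ hlog0 (by positivity)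
        refine (log_le_two_mul_sqrt (by positivity)).trans ?_
        gcongr 2 * √?_
        rw [div_le_div_iff₀ (by linarith) (by positivity)]
        nlinarith
      · simp only [if_neg hz, hF]; positivity)
  refine h.trans ?_
  calc _ ≤ ∑ i ∈ range (Nat.log 2 ⌊y⌋₊ + 1), 8 * √2 * B * y / √(1 + log y) * (1 / √(1 + i)) := by
        refine sum_le_sum fun i _ => ?_
        by_cases h2 : (2 : ℝ) ^ i ≤ √y
        · have hk : (1 + log y) / 2 ≤ 1 + log (y / 2 ^ i) := by
            have : √y ≤ y / 2 ^ i := by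
              rw [le_div_iff₀ (by positivity)]
              nlinarith [mul_self_sqrt hy0.le, sqrt_nonneg y]
            have := log_le_log (sqrt_pos.2 hy0) this
            rw [log_sqrt hy0.le] at this
            linarith
          simp only [hF, if_pos h2]
          calc _ ≤ 2 ^ (i + 1) * (2 * √(2 * (1 + log y) / (1 + i))) *
                  (B * (y / 2 ^ i) / ((1 + log y) / 2)) := by gcongr
            _ = 8 * B * y * √(2 * (1 + log y) / (1 + i)) / (1 + log y) := by
                field_simp; ring
            _ = _ := by
                rw [sqrt_div (by positivity), sqrt_mul (by norm_num)]
                have h5 := sq_sqrt (show 0 ≤ 1 + log y by linarith)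
                have h6 : 0 < √(1 + log y) := sqrt_pos.2 (by linarith)
                have h7 : 0 < √(1 + (i : ℝ)) := sqrt_pos.2 (by positivity)
                nth_rewrite 2 [← h5]
                field_simp
        · simp only [hF, if_neg h2, zero_mul]; positivity
    _ = 8 * √2 * B * y / √(1 + log y) * ∑ i ∈ range (Nat.log 2 ⌊y⌋₊ + 1), 1 / √(1 + i) := by
        rw [mul_sum]
    _ ≤ 8 * √2 * B * y / √(1 + log y) * (2 * (√2 * √(1 + log y))) := by
        gcongr
        refine (sum_range_inv_sqrt_le _).trans ?_
        rw [← sqrt_mul (by norm_num)]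
        gcongr
        have := natLog_two_floor_le hy
        push_cast
        linarith
    _ = _ := by
        have h6 : 0 < √(1 + log y) := sqrt_pos.2 (by linarith)
        field_simp
        rw [sq_sqrt (by norm_num)]; ring

lemma exists_succ_mul_levelSum_le : ∃ C : ℝ, 0 < C ∧ ∀ (P : Finset ℕ) (k : ℕ) (x : ℝ), 1 ≤ x →
    ((k : ℝ) + 1) * levelSum P (k + 1) x ≤ levelSum P k x * (log (1 + log x) + C) := by
  obtain ⟨C, hC, hM⟩ := exists_abs_sum_inv_primePows_sub_le
  refine ⟨C, hC, fun P k x hx => ?_⟩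
  have hx0 : 0 < x := by linarith
  rw [succ_mul_levelSum P k hx0.le, levelSum, sum_mul]
  refine sum_le_sum fun m hm => ?_
  obtain ⟨hm0, hm1⟩ := one_le_div_of_mem_levelSet hx0.le hm
  refine mul_le_mul_of_nonneg_left ?_ (by positivity)
  refine (sum_le_sum_of_subset_of_nonneg (filter_subset _ _) fun _ _ _ => by positivity).trans ?_
  have h1 := (abs_le.1 (hM _ hm1)).2
  have h2 : log (1 + log (x / m)) ≤ log (1 + log x) := by
    have h3 : (1 : ℝ) ≤ m := by
      exact_mod_cast Nat.one_le_iff_ne_zero.2 ((mem_levelSet hx0.le).1 hm).1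
    have h4 := log_nonneg hm1
    refine log_le_log (by linarith) ?_
    have := log_le_log (by linarith) (div_le_self hx0.le h3)
    linarith
  linarith

lemma sum_primePows_filter_notMem_ge {g : ℕ → ℝ} (hg : ∀ n, 0 ≤ g n) (Q P : Finset ℕ) (z : ℝ) :
    ∑ q ∈ primePows z, g q - ∑ q ∈ primePows z with q.minFac ∈ Q, g q
        - ∑ q ∈ primePows z with q.minFac ∈ P, g q ≤
      ∑ q ∈ primePows z with q.minFac ∉ Q ∪ P, g q := by
  simp only [sum_filter, ← sum_sub_distrib]
  refine sum_le_sum fun q _ => ?_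
  have := hg q
  by_cases h1 : q.minFac ∈ Q <;> by_cases h2 : q.minFac ∈ P <;> simp [h1, h2, this]


lemma exists_le_succ_mul_levelSum : ∃ C : ℝ, 0 < C ∧ ∀ P : Finset ℕ, (∀ p ∈ P, p.Prime) →
    ∀ (k : ℕ) (x : ℝ), 1 ≤ x →
    levelSum P k x * (log (1 + log x) - (C + ∑ p ∈ P, (2 : ℝ) / p)) - C * levelWeight P x k ≤
      ((k : ℝ) + 1) * levelSum P (k + 1) x := by
  obtain ⟨C, hC, hM⟩ := exists_abs_sum_inv_primePows_sub_le
  obtain ⟨C', hC', hU⟩ := exists_levelCount_le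
  refine ⟨C + 1 + 32 * C' + 8, by positivity, fun P hP k x hx => ?_⟩
  have hx0 : 0 < x := by linarith
  have hL := log_nonneg hx
  set α := levelWeight P x k with hα
  have hα0 : 0 ≤ α := levelWeight_nonneg ..
  set S := ∑ p ∈ P, (2 : ℝ) / p with hS
  have hratio := sum_levelSet_log_ratio_le P k hx (B := C' * α) (by positivity)
    (fun t h1 h2 => hU P k x t h1 h2)
  have hpm : ∑ m ∈ levelSet P k x, 1 / (m : ℝ) * ∑ p ∈ m.primeFactors, (2 : ℝ) / p ≤ 8 * α := by
    cases k with
    | zero =>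
      rw [levelSet_zero P hx]
      simpa using hα0
    | succ k =>
      have h := sum_levelSet_succ_inv_mul_sum_inv_le P k hx0.le
      calc _ = 2 * ∑ n ∈ levelSet P (k + 1) x, 1 / (n : ℝ) * ∑ p ∈ n.primeFactors, 1 / (p : ℝ) := by
            simp only [mul_sum]
            exact sum_congr rfl fun n _ => sum_congr rfl fun p _ => by ring
        _ ≤ 2 * (4 * levelSum P k x) := by gcongr
        _ = _ := by rw [hα, levelWeight]; ring
  rw [succ_mul_levelSum P k hx0.le]
  have main : ∀ m ∈ levelSet P k x,
      1 / (m : ℝ) * (log (1 + log x) - (C + 1 + S))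
        - 1 / (m : ℝ) * ∑ p ∈ m.primeFactors, (2 : ℝ) / p
        - (if x / (m : ℝ) ≤ √x then x / (m : ℝ) * log ((1 + log x) / (1 + log (x / m))) else 0) / x ≤
      1 / (m : ℝ) *
        ∑ q ∈ primePows (x / m) with q.minFac ∉ m.primeFactors ∪ P, 1 / (q : ℝ) := by
    intro m hm
    obtain ⟨hm0, hm1⟩ := one_le_div_of_mem_levelSet hx0.le hm
    have hlm := log_nonneg hm1
    have h1 := (abs_le.1 (hM _ hm1)).1
    have h2 := sum_inv_primePows_filter_minFac_le (P := m.primeFactors)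
      (fun p hp => Nat.prime_of_mem_primeFactors hp) (x / m)
    have h3 := sum_inv_primePows_filter_minFac_le hP (x / m)
    have h4 := sum_primePows_filter_notMem_ge (g := fun q => 1 / (q : ℝ)) (fun _ => by positivity)
      m.primeFactors P (x / m)
    have h5 : log ((1 + log x) / (1 + log (x / m))) = log (1 + log x) - log (1 + log (x / m)) :=
      log_div (by linarith) (by linarith)
    have h6 : (if x / (m : ℝ) ≤ √x then x / (m : ℝ) * log ((1 + log x) / (1 + log (x / m)))
        else 0) / x ≥ 1 / (m : ℝ) * (log ((1 + log x) / (1 + log (x / m))) - 1) := by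
      split_ifs with hc
      · rw [ge_iff_le, mul_div_right_comm, div_right_comm, div_self hx0.ne']
        gcongr; linarith
      · rw [zero_div]
        refine mul_nonpos_of_nonneg_of_nonpos (by positivity) ?_
        push Not at hc
        have h7 := log_le_log (sqrt_pos.2 hx0) hc.le
        rw [log_sqrt hx0.le] at h7
        have h8 : (1 + log x) / (1 + log (x / m)) ≤ 2 := by
          rw [div_le_iff₀ (by linarith)]; linarith
        have h9 := log_le_log (by positivity) h8
        have := log_two_lt_d9
        linarith
    rw [h5] at h6 ⊢
    have h7 : (0 : ℝ) < 1 / m := by positivity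
    have h8 : log (1 + log (x / m)) - C - ∑ p ∈ m.primeFactors, (2 : ℝ) / p - S ≤
      ∑ q ∈ primePows (x / m) with q.minFac ∉ m.primeFactors ∪ P, 1 / (q : ℝ) := by linarith
    have h9 := mul_le_mul_of_nonneg_left h8 h7.le
    linarith
  have hsum := sum_le_sum main
  rw [sum_sub_distrib, sum_sub_distrib, ← sum_mul, ← sum_div] at hsum
  have hr2 : (∑ n ∈ levelSet P k x,
        (if x / (n : ℝ) ≤ √x then x / (n : ℝ) * log ((1 + log x) / (1 + log (x / n))) else 0)) / x ≤
      32 * (C' * α) := by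
    rw [div_le_iff₀ hx0]; exact hratio
  have hA : ∑ m ∈ levelSet P k x, 1 / (m : ℝ) = levelSum P k x := rfl
  rw [hA] at hsum
  have hA0 := levelSum_nonneg P k x
  nlinarith [mul_nonneg hC'.le hA0, mul_nonneg hC.le hα0]

lemma abs_log_one_add_log_sub_le {x : ℝ} (h : 1 ≤ log x) :
    0 ≤ log (1 + log x) - log (log x) ∧ log (1 + log x) - log (log x) ≤ 1 := by
  have h0 : 0 < log x := by linarith
  constructor
  · have := log_le_log h0 (show log x ≤ 1 + log x by linarith); linarith
  · rw [← log_div (by positivity) h0.ne']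
    have h1 : (1 + log x) / log x ≤ 2 := by rw [div_le_iff₀ h0]; linarith
    have h2 := log_le_log (by positivity) h1
    have := log_two_lt_d9
    linarith

lemma one_le_log_of_one_le_log_log {x : ℝ} (hx : 2 ≤ x) (h : 1 ≤ log (log x)) : 2 ≤ log x := by
  have h0 : 0 < log x := log_pos (by linarith)
  have h1 := exp_le_exp.2 h
  rw [exp_log h0] at h1
  have := exp_one_gt_d9
  linarith

lemma exists_levelWeight_ratio (R : ℝ) (hR : 0 < R) {P : Finset ℕ} (hP : ∀ p ∈ P, p.Prime) :
    ∃ C D₀ : ℝ, 0 < C ∧ 1 ≤ D₀ ∧ ∀ x : ℝ, 2 ≤ x → D₀ ≤ log (log x) →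
      ∀ k : ℕ, (k : ℝ) ≤ R * log (log x) →
        0 < levelWeight P x (k + 1) ∧
        levelWeight P x k ≤ (2 * R + 1) * levelWeight P x (k + 1) ∧
        (1 ≤ k → |levelWeight P x k - k / log (log x) * levelWeight P x (k + 1)| ≤
          C / log (log x) * levelWeight P x (k + 1)) := by
  obtain ⟨C₁, hC₁, hup⟩ := exists_succ_mul_levelSum_le
  obtain ⟨C₂, hC₂, hlo⟩ := exists_le_succ_mul_levelSum
  set S := ∑ p ∈ P, (2 : ℝ) / p with hS
  have hS0 : 0 ≤ S := sum_nonneg fun _ _ => by positivity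
  set C' := C₂ + S + C₂ * (2 * R + 1) with hC'
  have hC'0 : 0 < C' := by positivity
  refine ⟨2 * R * (C' + C₁ + 1), 2 * C' + 1, by positivity, by linarith, fun x hx hD => ?_⟩
  set D := log (log x) with hDdef
  have hL := one_le_log_of_one_le_log_log hx (by linarith)
  have hE := abs_log_one_add_log_sub_le (x := x) (by linarith)
  have hx1 : 1 ≤ x := by linarith
  have hD0 : 0 < D := by linarith
  intro k
  induction k with
  | zero =>
    intro _
    simp only [levelWeight, levelSum_zero P hx1]
    exact ⟨one_pos, by linarith, by simp⟩
  | succ k ih =>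
    intro hk
    push_cast at hk
    obtain ⟨hpos, hle, -⟩ := ih (by linarith)
    rw [show levelWeight P x (k + 1) = levelSum P k x from rfl] at hpos hle ⊢
    rw [show levelWeight P x (k + 1 + 1) = levelSum P (k + 1) x from rfl]
    set A := levelSum P k x with hA
    set A' := levelSum P (k + 1) x with hA'
    have h1 := hup P k x hx1
    have h2 := hlo P hP k x hx1
    rw [← hS, ← hA, ← hA'] at h2
    rw [← hA, ← hA'] at h1
    have h3 : A * (D - C') ≤ ((k : ℝ) + 1) * A' := by
      have h4 := mul_le_mul_of_nonneg_left hle hC₂.le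
      have h5 := mul_nonneg hpos.le hE.1
      rw [hC']
      linarith
    have h4 : ((k : ℝ) + 1) * A' ≤ A * (D + (C₁ + 1)) := by
      have := mul_le_mul_of_nonneg_left hE.2 hpos.le
      linarith
    have hk0 : (0 : ℝ) < (k : ℝ) + 1 := by positivity
    have hA'0 : 0 < A' := by
      have : 0 < A * (D - C') := mul_pos hpos (by linarith)
      exact (pos_iff_pos_of_mul_pos (this.trans_le h3)).1 hk0
    have h5 : A ≤ 2 * R * A' := by
      have : A * (D / 2) ≤ R * D * A' := by
        calc A * (D / 2) ≤ A * (D - C') := by gcongr; linarith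
          _ ≤ _ := h3
          _ ≤ _ := by gcongr
      have : D * A ≤ D * (2 * R * A') := by linarith
      exact le_of_mul_le_mul_left this hD0
    refine ⟨hA'0, by linarith, fun _ => ?_⟩
    push_cast
    have h6 : A - ((k : ℝ) + 1) / D * A' = (D * A - ((k : ℝ) + 1) * A') / D := by
      field_simp
    rw [h6, abs_div, abs_of_pos hD0, div_mul_eq_mul_div]
    gcongr
    rw [abs_le]
    have h7 := mul_le_mul_of_nonneg_right h5 hC'0.le
    have h8 := mul_le_mul_of_nonneg_right h5 (show 0 ≤ C₁ + 1 by linarith)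
    have h9 : 0 ≤ 2 * R * A' * C' := by positivity
    have h10 : 0 ≤ 2 * R * A' * (C₁ + 1) := by positivity
    constructor <;> linarith

lemma log_rpow_neg_le {L : ℝ} (hL : 2 ≤ L) : L ^ (-(1 / 144) : ℝ) ≤ 144 / log L ∧
    1 / L ≤ 144 / log L ∧ L ^ (-(1 / 2) : ℝ) ≤ 144 / log L := by
  have h0 : 0 < L := by linarith
  have hlog : 0 < log L := log_pos (by linarith)
  have h1 : L ^ (-(1 / 144) : ℝ) ≤ 144 / log L := by
    have h2 := log_le_sub_one_of_pos (show 0 < L ^ (1 / 144 : ℝ) by positivity)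
    rw [log_rpow h0] at h2
    rw [rpow_neg h0.le, le_div_iff₀ hlog, inv_mul_le_iff₀ (by positivity)]
    linarith
  refine ⟨h1, ?_, ?_⟩
  · rw [one_div, ← rpow_neg_one]
    exact (rpow_le_rpow_of_exponent_le (by linarith) (by norm_num)).trans h1
  · exact (rpow_le_rpow_of_exponent_le (by linarith) (by norm_num)).trans h1

lemma exists_sum_levelSet_abs_sub_le : ∃ C : ℝ, 0 < C ∧ ∀ (P : Finset ℕ) (x y : ℝ) (j : ℕ),
    2 ≤ x → 1 ≤ log (log x) → √x ≤ y → y ≤ x →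
    ∑ m ∈ levelSet P j y, |∑ q ∈ primePows (y / m), log q - y / m| ≤
      C * y * (levelWeight P x j + levelWeight P x (j + 1)) / log (log x) := by
  obtain ⟨C₁, hC₁, hpsi⟩ := exists_abs_sum_log_primePows_sub_le
  obtain ⟨C₂, hC₂, hU⟩ := exists_levelCount_le
  refine ⟨144 * C₁ * (1 + 64 * C₂), by positivity, fun P x y j hx hD hxy hyx => ?_⟩
  have hx0 : 0 < x := by linarith
  have hL := one_le_log_of_one_le_log_log hx hD
  set L := log x with hLdef
  have hL0 : 0 < L := by linarith
  have hy1 : 1 ≤ y := (one_le_sqrt.2 (by linarith)).trans hxy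
  have hy0 : 0 < y := by linarith
  have hly : L / 2 ≤ log y := by
    rw [hLdef, ← log_sqrt hx0.le]; exact log_le_log (sqrt_pos.2 hx0) hxy
  set α := levelWeight P x j
  set α' := levelWeight P x (j + 1) with hα'
  have hα0 : 0 ≤ α := levelWeight_nonneg ..
  have hα'0 : 0 ≤ α' := levelWeight_nonneg ..
  set Z := exp (L ^ (1 / 4 : ℝ)) with hZ
  have hL4 : 1 ≤ L ^ (1 / 4 : ℝ) := one_le_rpow (by linarith) (by norm_num)
  have hZ1 : 1 ≤ Z := one_le_exp (by linarith)
  have hlZ : log Z = L ^ (1 / 4 : ℝ) := log_exp _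
  have h1 := sum_levelSet_filter_div_lt_le P j hy1 (B := C₂ * α) (by positivity) hZ1
    (fun t h1 h2 => hU P j x t h1 (h2.trans hyx))
  obtain ⟨r1, -, r2⟩ := log_rpow_neg_le hL
  have h2 : ∀ m ∈ levelSet P j y, |∑ q ∈ primePows (y / m), log q - y / m| ≤
      C₁ * (y / m) * L ^ (-(1 / 144) : ℝ) + C₁ * if (m : ℝ) * Z > y then y / m else 0 := by
    intro m hm
    obtain ⟨hm0, hm1⟩ := one_le_div_of_mem_levelSet hy0.le hm
    refine (hpsi _ hm1).trans ?_
    have hlm := log_nonneg hm1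
    split_ifs with hc
    · have : (1 + log (y / m)) ^ (-(1 / 36) : ℝ) ≤ 1 :=
        rpow_le_one_of_one_le_of_nonpos (by linarith) (by norm_num)
      have h3 : C₁ * (y / m) * (1 + log (y / m)) ^ (-(1 / 36) : ℝ) ≤ C₁ * (y / m) * 1 := by gcongr
      have : 0 ≤ C₁ * (y / m) * L ^ (-(1 / 144) : ℝ) := by positivity
      linarith
    · rw [mul_zero, add_zero]
      gcongr
      push Not at hc
      have h4 : Z ≤ y / m := by rw [le_div_iff₀ hm0]; linarith
      have h5 := log_le_log (by positivity) h4
      rw [hlZ] at h5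
      calc (1 + log (y / m)) ^ (-(1 / 36) : ℝ) ≤ (L ^ (1 / 4 : ℝ)) ^ (-(1 / 36) : ℝ) :=
            rpow_le_rpow_of_nonpos (by positivity) (by linarith) (by norm_num)
        _ = _ := by rw [← rpow_mul hL0.le]; norm_num
  refine (sum_le_sum h2).trans ?_
  rw [sum_add_distrib, ← mul_sum, ← sum_filter]
  have h3 : ∑ m ∈ levelSet P j y, C₁ * (y / m) * L ^ (-(1 / 144) : ℝ) ≤
      C₁ * y * α' * (144 / log L) := by
    calc _ = C₁ * y * L ^ (-(1 / 144) : ℝ) * levelSum P j y := by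
          rw [levelSum, mul_sum]; exact sum_congr rfl fun _ _ => by ring
      _ ≤ C₁ * y * (144 / log L) * α' := by
          have := levelSum_mono P j hyx
          have h0 := levelSum_nonneg P j y
          have hd : 0 < log L := by linarith
          exact mul_le_mul (by gcongr) this h0 (by positivity)
      _ = _ := by ring
  have h4 : 8 * (C₂ * α) * y * (1 + log Z) ^ 2 / (1 + log y) ≤ 64 * C₂ * α * y * (144 / log L) := by
    have h5 : (1 + log Z) ^ 2 / (1 + log y) ≤ 8 * (144 / log L) := by
      calc (1 + log Z) ^ 2 / (1 + log y) ≤ (2 * L ^ (1 / 4 : ℝ)) ^ 2 / (L / 2) := by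
            rw [hlZ]; gcongr <;> linarith
        _ = 8 * L ^ (-(1 / 2) : ℝ) := by
            rw [mul_pow, ← rpow_natCast (L ^ (1 / 4 : ℝ)), ← rpow_mul hL0.le,
              show (-(1 / 2) : ℝ) = 1 / 2 - 1 by norm_num,
              rpow_sub_one hL0.ne']
            norm_num
            ring
        _ ≤ _ := by gcongr
    calc _ = 8 * (C₂ * α) * y * ((1 + log Z) ^ 2 / (1 + log y)) := by ring
      _ ≤ 8 * (C₂ * α) * y * (8 * (144 / log L)) := by gcongr
      _ = _ := by ring
  have h5 : 0 ≤ C₁ * y * α * (144 / log L) := by have : 0 < log L := by linarith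
                                                 positivity
  have h6 : 0 ≤ 64 * C₁ * C₂ * α' * y * (144 / log L) := by have : 0 < log L := by linarith
                                                            positivity
  have h7 := mul_le_mul_of_nonneg_left (h1.trans h4) hC₁.le
  calc _ ≤ C₁ * y * α' * (144 / log L) + C₁ * (64 * C₂ * α * y * (144 / log L)) := by linarith
    _ ≤ (C₁ * y * α' * (144 / log L) + C₁ * (64 * C₂ * α * y * (144 / log L))) +
        (C₁ * y * α * (144 / log L) + 64 * C₁ * C₂ * α' * y * (144 / log L)) := by linarith
    _ = _ := by ring

lemma exists_abs_levelCount_mul_log_sub_le (R : ℝ) (hR : 0 < R) (P : Finset ℕ) :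
    ∃ C : ℝ, 0 < C ∧ ∀ (x y : ℝ) (j : ℕ),
    2 ≤ x → 1 ≤ log (log x) → √x ≤ y → y ≤ x → (j : ℝ) ≤ R * log (log x) →
    |levelCount P (j + 1) y * log y - y * levelSum P j y| ≤
      C * y * (levelWeight P x j + levelWeight P x (j + 1)) / log (log x) := by
  obtain ⟨C₁, hC₁, hE⟩ := exists_sum_levelSet_abs_sub_le
  obtain ⟨C₂, hC₂, hU⟩ := exists_levelCount_le
  obtain ⟨C₃, hC₃, hsq⟩ := exists_sum_levelSet_sqrt_le
  refine ⟨C₁ + 2048 * (R + #P) * (C₃ * C₂) + 1000 * (C₃ * C₂), by positivity,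
    fun x y j hx hD hxy hyx hj => ?_⟩
  have hx0 : 0 < x := by linarith
  have hL := one_le_log_of_one_le_log_log hx hD
  set L := log x with hLdef
  set D := log L with hDdef
  have hL0 : 0 < L := by linarith
  have hD0 : 0 < D := by linarith
  have hy1 : 1 ≤ y := (one_le_sqrt.2 (by linarith)).trans hxy
  have hy0 : 0 < y := by linarith
  have hly : L / 2 ≤ log y := by
    rw [hLdef, ← log_sqrt hx0.le]; exact log_le_log (sqrt_pos.2 hx0) hxy
  set α := levelWeight P x j
  set α' := levelWeight P x (j + 1) with hα'
  have hα0 : 0 ≤ α := levelWeight_nonneg ..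
  have hα'0 : 0 ≤ α' := levelWeight_nonneg ..
  have s1 := hsq P j y (C₂ * α) hy1 (by positivity) (fun t h1 h2 => hU P j x t h1 (h2.trans hyx))
  have s2 := hsq P (j + 1) y (C₂ * α') hy1 (by positivity)
    (fun t h1 h2 => hU P (j + 1) x t h1 (h2.trans hyx))
  have a1 := hE P x y j hx hD hxy hyx
  have hinv : 1 / (1 + log y) ≤ 2 * (1 / L) := by
    rw [div_le_iff₀ (by linarith), mul_one_div, div_mul_eq_mul_div, le_div_iff₀ hL0]; linarith
  -- the error from replacing `log n` by `log y`
  have e1 : levelCount P (j + 1) y * log y - ∑ n ∈ levelSet P (j + 1) y, log n =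
      ∑ n ∈ levelSet P (j + 1) y, log (y / n) := by
    rw [levelCount, ← nsmul_eq_mul, ← sum_const, ← sum_sub_distrib]
    refine sum_congr rfl fun n hn => ?_
    rw [log_div hy0.ne' (one_le_div_of_mem_levelSet hy0.le hn).1.ne']
  have c0 : 0 ≤ ∑ n ∈ levelSet P (j + 1) y, log (y / n) :=
    sum_nonneg fun n hn => log_nonneg (one_le_div_of_mem_levelSet hy0.le hn).2
  have c1 : ∑ n ∈ levelSet P (j + 1) y, log (y / n) ≤ 1000 * (C₃ * C₂) * y * α' / D := by
    calc _ ≤ ∑ n ∈ levelSet P (j + 1) y, 2 * √(y / n) := sum_le_sum fun n hn =>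
          log_le_two_mul_sqrt (by linarith [(one_le_div_of_mem_levelSet hy0.le hn).2])
      _ ≤ 2 * (C₃ * (C₂ * α' * y / (1 + log y))) := by rw [← mul_sum]; gcongr
      _ = 2 * C₃ * C₂ * α' * y * (1 / (1 + log y)) := by ring
      _ ≤ 2 * C₃ * C₂ * α' * y * (2 * (144 / D)) := by
          gcongr
          exact hinv.trans (mul_le_mul_of_nonneg_left (log_rpow_neg_le hL).2.1 (by norm_num))
      _ = 576 * (C₃ * C₂ * y * α' / D) := by ring
      _ ≤ 1000 * (C₃ * C₂ * y * α' / D) := by gcongr; norm_num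
      _ = _ := by ring
  -- the contribution of prime powers not coprime to `m`
  have e2 : ∑ n ∈ levelSet P (j + 1) y, log n - y * levelSum P j y =
      ∑ m ∈ levelSet P j y, (∑ q ∈ primePows (y / m), log q - y / m) -
      ∑ m ∈ levelSet P j y, ∑ q ∈ primePows (y / m) with q.minFac ∈ m.primeFactors ∪ P, log q := by
    rw [sum_log_levelSet_succ P j hy0.le, levelSum, mul_sum, ← sum_sub_distrib, ← sum_sub_distrib]
    refine sum_congr rfl fun m _ => ?_
    rw [← sum_filter_add_sum_filter_not (primePows (y / m))
      (fun q => q.minFac ∈ m.primeFactors ∪ P)]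
    ring
  have d0 : 0 ≤ ∑ m ∈ levelSet P j y,
      ∑ q ∈ primePows (y / m) with q.minFac ∈ m.primeFactors ∪ P, log q :=
    sum_nonneg fun _ _ => sum_nonneg fun _ _ => log_natCast_nonneg _
  have d1 : ∑ m ∈ levelSet P j y,
      ∑ q ∈ primePows (y / m) with q.minFac ∈ m.primeFactors ∪ P, log q ≤
        2048 * (R + #P) * (C₃ * C₂) * y * α / D := by
    calc _ ≤ ∑ m ∈ levelSet P j y, 32 * (R * D + #P) * √(y / m) := by
          refine sum_le_sum fun m hm => ?_
          have hm1 := (one_le_div_of_mem_levelSet hy0.le hm).2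
          refine (sum_log_primePows_filter_minFac_le _ hm1).trans ?_
          have h1 : (#(m.primeFactors ∪ P) : ℝ) ≤ R * D + #P := by
            have h2 := card_union_le m.primeFactors P
            rw [((mem_levelSet hy0.le).1 hm).2.2.2] at h2
            have h3 : (#(m.primeFactors ∪ P) : ℝ) ≤ j + #P := by exact_mod_cast h2
            linarith
          have h2 : log (y / m) ^ 2 ≤ 16 * √(y / m) := by
            refine le_trans ?_ (one_add_log_sq_le hm1)
            have := log_nonneg hm1
            gcongr; linarith
          calc _ ≤ 2 * (R * D + #P) * (16 * √(y / m)) := by gcongr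
            _ = _ := by ring
      _ ≤ 32 * (R * D + #P) * (C₃ * (C₂ * α * y / (1 + log y))) := by
          rw [← mul_sum]; gcongr
      _ = 32 * (C₃ * C₂) * α * y * ((R * D + #P) * (1 / (1 + log y))) := by ring
      _ ≤ 32 * (C₃ * C₂) * α * y * ((R + #P) * (64 / D)) := by
          gcongr 32 * (C₃ * C₂) * α * y * ?_
          calc (R * D + #P) * (1 / (1 + log y)) ≤ (R * D + #P * D) * (2 * (1 / L)) := by
                have h1 : (#P : ℝ) ≤ #P * D := le_mul_of_one_le_right (by positivity) hD
                have h2 := log_nonneg hy1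
                exact mul_le_mul (by linarith) hinv (by positivity) (by positivity)
            _ = (R + #P) * (2 * D / L) := by ring
            _ ≤ _ := by
                gcongr ?_ * ?_
                rw [div_le_div_iff₀ hL0 hD0]
                have h1 := one_add_log_sq_le (show 1 ≤ L by linarith)
                rw [← hDdef] at h1
                have h2 : √L ≤ L := sqrt_le_left hL0.le |>.2 (by nlinarith)
                nlinarith
      _ = _ := by ring
  have a0 : |∑ m ∈ levelSet P j y, (∑ q ∈ primePows (y / m), log q - y / m)| ≤
      C₁ * y * (α + α') / D := (abs_sum_le_sum_abs _ _).trans a1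
  have e3 : levelCount P (j + 1) y * log y - y * levelSum P j y =
      ∑ n ∈ levelSet P (j + 1) y, log (y / n) +
      (∑ m ∈ levelSet P j y, (∑ q ∈ primePows (y / m), log q - y / m) -
      ∑ m ∈ levelSet P j y, ∑ q ∈ primePows (y / m) with q.minFac ∈ m.primeFactors ∪ P, log q) := by
    linarith
  have g1 : 0 ≤ 1000 * (C₃ * C₂) * y * α / D := by positivity
  have g2 : 0 ≤ 2048 * (R + #P) * (C₃ * C₂) * y * α' / D := by positivity
  have e4 : (C₁ + 2048 * (R + #P) * (C₃ * C₂) + 1000 * (C₃ * C₂)) * y * (α + α') / D =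
    C₁ * y * (α + α') / D + (2048 * (R + #P) * (C₃ * C₂) * y * α / D +
      2048 * (R + #P) * (C₃ * C₂) * y * α' / D) + (1000 * (C₃ * C₂) * y * α / D +
      1000 * (C₃ * C₂) * y * α' / D) := by ring
  have a2 := abs_le.1 a0
  rw [e3, e4, abs_le]
  constructor <;> linarith [a2.1, a2.2]

lemma levelSum_sub_levelSum_div_le {P : Finset ℕ} {j : ℕ} {x m B : ℝ} (hx : 1 ≤ x) (hB : 0 ≤ B)
    (hm : 1 ≤ m) (hN : ∀ t, 1 ≤ t → t ≤ x → levelCount P j t ≤ B * t / (1 + log t)) :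
    levelSum P j x - levelSum P j (x / m) ≤ 8 * B * (1 + log m) ^ 2 / (1 + log x) := by
  have hx0 : 0 < x := by linarith
  have h1 := sum_levelSet_filter_div_lt_le P j hx hB hm hN
  have h2 : (levelSet P j x).filter (fun n => ¬ ((n : ℕ) : ℝ) * m > x) = levelSet P j (x / m) := by
    ext n
    rw [mem_filter, mem_levelSet hx0.le, mem_levelSet (by positivity), le_div_iff₀ (by linarith)]
    constructor
    · rintro ⟨⟨a, b, c⟩, d⟩
      exact ⟨a, by linarith, c⟩
    · rintro ⟨a, b, c⟩
      refine ⟨⟨a, ?_, c⟩, by linarith⟩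
      exact (le_mul_of_one_le_right (Nat.cast_nonneg n) hm).trans b
  have h3 : levelSum P j x - levelSum P j (x / m) =
      ∑ n ∈ levelSet P j x with ((n : ℕ) : ℝ) * m > x, 1 / (n : ℝ) := by
    rw [levelSum, levelSum, ← h2, ← sum_filter_add_sum_filter_not (levelSet P j x)
      (fun n => ((n : ℕ) : ℝ) * m > x)]
    ring
  have h4 : ∑ n ∈ levelSet P j x with ((n : ℕ) : ℝ) * m > x, x / n =
      x * ∑ n ∈ levelSet P j x with ((n : ℕ) : ℝ) * m > x, 1 / (n : ℝ) := by
    rw [mul_sum]; exact sum_congr rfl fun _ _ => by ring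
  rw [h3]
  rw [h4] at h1
  refine le_of_mul_le_mul_left (h1.trans (le_of_eq ?_)) hx0
  ring

lemma exists_abs_mul_levelCount_div_sub_le (R : ℝ) (hR : 0 < R) (P : Finset ℕ) :
    ∃ C : ℝ, 0 < C ∧ ∀ (x m : ℝ) (j : ℕ),
    2 ≤ x → 1 ≤ log (log x) → 1 ≤ m → m ≤ √x → (j : ℝ) ≤ R * log (log x) →
    |m * levelCount P (j + 1) (x / m) * (log x / x) - levelWeight P x (j + 1)| ≤
      C * (1 + log m) ^ 2 * (levelWeight P x j + levelWeight P x (j + 1)) / log (log x) := by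
  obtain ⟨C₁, hC₁, hE⟩ := exists_abs_levelCount_mul_log_sub_le R hR P
  obtain ⟨C₂, hC₂, hU⟩ := exists_levelCount_le
  refine ⟨2 * C₁ + 288 + 8 * C₂ * 144, by positivity, fun x m j hx hD hm hmx hj => ?_⟩
  have hx0 : 0 < x := by linarith
  have hL := one_le_log_of_one_le_log_log hx hD
  have hm0 : 0 < m := by linarith
  have hlm := log_nonneg hm
  have hsx : √x * √x = x := mul_self_sqrt hx0.le
  have hs0 : 0 < √x := sqrt_pos.2 hx0
  have hxy : √x ≤ x / m := by
    rw [le_div_iff₀ hm0]; nlinarith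
  have hyx : x / m ≤ x := div_le_self hx0.le hm
  have a1 := hE x (x / m) j hx hD hxy hyx hj
  have a2 := levelSum_sub_levelSum_div_le (P := P) (j := j) (x := x) (m := m)
    (B := C₂ * levelWeight P x j) (by linarith)
    (mul_nonneg hC₂.le (levelWeight_nonneg ..)) hm (fun t h1 h2 => hU P j x t h1 h2)
  have a3 := levelSum_mono P j hyx
  have a4 := levelSum_nonneg P j (x / m)
  have hr := (log_rpow_neg_le hL).2.1
  set L := log x with hLdef
  set D := log L with hDdef
  have hL0 : 0 < L := by linarith
  have hD0 : 0 < D := by linarith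
  set y := x / m with hy
  have hy0 : 0 < y := by positivity
  have hly : L / 2 ≤ log y := by
    rw [hLdef, ← log_sqrt hx0.le]; exact log_le_log (sqrt_pos.2 hx0) hxy
  have hly0 : 0 < log y := by linarith
  have hlog : L = log y + log m := by
    rw [hy, log_div hx0.ne' hm0.ne']; ring
  set α := levelWeight P x j
  set α' := levelWeight P x (j + 1) with hα'
  have hα'' : levelSum P j x = α' := rfl
  rw [hα''] at a2 a3
  have hα0 : 0 ≤ α := levelWeight_nonneg ..
  have hα'0 : 0 ≤ α' := levelWeight_nonneg ..
  have hxm : x = y * m := by rw [hy]; field_simp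
  have e1 : m * levelCount P (j + 1) y * (L / x) - α' =
      (levelCount P (j + 1) y * log y - y * levelSum P j y) * (L / (y * log y)) +
      (levelSum P j y * (log m / log y) - (α' - levelSum P j y)) := by
    rw [hxm, hlog]
    field_simp
    ring
  have hl2 : L / log y ≤ 2 := by rw [div_le_iff₀ hly0]; linarith
  have hlm2 : (1 : ℝ) ≤ (1 + log m) ^ 2 := by nlinarith
  have b1 : |(levelCount P (j + 1) y * log y - y * levelSum P j y) * (L / (y * log y))| ≤
      2 * C₁ * (1 + log m) ^ 2 * (α + α') / D := by
    rw [abs_mul, abs_of_nonneg (show 0 ≤ L / (y * log y) by positivity)]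
    calc _ ≤ C₁ * y * (α + α') / D * (L / (y * log y)) := by gcongr
      _ = C₁ * (α + α') / D * (L / log y) := by field_simp
      _ ≤ C₁ * (α + α') / D * 2 := by gcongr
      _ = 2 * C₁ * 1 * (α + α') / D := by ring
      _ ≤ _ := by gcongr
  have b2 : levelSum P j y * (log m / log y) ≤ 288 * (1 + log m) ^ 2 * α' / D := by
    calc _ ≤ α' * ((1 + log m) ^ 2 / (L / 2)) := by
          gcongr
          nlinarith
      _ = 2 * (1 + log m) ^ 2 * α' * (1 / L) := by ring
      _ ≤ 2 * (1 + log m) ^ 2 * α' * (144 / D) := by gcongr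
      _ = _ := by ring
  have b3 : α' - levelSum P j y ≤ 8 * C₂ * 144 * (1 + log m) ^ 2 * α / D := by
    calc _ ≤ _ := a2
      _ ≤ 8 * (C₂ * α) * (1 + log m) ^ 2 / L := by gcongr; linarith
      _ = 8 * (C₂ * α) * (1 + log m) ^ 2 * (1 / L) := by ring
      _ ≤ 8 * (C₂ * α) * (1 + log m) ^ 2 * (144 / D) := by gcongr
      _ = _ := by ring
  have b4 : 0 ≤ levelSum P j y * (log m / log y) := by positivity
  have b5 : 0 ≤ 288 * (1 + log m) ^ 2 * α / D := by positivity
  have b6 : 0 ≤ 8 * C₂ * 144 * (1 + log m) ^ 2 * α' / D := by positivity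
  have e2 : (2 * C₁ + 288 + 8 * C₂ * 144) * (1 + log m) ^ 2 * (α + α') / D =
      2 * C₁ * (1 + log m) ^ 2 * (α + α') / D +
      (288 * (1 + log m) ^ 2 * α / D + 288 * (1 + log m) ^ 2 * α' / D) +
      (8 * C₂ * 144 * (1 + log m) ^ 2 * α / D + 8 * C₂ * 144 * (1 + log m) ^ 2 * α' / D) := by
    ring
  have b7 := abs_le.1 b1
  rw [e1, e2, abs_le]
  constructor <;> linarith [b7.1, b7.2]

/-- A sequence whose consecutive ratios are close to `r` is close to a geometric sequence. -/
lemma abs_sub_pow_mul_le {a : ℕ → ℝ} {k : ℕ} {R C D : ℝ} (hR : 0 ≤ R) (hC : 0 ≤ C) (hD : 0 < D)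
    (hk : (k : ℝ) ≤ R * D) (ha : ∀ i ≤ k, 0 ≤ a i)
    (h1 : ∀ i < k, a i ≤ (2 * R + 1) * a (i + 1))
    (h2 : ∀ i, 1 ≤ i → i < k → |a i - i / D * a (i + 1)| ≤ C / D * a (i + 1)) (l : ℕ) (hl : l < k) :
    a (k - l) ≤ (2 * R + 1) ^ l * a k ∧
    |a (k - l) - ((k - 1) / D) ^ l * a k| ≤ (C + 1) * (4 * (R + 1)) ^ l / D * a k := by
  induction l with
  | zero => simpa using mul_nonneg (div_nonneg (by linarith) hD.le) (ha k le_rfl)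
  | succ l ih =>
    obtain ⟨i1, i2⟩ := ih (by omega)
    obtain ⟨i, hi⟩ : ∃ i, k - l = i + 1 := ⟨k - l - 1, by omega⟩
    have hi' : k - (l + 1) = i := by omega
    have hik : i < k := by omega
    have hcast : (i : ℝ) = k - 1 - l := by
      have : k = i + 1 + l := by omega
      rw [this]; push_cast; ring
    rw [hi] at i1 i2
    rw [hi']
    have g1 := h1 i hik
    have g2 := h2 i (by omega) hik
    have hak := ha k le_rfl
    refine ⟨?_, ?_⟩
    · calc a i ≤ (2 * R + 1) * a (i + 1) := g1
        _ ≤ (2 * R + 1) * ((2 * R + 1) ^ l * a k) := by gcongr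
        _ = _ := by ring
    · have hr0 : 0 ≤ ((k : ℝ) - 1) / D := by
        have : (1 : ℝ) ≤ k := by exact_mod_cast (show 1 ≤ k by omega)
        exact div_nonneg (by linarith) hD.le
      have hrR : ((k : ℝ) - 1) / D ≤ R := by rw [div_le_iff₀ hD]; linarith
      set r := ((k : ℝ) - 1) / D with hr
      have hid : (i : ℝ) / D = r - l / D := by rw [hcast, hr]; ring
      rw [hid] at g2
      have ha1 := ha (i + 1) (by omega)
      have c1 : |a i - r * a (i + 1)| ≤ (C + 1) * 2 ^ l * ((2 * R + 1) ^ l * a k) / D := by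
        have : a i - r * a (i + 1) = (a i - (r - l / D) * a (i + 1)) - l / D * a (i + 1) := by ring
        rw [this]
        refine (abs_sub _ _).trans ?_
        rw [abs_of_nonneg (show 0 ≤ l / D * a (i + 1) by positivity)]
        have hl2 : (C + l : ℝ) ≤ (C + 1) * 2 ^ l := by
          have b1 : (l : ℝ) ≤ 2 ^ l := by exact_mod_cast Nat.lt_two_pow_self.le
          have b2 : (1 : ℝ) ≤ 2 ^ l := one_le_pow₀ (by norm_num)
          nlinarith
        calc _ ≤ C / D * a (i + 1) + l / D * a (i + 1) := by gcongr
          _ = (C + l) * a (i + 1) / D := by ring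
          _ ≤ _ := by gcongr
      have c2 : a i - r ^ (l + 1) * a k = (a i - r * a (i + 1)) + r * (a (i + 1) - r ^ l * a k) := by
        ring
      rw [c2]
      refine (abs_add_le _ _).trans ?_
      rw [abs_mul, abs_of_nonneg hr0]
      calc _ ≤ (C + 1) * 2 ^ l * ((2 * R + 1) ^ l * a k) / D +
            R * ((C + 1) * (4 * (R + 1)) ^ l / D * a k) := by gcongr
        _ = (C + 1) / D * a k * ((2 * (2 * R + 1)) ^ l + R * (4 * (R + 1)) ^ l) := by
            rw [mul_pow 2 (2 * R + 1)]; ring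
        _ ≤ (C + 1) / D * a k * ((4 * (R + 1)) ^ l + R * (4 * (R + 1)) ^ l) := by
            gcongr ?_ * (?_ ^ l + _); linarith
        _ = (C + 1) / D * a k * ((4 * (R + 1)) ^ l * (1 + R)) := by ring
        _ ≤ (C + 1) / D * a k * ((4 * (R + 1)) ^ l * (4 * (R + 1))) := by gcongr; linarith
        _ = _ := by ring

lemma exists_log_rpow_mul_le (B : ℝ) (hB : 0 ≤ B) : ∃ C : ℝ, 0 < C ∧ ∀ x : ℝ, 2 ≤ x →
    1 ≤ log (log x) → log x ^ B * log (log x) ≤ C * x ^ (1 / 16 : ℝ) := by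
  refine ⟨(16 * (B + 1)) ^ (B + 1), by positivity, fun x hx hD => ?_⟩
  have hL := one_le_log_of_one_le_log_log hx hD
  have hx0 : 0 < x := by linarith
  have hL0 : 0 < log x := by linarith
  calc log x ^ B * log (log x) ≤ log x ^ B * log x :=
        mul_le_mul_of_nonneg_left (by linarith [log_le_sub_one_of_pos hL0]) (by positivity)
    _ = log x ^ (B + 1) := by rw [rpow_add_one hL0.ne']
    _ ≤ (x ^ (1 / (16 * (B + 1))) / (1 / (16 * (B + 1)))) ^ (B + 1) := by
        gcongr
        exact log_le_rpow_div hx0.le (by positivity)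
    _ = (16 * (B + 1) * x ^ (1 / (16 * (B + 1)))) ^ (B + 1) := by
        rw [div_div_eq_mul_div]; ring_nf
    _ = _ := by
        rw [mul_rpow (by positivity) (by positivity), ← rpow_mul hx0.le]
        congr 2
        field_simp

lemma one_add_log_sq_le_rpow {m : ℝ} (hm : 1 ≤ m) : (1 + log m) ^ 2 ≤ 256 * m ^ (1 / 8 : ℝ) := by
  have h1 := log_le_sub_one_of_pos (show 0 < m ^ (1 / 16 : ℝ) by positivity)
  rw [log_rpow (by linarith)] at h1
  have h2 := log_nonneg hm
  calc (1 + log m) ^ 2 ≤ (16 * m ^ (1 / 16 : ℝ)) ^ 2 := by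
        gcongr
        linarith
    _ = 256 * (m ^ (1 / 16 : ℝ)) ^ 2 := by ring
    _ = _ := by rw [← rpow_natCast, ← rpow_mul (by linarith)]; norm_num

/-- The number of `n ≤ y` coprime to `P` with `k - l` prime factors, zero when `l > k`. -/
noncomputable def shiftedCount (P : Finset ℕ) (k l : ℕ) (y : ℝ) : ℝ :=
  if l ≤ k then levelCount P (k - l) y else 0

lemma shiftedCount_nonneg (P : Finset ℕ) (k l : ℕ) (y : ℝ) : 0 ≤ shiftedCount P k l y := by
  unfold shiftedCount
  split_ifs
  exacts [levelCount_nonneg .., le_rfl]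

lemma shiftedCount_le (P : Finset ℕ) (k l : ℕ) {y : ℝ} (hy : 0 ≤ y) : shiftedCount P k l y ≤ y := by
  unfold shiftedCount
  split_ifs
  exacts [levelCount_le P _ hy, hy]

lemma exists_levelWeight_le_levelCount (R : ℝ) (hR : 0 < R) {P : Finset ℕ}
    (hP : ∀ p ∈ P, p.Prime) : ∃ C D₀ : ℝ, 0 < C ∧ 1 ≤ D₀ ∧ ∀ (x : ℝ) (k : ℕ), 2 ≤ x →
    D₀ ≤ log (log x) → 1 ≤ k → (k : ℝ) ≤ R * log (log x) →
    0 < levelWeight P x k ∧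
    levelWeight P x k ≤ 2 * (levelCount P k x * (log x / x)) ∧
    (∀ l < k, levelWeight P x (k - l) ≤ (2 * R + 1) ^ l * levelWeight P x k) ∧
    (∀ l < k, |levelWeight P x (k - l) - ((k - 1) / log (log x)) ^ l * levelWeight P x k| ≤
      C * (4 * (R + 1)) ^ l / log (log x) * levelWeight P x k) ∧
    (∀ l < k, ∀ m, 1 ≤ m → m ≤ √x →
      |m * levelCount P (k - l) (x / m) * (log x / x) - levelWeight P x (k - l)| ≤
        C * m ^ (1 / 8 : ℝ) * levelWeight P x (k - l) / log (log x)) := by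
  obtain ⟨C₁, hC₁, hA⟩ := exists_abs_mul_levelCount_div_sub_le R hR P
  obtain ⟨C₂, D₁, hC₂, hD₁, hB⟩ := exists_levelWeight_ratio R hR hP
  set C := C₁ * 256 * (2 * R + 2) + (C₂ + 1) with hC
  refine ⟨C, D₁ + 2 * (C * 256), by positivity, ?_, fun x k hx hD hk hkR => ?_⟩
  · have : 0 < C := by positivity
    linarith
  have hC0 : 0 < C := by positivity
  have hDD : D₁ ≤ log (log x) := by linarith
  have hD1 : 1 ≤ log (log x) := by linarith
  have hL := one_le_log_of_one_le_log_log hx hD1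
  have hbound : ∀ l < k, ∀ m, 1 ≤ m → m ≤ √x →
      |m * levelCount P (k - l) (x / m) * (log x / x) - levelWeight P x (k - l)| ≤
        C * m ^ (1 / 8 : ℝ) * levelWeight P x (k - l) / log (log x) := by
    intro l hl m hm hmx
    obtain ⟨j, hj⟩ : ∃ j, k - l = j + 1 := ⟨k - l - 1, by omega⟩
    have hjR : (j : ℝ) ≤ R * log (log x) := by
      have : (j : ℝ) ≤ k := by exact_mod_cast (show j ≤ k by omega)
      linarith
    rw [hj]
    obtain ⟨r1, r2, -⟩ := hB x hx hDD j hjR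
    have hs := one_add_log_sq_le_rpow hm
    refine (hA x m j hx hD1 hm hmx hjR).trans ?_
    calc _ ≤ C₁ * (256 * m ^ (1 / 8 : ℝ)) *
          ((2 * R + 1) * levelWeight P x (j + 1) + levelWeight P x (j + 1)) / log (log x) := by
          have := levelWeight_nonneg P x j
          gcongr
      _ = (C₁ * 256 * (2 * R + 2)) * m ^ (1 / 8 : ℝ) * levelWeight P x (j + 1) / log (log x) := by
          ring
      _ ≤ _ := by gcongr; linarith
  have hpos : 0 < levelWeight P x k := by
    obtain ⟨j, rfl⟩ : ∃ j, k = j + 1 := ⟨k - 1, by omega⟩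
    refine (hB x hx hDD j ?_).1
    push_cast at hkR
    linarith
  have hik : ∀ i < k, (i : ℝ) ≤ R * log (log x) := fun i hi => by
    have : (i : ℝ) ≤ k := by exact_mod_cast hi.le
    linarith
  have hgeo := fun l hl => abs_sub_pow_mul_le (a := levelWeight P x) hR.le hC₂.le
    (by linarith) hkR (fun i _ => levelWeight_nonneg P x i)
    (fun i hi => (hB x hx hDD i (hik i hi)).2.1)
    (fun i h1 hi => (hB x hx hDD i (hik i hi)).2.2 h1) l hl
  refine ⟨hpos, ?_, fun l hl => (hgeo l hl).1, fun l hl => (hgeo l hl).2.trans ?_, hbound⟩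
  · have h1 := hbound 0 hk 1 le_rfl (one_le_sqrt.2 (by linarith))
    simp only [tsub_zero, one_mul, div_one, one_rpow, mul_one] at h1
    have h2 : C * levelWeight P x k / log (log x) ≤ levelWeight P x k / 2 := by
      rw [div_le_iff₀ (by linarith)]
      nlinarith
    have := (abs_le.1 (h1.trans h2)).1
    linarith
  · have : C₂ + 1 ≤ C := by
      have : 0 ≤ C₁ * 256 * (2 * R + 2) := by positivity
      linarith
    have hd : 0 < log (log x) := by linarith
    gcongr

theorem exists_abs_mul_shiftedCount_sub_le (R : ℝ) (hR : 0 < R) {P : Finset ℕ}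
    (hP : ∀ p ∈ P, p.Prime) : ∃ C D₀ : ℝ, 0 < C ∧ 1 ≤ D₀ ∧ ∀ (x : ℝ) (k : ℕ), 2 ≤ x →
    D₀ ≤ log (log x) → 1 ≤ k → (k : ℝ) ≤ R * log (log x) →
    0 < levelCount P k x ∧ ∀ (m : ℝ) (l : ℕ), 1 ≤ m →
      |m * shiftedCount P k l (x / m) - ((k - 1) / log (log x)) ^ l * levelCount P k x| ≤
        C * (4 * (R + 1)) ^ l * m ^ (1 / 8 : ℝ) / log (log x) * levelCount P k x := by
  obtain ⟨C, D₀, hC, hD₀, hA⟩ := exists_levelWeight_le_levelCount R hR hP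
  have hlogK : 0 ≤ log (2 * R + 1) := log_nonneg (by linarith)
  obtain ⟨C₅, hC₅, hS⟩ := exists_log_rpow_mul_le (R * log (2 * R + 1) + 1) (by positivity)
  refine ⟨6 * C + 3 * C₅ + 1, D₀, by positivity, hD₀, fun x k hx hD hk hkR => ?_⟩
  obtain ⟨hα, hV, hgeo, hgeo', hN⟩ := hA x k hx hD hk hkR
  have hD1 : 1 ≤ log (log x) := by linarith
  have hL := one_le_log_of_one_le_log_log hx hD1
  have hSx := hS x hx hD1
  have hx0 : 0 < x := by linarith
  set L := log x with hLdef
  set D := log L with hDdef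
  set V := levelCount P k x with hVdef
  set α := levelWeight P x k
  have hL0 : 0 < L := by linarith
  have hD0 : 0 < D := by linarith
  have hLx : 0 < L / x := by positivity
  have hV0 : 0 < V := by
    by_contra h
    push Not at h
    nlinarith
  refine ⟨hV0, fun m l hm => ?_⟩
  have hm0 : 0 < m := by linarith
  have hm8 : 1 ≤ m ^ (1 / 8 : ℝ) := one_le_rpow hm (by norm_num)
  have hr0 : 0 ≤ ((k : ℝ) - 1) / D := by
    have : (1 : ℝ) ≤ k := by exact_mod_cast hk
    exact div_nonneg (by linarith) hD0.le
  have hrR : ((k : ℝ) - 1) / D ≤ R := by rw [div_le_iff₀ hD0]; linarith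
  set r := ((k : ℝ) - 1) / D with hr
  have hrl : r ^ l ≤ (4 * (R + 1)) ^ l := by gcongr; linarith
  have hs0 : 0 < √x := sqrt_pos.2 hx0
  by_cases hcase : l < k ∧ m ≤ √x
  · obtain ⟨hl, hmx⟩ := hcase
    have e1 : shiftedCount P k l (x / m) = levelCount P (k - l) (x / m) := by
      rw [shiftedCount, if_pos hl.le]
    rw [e1]
    have h1 := hN l hl m hm hmx
    have h2 := hgeo' l hl
    have h3 := hN 0 hk 1 le_rfl (one_le_sqrt.2 (by linarith))
    simp only [tsub_zero, one_mul, div_one, one_rpow, mul_one] at h3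
    have h4 : levelWeight P x (k - l) ≤ (4 * (R + 1)) ^ l * α :=
      (hgeo l hl).trans (by gcongr; linarith)
    have h5 : C * m ^ (1 / 8 : ℝ) * levelWeight P x (k - l) / D ≤
        C * (4 * (R + 1)) ^ l * m ^ (1 / 8 : ℝ) / D * α := by
      calc _ ≤ C * m ^ (1 / 8 : ℝ) * ((4 * (R + 1)) ^ l * α) / D := by gcongr
        _ = _ := by ring
    have h6 : C * (4 * (R + 1)) ^ l / D * α ≤ C * (4 * (R + 1)) ^ l * m ^ (1 / 8 : ℝ) / D * α := by
      gcongr ?_ / D * α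
      exact le_mul_of_one_le_right (by positivity) hm8
    have h7 : r ^ l * (C * α / D) ≤ C * (4 * (R + 1)) ^ l * m ^ (1 / 8 : ℝ) / D * α := by
      calc _ ≤ (4 * (R + 1)) ^ l * (C * α / D) := by gcongr
        _ = C * (4 * (R + 1)) ^ l / D * α := by ring
        _ ≤ _ := h6
    have h8 : |r ^ l * (V * (L / x) - α)| ≤ r ^ l * (C * α / D) := by
      rw [abs_mul, abs_of_nonneg (pow_nonneg hr0 l)]
      gcongr
    have e2 : (m * levelCount P (k - l) (x / m) - r ^ l * V) * (L / x) =
        (m * levelCount P (k - l) (x / m) * (L / x) - levelWeight P x (k - l)) +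
        (levelWeight P x (k - l) - r ^ l * α) - r ^ l * (V * (L / x) - α) := by ring
    have h9 : |m * levelCount P (k - l) (x / m) - r ^ l * V| * (L / x) ≤
        3 * (C * (4 * (R + 1)) ^ l * m ^ (1 / 8 : ℝ) / D) * α := by
      have e4 : |m * levelCount P (k - l) (x / m) - r ^ l * V| * (L / x) =
          |(m * levelCount P (k - l) (x / m) - r ^ l * V) * (L / x)| := by
        rw [abs_mul, abs_of_pos hLx]
      rw [e4, e2]
      refine (abs_sub _ _).trans ?_
      have := abs_add_le (m * levelCount P (k - l) (x / m) * (L / x) - levelWeight P x (k - l))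
        (levelWeight P x (k - l) - r ^ l * α)
      linarith
    refine le_of_mul_le_mul_right (h9.trans ?_) hLx
    calc _ ≤ 3 * (C * (4 * (R + 1)) ^ l * m ^ (1 / 8 : ℝ) / D) * (2 * (V * (L / x))) := by gcongr
      _ = (6 * C) * (4 * (R + 1)) ^ l * m ^ (1 / 8 : ℝ) / D * V * (L / x) := by ring
      _ ≤ _ := by gcongr; linarith
  · -- the trivial range
    have hlow : x ^ (15 / 16 : ℝ) * D ≤ 2 * C₅ * V := by
      have h1 : (1 : ℝ) ≤ L ^ (R * log (2 * R + 1)) * α := by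
        have h2 := hgeo (k - 1) (by omega)
        have h3 : levelWeight P x (k - (k - 1)) = 1 := by
          rw [show k - (k - 1) = 0 + 1 by omega]
          exact levelSum_zero P (by linarith)
        rw [h3] at h2
        refine h2.trans ?_
        gcongr
        rw [← rpow_natCast]
        calc (2 * R + 1) ^ ((k - 1 : ℕ) : ℝ) ≤ (2 * R + 1) ^ (R * D) := by
              refine rpow_le_rpow_of_exponent_le (by linarith) ?_
              have : ((k - 1 : ℕ) : ℝ) ≤ k := by exact_mod_cast Nat.sub_le k 1
              linarith
          _ = L ^ (R * log (2 * R + 1)) := by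
              rw [rpow_def_of_pos (by linarith), rpow_def_of_pos hL0, ← hDdef]
              ring_nf
      have h2 : (1 : ℝ) ≤ L ^ (R * log (2 * R + 1)) * (2 * (V * (L / x))) :=
        h1.trans (by gcongr)
      have e1 : x ^ (15 / 16 : ℝ) * x ^ (1 / 16 : ℝ) = x := by
        rw [← rpow_add hx0]; norm_num
      rw [rpow_add_one hL0.ne'] at hSx
      calc x ^ (15 / 16 : ℝ) * D = x ^ (15 / 16 : ℝ) * D * 1 := by ring
        _ ≤ x ^ (15 / 16 : ℝ) * D * (L ^ (R * log (2 * R + 1)) * (2 * (V * (L / x)))) := by gcongr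
        _ = 2 * V * (x ^ (15 / 16 : ℝ) * (L ^ (R * log (2 * R + 1)) * L * D)) / x := by ring
        _ ≤ 2 * V * (x ^ (15 / 16 : ℝ) * (C₅ * x ^ (1 / 16 : ℝ))) / x := by gcongr
        _ = 2 * V * C₅ * (x ^ (15 / 16 : ℝ) * x ^ (1 / 16 : ℝ)) / x := by ring
        _ = _ := by rw [e1]; field_simp
    have hlow' : x ^ (15 / 16 : ℝ) ≤ 2 * C₅ * V / D := by rwa [le_div_iff₀ hD0]
    have hx8 : x ^ (1 / 16 : ℝ) = √x ^ (1 / 8 : ℝ) := by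
      rw [sqrt_eq_rpow, ← rpow_mul hx0.le]; norm_num
    have c1 : m * shiftedCount P k l (x / m) ≤ x ^ (15 / 16 : ℝ) * m ^ (1 / 8 : ℝ) := by
      by_cases hmx : m ≤ √x
      · have hl : k ≤ l := by by_contra h; exact hcase ⟨by omega, hmx⟩
        have h1 : shiftedCount P k l (x / m) ≤ 1 := by
          unfold shiftedCount
          split_ifs with h
          · rw [show k - l = 0 by omega, levelCount_zero]
            rw [le_div_iff₀ hm0, one_mul]
            refine hmx.trans (sqrt_le_left hx0.le |>.2 (by nlinarith))
          · norm_num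
        calc m * shiftedCount P k l (x / m) ≤ √x * 1 :=
            mul_le_mul hmx h1 (shiftedCount_nonneg ..) hs0.le
          _ = x ^ (1 / 2 : ℝ) * 1 := by rw [sqrt_eq_rpow]
          _ ≤ x ^ (15 / 16 : ℝ) * m ^ (1 / 8 : ℝ) := by
            exact mul_le_mul (rpow_le_rpow_of_exponent_le (by linarith) (by norm_num)) hm8
              zero_le_one (by positivity)
      · push Not at hmx
        calc m * shiftedCount P k l (x / m) ≤ m * (x / m) := by
              gcongr; exact shiftedCount_le P k l (by positivity)
          _ = x := by field_simp
          _ = x ^ (15 / 16 : ℝ) * x ^ (1 / 16 : ℝ) := by rw [← rpow_add hx0]; norm_num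
          _ ≤ x ^ (15 / 16 : ℝ) * m ^ (1 / 8 : ℝ) := by rw [hx8]; gcongr
    have hK1 : (1 : ℝ) ≤ (4 * (R + 1)) ^ l := one_le_pow₀ (by linarith)
    have c2 : m * shiftedCount P k l (x / m) ≤
        2 * C₅ * (4 * (R + 1)) ^ l * m ^ (1 / 8 : ℝ) / D * V := by
      calc _ ≤ 2 * C₅ * V / D * m ^ (1 / 8 : ℝ) := c1.trans (by gcongr)
        _ = 2 * C₅ * 1 * m ^ (1 / 8 : ℝ) / D * V := by ring
        _ ≤ _ := by gcongr
    have c3 : r ^ l ≤ (C₅ + 1) * (4 * (R + 1)) ^ l * m ^ (1 / 8 : ℝ) / D := by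
      by_cases hmx : m ≤ √x
      · have hl : k ≤ l := by by_contra h; exact hcase ⟨by omega, hmx⟩
        obtain ⟨i, rfl⟩ : ∃ i, l = i + 1 := ⟨l - 1, by omega⟩
        have h1 : (k : ℝ) - 1 ≤ 2 ^ i := by
          have b1 : (i : ℝ) ≤ 2 ^ i := by exact_mod_cast Nat.lt_two_pow_self.le
          have b2 : (k : ℝ) ≤ i + 1 := by exact_mod_cast hl
          linarith
        calc r ^ (i + 1) = r ^ i * ((k - 1) / D) := by rw [pow_succ]
          _ ≤ R ^ i * (2 ^ i / D) := by gcongr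
          _ = 1 * (R * 2) ^ i * 1 / D := by rw [mul_pow]; ring
          _ ≤ (C₅ + 1) * ((4 * (R + 1)) ^ i * (4 * (R + 1))) * m ^ (1 / 8 : ℝ) / D := by
              gcongr ?_ * ?_ * ?_ / D
              · linarith
              · calc (R * 2) ^ i ≤ (4 * (R + 1)) ^ i :=
                    pow_le_pow_left₀ (by positivity) (by linarith) i
                  _ ≤ _ := le_mul_of_one_le_right (by positivity) (by linarith)
          _ = _ := by rw [← pow_succ]
      · push Not at hmx
        have h1 : D ≤ C₅ * m ^ (1 / 8 : ℝ) := by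
          have h2 : 1 ≤ L ^ (R * log (2 * R + 1) + 1) := one_le_rpow (by linarith) (by positivity)
          calc D ≤ L ^ (R * log (2 * R + 1) + 1) * D := le_mul_of_one_le_left hD0.le h2
            _ ≤ C₅ * √x ^ (1 / 8 : ℝ) := by rw [← hx8]; exact hSx
            _ ≤ _ := by gcongr
        rw [le_div_iff₀ hD0]
        calc r ^ l * D ≤ (4 * (R + 1)) ^ l * (C₅ * m ^ (1 / 8 : ℝ)) := by gcongr
          _ = C₅ * (4 * (R + 1)) ^ l * m ^ (1 / 8 : ℝ) := by ring
          _ ≤ _ := by gcongr; linarith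
    have c4 : 0 ≤ m * shiftedCount P k l (x / m) :=
      mul_nonneg hm0.le (shiftedCount_nonneg ..)
    have c5 : 0 ≤ r ^ l * V := by positivity
    have c6 : r ^ l * V ≤ (C₅ + 1) * (4 * (R + 1)) ^ l * m ^ (1 / 8 : ℝ) / D * V := by gcongr
    have c7 : 0 ≤ 6 * C * (4 * (R + 1)) ^ l * m ^ (1 / 8 : ℝ) / D * V := by positivity
    have e3 : (6 * C + 3 * C₅ + 1) * (4 * (R + 1)) ^ l * m ^ (1 / 8 : ℝ) / D * V =
      6 * C * (4 * (R + 1)) ^ l * m ^ (1 / 8 : ℝ) / D * V +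
      2 * C₅ * (4 * (R + 1)) ^ l * m ^ (1 / 8 : ℝ) / D * V +
      (C₅ + 1) * (4 * (R + 1)) ^ l * m ^ (1 / 8 : ℝ) / D * V := by ring
    rw [e3, abs_le]
    constructor <;> linarith

lemma card_levelSet_filter_factorization {P : Finset ℕ} {p : ℕ} (hp : p.Prime) (hpP : p ∉ P)
    (j a : ℕ) {y : ℝ} (hy : 0 ≤ y) :
    #{n ∈ (levelSet P (j + 1) y).filter (p ∣ ·) | n.factorization p - 1 = a} =
      #(levelSet (insert p P) j (y / p ^ (a + 1))) := by
  have hp0 : (0 : ℝ) < (p : ℝ) ^ (a + 1) := by have := hp.pos; positivity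
  have hypa : 0 ≤ y / (p : ℝ) ^ (a + 1) := by positivity
  have hpf : ∀ m, (p ^ (a + 1) * m).primeFactors = insert p m.primeFactors ∨ m = 0 := fun m => by
    by_cases hm : m = 0
    · exact Or.inr hm
    · left
      rw [Nat.primeFactors_mul (pow_ne_zero _ hp.ne_zero) hm,
        Nat.primeFactors_prime_pow (by omega) hp, insert_eq]
  symm
  refine card_bij (fun m _ => p ^ (a + 1) * m) ?_ ?_ ?_
  · intro m hm
    obtain ⟨h0, h1, h2, h3⟩ := (mem_levelSet hypa).1 hm
    rw [disjoint_insert_right] at h2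
    have hpm : ¬ p ∣ m := fun h => h2.1 (Nat.mem_primeFactors.2 ⟨hp, h, h0⟩)
    have hpf' := (hpf m).resolve_right h0
    rw [mem_filter, mem_filter, mem_levelSet hy]
    refine ⟨⟨⟨mul_ne_zero (pow_ne_zero _ hp.ne_zero) h0, ?_, ?_, ?_⟩, ?_⟩, ?_⟩
    · rw [le_div_iff₀ hp0] at h1
      push_cast
      linarith
    · rw [hpf', disjoint_insert_left]
      exact ⟨hpP, h2.2⟩
    · rw [hpf', card_insert_of_notMem h2.1, h3]
    · exact (dvd_pow_self p (by omega)).mul_right m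
    · rw [Nat.factorization_mul (pow_ne_zero _ hp.ne_zero) h0, hp.factorization_pow]
      simp [Nat.factorization_eq_zero_of_not_dvd hpm]
  · intro m _ m' _ h
    exact Nat.eq_of_mul_eq_mul_left (pow_pos hp.pos _) h
  · intro n hn
    rw [mem_filter, mem_filter, mem_levelSet hy] at hn
    obtain ⟨⟨⟨h0, h1, h2, h3⟩, h4⟩, h5⟩ := hn
    have h6 : n.factorization p = a + 1 := by
      have := hp.factorization_pos_of_dvd h0 h4
      omega
    have h7 := Nat.ordProj_mul_ordCompl_eq_self n p
    have h8 := Nat.not_dvd_ordCompl hp h0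
    rw [h6] at h7 h8
    set m := n / p ^ (a + 1)
    have hm0 : m ≠ 0 := by
      rintro h
      rw [h] at h8
      exact h8 (dvd_zero p)
    have hpf' := (hpf m).resolve_right hm0
    have hpm : p ∉ m.primeFactors := fun h => h8 (Nat.dvd_of_mem_primeFactors h)
    refine ⟨m, ?_, h7⟩
    rw [← h7] at h1 h2 h3
    rw [hpf'] at h2 h3
    rw [mem_levelSet hypa, le_div_iff₀ hp0, disjoint_insert_right]
    rw [disjoint_insert_left] at h2
    rw [card_insert_of_notMem hpm] at h3
    push_cast at h1
    exact ⟨hm0, by linarith, ⟨hpm, h2.2⟩, by omega⟩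

lemma levelCount_succ_eq_add_sum {P : Finset ℕ} {p : ℕ} (hp : p.Prime) (hpP : p ∉ P)
    (j A : ℕ) {y : ℝ} (hy : 0 ≤ y) (hA : y < (p : ℝ) ^ (A + 1)) :
    levelCount P (j + 1) y = levelCount (insert p P) (j + 1) y +
      ∑ a ∈ range A, levelCount (insert p P) j (y / p ^ (a + 1)) := by
  have h1 : (levelSet P (j + 1) y).filter (fun n => ¬ p ∣ n) = levelSet (insert p P) (j + 1) y := by
    ext n
    rw [mem_filter, mem_levelSet hy, mem_levelSet hy, disjoint_insert_right, Nat.mem_primeFactors]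
    have := hp
    tauto
  have h2 : #((levelSet P (j + 1) y).filter (p ∣ ·)) =
      ∑ a ∈ range A, #(levelSet (insert p P) j (y / p ^ (a + 1))) := by
    rw [card_eq_sum_card_fiberwise (f := fun n => n.factorization p - 1) (t := range A)]
    · exact sum_congr rfl fun a _ => card_levelSet_filter_factorization hp hpP j a hy
    · intro n hn
      have hn' := mem_filter.1 (mem_coe.1 hn)
      obtain ⟨h0, h1, -⟩ := (mem_levelSet hy).1 hn'.1
      have h3 := hp.factorization_pos_of_dvd h0 hn'.2
      have h4 : p ^ n.factorization p ≤ n := Nat.ordProj_le p h0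
      have h5 : (p : ℝ) ^ n.factorization p < (p : ℝ) ^ (A + 1) := by
        refine lt_of_le_of_lt ?_ hA
        exact le_trans (by exact_mod_cast h4) h1
      have h6 := (pow_lt_pow_iff_right₀ (by exact_mod_cast hp.one_lt)).1 h5
      simp only [coe_range, Set.mem_Iio]
      omega
  rw [levelCount, ← card_filter_add_card_filter_not (s := levelSet P (j + 1) y) (p ∣ ·), h1, h2]
  push_cast
  rw [add_comm]
  rfl

lemma levelCount_eq_zero_of_lt_one (P : Finset ℕ) (j : ℕ) {y : ℝ} (hy : 0 ≤ y) (hy1 : y < 1) :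
    levelCount P j y = 0 := by
  rw [levelCount, Nat.cast_eq_zero, card_eq_zero]
  refine eq_empty_of_forall_notMem fun n hn => ?_
  obtain ⟨h0, h1, -⟩ := (mem_levelSet hy).1 hn
  have : (1 : ℝ) ≤ n := by exact_mod_cast Nat.one_le_iff_ne_zero.2 h0
  linarith

lemma levelCount_zero_eq (P Q : Finset ℕ) {y : ℝ} (hy : 0 ≤ y) :
    levelCount P 0 y = levelCount Q 0 y := by
  rcases lt_or_ge y 1 with h | h
  · rw [levelCount_eq_zero_of_lt_one P 0 hy h, levelCount_eq_zero_of_lt_one Q 0 hy h]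
  · rw [levelCount_zero P h, levelCount_zero Q h]

lemma hasSum_shiftedCount {P : Finset ℕ} {p : ℕ} (hp : p.Prime) (hpP : p ∉ P)
    (k l : ℕ) {y : ℝ} (hy : 0 ≤ y) :
    HasSum (fun a : ℕ => shiftedCount (insert p P) k (l + 1) (y / p ^ (a + 1)))
      (shiftedCount P k l y - shiftedCount (insert p P) k l y) := by
  rcases lt_trichotomy l k with h | h | h
  · obtain ⟨j, hj⟩ : ∃ j, k = l + (j + 1) := ⟨k - l - 1, by omega⟩
    subst hj
    simp only [shiftedCount, show l + 1 ≤ l + (j + 1) by omega, show l ≤ l + (j + 1) by omega,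
      if_true, show l + (j + 1) - (l + 1) = j by omega, show l + (j + 1) - l = j + 1 by omega]
    obtain ⟨A, hA⟩ := pow_unbounded_of_one_lt y (show (1 : ℝ) < p by exact_mod_cast hp.one_lt)
    have hp1 : (1 : ℝ) ≤ p := by exact_mod_cast hp.one_le
    have hA' : y < (p : ℝ) ^ (A + 1) := hA.trans_le (pow_le_pow_right₀ hp1 (by omega))
    rw [levelCount_succ_eq_add_sum hp hpP j A hy hA', add_sub_cancel_left]
    refine hasSum_sum_of_ne_finset_zero fun a ha => ?_
    have ha' : A ≤ a := by simpa using ha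
    refine levelCount_eq_zero_of_lt_one _ _ (by positivity) ?_
    rw [div_lt_one (by positivity)]
    exact hA.trans_le (pow_le_pow_right₀ hp1 (by omega))
  · subst h
    simp [shiftedCount, levelCount_zero_eq P (insert p P) hy]
  · have h1 : ¬ l ≤ k := by omega
    have h2 : ¬ l + 1 ≤ k := by omega
    simp [shiftedCount, h1, h2]

/-- `∏ p ∈ P, (1 + r / (p - 1))`. -/
noncomputable def localFactor (r : ℝ) (P : Finset ℕ) : ℝ := ∏ p ∈ P, (1 + r / ((p : ℝ) - 1))

lemma one_le_one_add_div {r : ℝ} (hr : 0 ≤ r) {p : ℕ} (hp : p.Prime) :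
    1 ≤ 1 + r / ((p : ℝ) - 1) := by
  have : (1 : ℝ) < p := by exact_mod_cast hp.one_lt
  have : 0 ≤ r / ((p : ℝ) - 1) := div_nonneg hr (by linarith)
  linarith

lemma one_le_localFactor {r : ℝ} (hr : 0 ≤ r) {P : Finset ℕ} (hP : ∀ p ∈ P, p.Prime) :
    1 ≤ localFactor r P :=
  prod_induction _ (1 ≤ ·) (fun _ _ => one_le_mul_of_one_le_of_one_le) le_rfl
    fun p hp => one_le_one_add_div hr (hP p hp)

/-- The difference between the scaled count of integers `n ≤ x / m` coprime to `P` with `k - l` prime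
factors and its main term `c r ^ l / localFactor r P`. -/
noncomputable def levelDeviation (k : ℕ) (r c x : ℝ) (P : Finset ℕ) (l m : ℕ) : ℝ :=
  m * shiftedCount P k l (x / m) - c / localFactor r P * r ^ l

/-- The deviations for `P` are bounded by `M K ^ l m ^ (1 / 8)`. -/
def DeviationBound (k : ℕ) (r c x K : ℝ) (P : Finset ℕ) (M : ℝ) : Prop :=
  ∀ l m : ℕ, 1 ≤ m → |levelDeviation k r c x P l m| ≤ M * (K ^ l * (m : ℝ) ^ (1 / 8 : ℝ))

lemma hasSum_levelDeviation {P : Finset ℕ} {p : ℕ} (hp : p.Prime) (hpP : p ∉ P) (k : ℕ) {r : ℝ}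
    (c : ℝ) {x : ℝ} (hr : 0 ≤ r) (hx : 0 ≤ x) (l : ℕ) {m : ℕ} (hm : 1 ≤ m) :
    HasSum (fun a : ℕ => 1 / (p : ℝ) ^ (a + 1) *
        levelDeviation k r c x (insert p P) (l + 1) (m * p ^ (a + 1)))
      (levelDeviation k r c x P l m - levelDeviation k r c x (insert p P) l m) := by
  have hp1 : (1 : ℝ) < p := by exact_mod_cast hp.one_lt
  have hp0 : (0 : ℝ) < p := by linarith
  have hm0 : (0 : ℝ) < m := by exact_mod_cast hm
  have h1 := (hasSum_shiftedCount hp hpP k l (y := x / m) (by positivity)).mul_left (m : ℝ)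
  have h2 : HasSum (fun a : ℕ => 1 / (p : ℝ) ^ (a + 1)) (1 / ((p : ℝ) - 1)) := by
    have h3 := (hasSum_geometric_of_lt_one (r := 1 / (p : ℝ)) (by positivity)
      (by rw [div_lt_one hp0]; exact hp1)).mul_left (1 / (p : ℝ))
    have h4 : (p : ℝ) - 1 ≠ 0 := by linarith
    have h5 : 1 / (p : ℝ) * (1 - 1 / (p : ℝ))⁻¹ = 1 / ((p : ℝ) - 1) := by
      rw [one_sub_div hp0.ne', inv_div]; field_simp
    rw [h5] at h3
    have h6 : (fun a : ℕ => 1 / (p : ℝ) ^ (a + 1)) = fun a => 1 / (p : ℝ) * (1 / (p : ℝ)) ^ a :=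
      funext fun a => by rw [← pow_succ', div_pow, one_pow]
    rwa [h6]
  have h5 := h2.mul_right (c / localFactor r (insert p P) * r ^ (l + 1))
  have h6 := h1.sub h5
  have h7 := one_le_one_add_div hr hp
  have hb : localFactor r (insert p P) = (1 + r / ((p : ℝ) - 1)) * localFactor r P := by
    rw [localFactor, prod_insert hpP]; rfl
  have hc : c / localFactor r P = c / localFactor r (insert p P) * (1 + r / ((p : ℝ) - 1)) := by
    rw [hb, mul_comm (1 + r / ((p : ℝ) - 1)), ← div_div, div_mul_cancel₀ _ (by linarith)]
  have h8 : m * (shiftedCount P k l (x / m) - shiftedCount (insert p P) k l (x / m)) -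
      1 / ((p : ℝ) - 1) * (c / localFactor r (insert p P) * r ^ (l + 1)) =
      levelDeviation k r c x P l m - levelDeviation k r c x (insert p P) l m := by
    rw [levelDeviation, levelDeviation, hc]
    ring
  rw [h8] at h6
  have h9 : (fun a : ℕ => 1 / (p : ℝ) ^ (a + 1) *
        levelDeviation k r c x (insert p P) (l + 1) (m * p ^ (a + 1))) = fun a : ℕ =>
      m * shiftedCount (insert p P) k (l + 1) (x / m / p ^ (a + 1)) -
        1 / (p : ℝ) ^ (a + 1) * (c / localFactor r (insert p P) * r ^ (l + 1)) := by
    funext a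
    have : x / ((m * p ^ (a + 1) : ℕ) : ℝ) = x / m / p ^ (a + 1) := by push_cast; rw [div_div]
    rw [levelDeviation, this]
    push_cast
    field_simp
  rwa [h9]

lemma abs_levelDeviation_sub_le {P : Finset ℕ} {p : ℕ} (hp : p.Prime) (hpP : p ∉ P) {k : ℕ}
    {r c x K M : ℝ} (hr : 0 ≤ r) (hx : 0 ≤ x)
    (h : DeviationBound k r c x K (insert p P) M) (l : ℕ) {m : ℕ} (hm : 1 ≤ m) :
    |levelDeviation k r c x P l m - levelDeviation k r c x (insert p P) l m| ≤
      K / ((p : ℝ) ^ (7 / 8 : ℝ) - 1) * M * (K ^ l * (m : ℝ) ^ (1 / 8 : ℝ)) := by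
  have hp1 : (1 : ℝ) < p := by exact_mod_cast hp.one_lt
  have hp0 : (0 : ℝ) < p := by linarith
  have hm0 : (0 : ℝ) < m := by exact_mod_cast hm
  have hs := hasSum_levelDeviation hp hpP k c hr hx l hm
  set t := (p : ℝ) ^ (7 / 8 : ℝ) with ht
  have ht1 : 1 < t := one_lt_rpow hp1 (by norm_num)
  have ht0 : 0 < t := by linarith
  have hpt : 1 / (p : ℝ) * (p : ℝ) ^ (1 / 8 : ℝ) = 1 / t := by
    have : (p : ℝ) = t * (p : ℝ) ^ (1 / 8 : ℝ) := by
      rw [ht, ← rpow_add hp0]; norm_num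
    have h8 : 0 < (p : ℝ) ^ (1 / 8 : ℝ) := by positivity
    rw [this, mul_rpow ht0.le h8.le]
    have : t ^ (1 / 8 : ℝ) * ((p : ℝ) ^ (1 / 8 : ℝ)) ^ (1 / 8 : ℝ) = (p : ℝ) ^ (1 / 8 : ℝ) := by
      rw [← mul_rpow ht0.le h8.le, ← this]
    rw [this]
    field_simp
  have hg : HasSum (fun a : ℕ => M * (K ^ (l + 1) * (m : ℝ) ^ (1 / 8 : ℝ)) * (1 / t) * (1 / t) ^ a)
      (M * (K ^ (l + 1) * (m : ℝ) ^ (1 / 8 : ℝ)) * (1 / t) * (1 - 1 / t)⁻¹) :=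
    (hasSum_geometric_of_lt_one (by positivity) (by rw [div_lt_one ht0]; exact ht1)).mul_left _
  have hb := tsum_of_norm_bounded hg (f := fun a : ℕ => 1 / (p : ℝ) ^ (a + 1) *
        levelDeviation k r c x (insert p P) (l + 1) (m * p ^ (a + 1))) ?_
  · rw [hs.tsum_eq, norm_eq_abs] at hb
    refine hb.trans (le_of_eq ?_)
    have h4 : t - 1 ≠ 0 := by linarith
    rw [one_sub_div ht0.ne', inv_div]
    field_simp
    ring
  · intro a
    rw [norm_eq_abs, abs_mul, abs_of_pos (by positivity)]
    have h1 := h (l + 1) (m * p ^ (a + 1)) (Nat.mul_pos hm (pow_pos hp.pos _))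
    calc _ ≤ 1 / (p : ℝ) ^ (a + 1) *
          (M * (K ^ (l + 1) * ((m * p ^ (a + 1) : ℕ) : ℝ) ^ (1 / 8 : ℝ))) := by gcongr
      _ = M * (K ^ (l + 1) * (m : ℝ) ^ (1 / 8 : ℝ)) *
          (1 / (p : ℝ) * (p : ℝ) ^ (1 / 8 : ℝ)) ^ (a + 1) := by
        push_cast
        rw [mul_rpow hm0.le (by positivity), ← rpow_natCast_mul hp0.le, mul_comm ((a + 1 : ℕ) : ℝ),
          rpow_mul_natCast hp0.le]
        ring
      _ = _ := by rw [hpt]; ring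

lemma DeviationBound.of_insert {P : Finset ℕ} {p : ℕ} (hp : p.Prime) (hpP : p ∉ P) {k : ℕ}
    {r c x K M : ℝ} (hr : 0 ≤ r) (hx : 0 ≤ x) (h : DeviationBound k r c x K (insert p P) M) :
    DeviationBound k r c x K P ((1 + K / ((p : ℝ) ^ (7 / 8 : ℝ) - 1)) * M) := by
  intro l m hm
  have h1 := abs_levelDeviation_sub_le hp hpP hr hx h l hm
  have h2 := h l m hm
  have h3 := abs_sub_abs_le_abs_sub (levelDeviation k r c x P l m)
    (levelDeviation k r c x (insert p P) l m)
  linarith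

lemma deviationBound_trivial (k : ℕ) {r c x K : ℝ} {P : Finset ℕ} (hP : ∀ p ∈ P, p.Prime)
    (hr : 0 ≤ r) (hrK : r ≤ K) (hK : 1 ≤ K) (hc : 0 ≤ c) (hx : 0 ≤ x) :
    DeviationBound k r c x K P (x + c) := by
  intro l m hm
  have hm0 : (0 : ℝ) < m := by exact_mod_cast hm
  have hm1 : (1 : ℝ) ≤ m := by exact_mod_cast hm
  have h1 : m * shiftedCount P k l (x / m) ≤ x := by
    calc m * shiftedCount P k l (x / m) ≤ m * (x / m) := by
          gcongr; exact shiftedCount_le P k l (by positivity)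
      _ = x := by field_simp
  have h2 : 0 ≤ m * shiftedCount P k l (x / m) := mul_nonneg hm0.le (shiftedCount_nonneg ..)
  have hb := one_le_localFactor hr hP
  have h3 : c / localFactor r P * r ^ l ≤ c * K ^ l := by
    gcongr
    exact div_le_self hc hb
  have h4 : 0 ≤ c / localFactor r P * r ^ l := by positivity
  have hKl : 1 ≤ K ^ l := one_le_pow₀ hK
  have hm8 : 1 ≤ (m : ℝ) ^ (1 / 8 : ℝ) := one_le_rpow hm1 (by norm_num)
  have h5 : x ≤ x * (K ^ l * (m : ℝ) ^ (1 / 8 : ℝ)) :=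
    le_mul_of_one_le_right hx (one_le_mul_of_one_le_of_one_le hKl hm8)
  have h6 : c * K ^ l ≤ c * (K ^ l * (m : ℝ) ^ (1 / 8 : ℝ)) := by
    gcongr
    exact le_mul_of_one_le_right (by positivity) hm8
  rw [levelDeviation, abs_le, add_mul]
  constructor <;> linarith

lemma DeviationBound.insert {P : Finset ℕ} {p : ℕ} (hP : ∀ p ∈ P, p.Prime) (hp : p.Prime)
    (hpP : p ∉ P) {k : ℕ} {r c x K M : ℝ} (hr : 0 ≤ r) (hrK : r ≤ K) (hK : 1 ≤ K) (hc : 0 ≤ c)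
    (hx : 0 ≤ x) (hτ : K / ((p : ℝ) ^ (7 / 8 : ℝ) - 1) < 1) (h : DeviationBound k r c x K P M) :
    DeviationBound k r c x K (insert p P) (M / (1 - K / ((p : ℝ) ^ (7 / 8 : ℝ) - 1))) := by
  set τ := K / ((p : ℝ) ^ (7 / 8 : ℝ) - 1) with hτd
  have hpos : ∀ (l : ℕ) {m : ℕ}, 1 ≤ m → 0 < K ^ l * (m : ℝ) ^ (1 / 8 : ℝ) := fun l m hm => by
    have hm0 : (0 : ℝ) < m := by exact_mod_cast hm
    positivity
  have ht : DeviationBound k r c x K (Insert.insert p P) (x + c) := by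
    refine deviationBound_trivial k (fun q hq => ?_) hr hrK hK hc hx
    rcases mem_insert.1 hq with rfl | hq
    exacts [hp, hP q hq]
  set S : Set ℝ := {z | ∃ l m : ℕ, 1 ≤ m ∧
    z = |levelDeviation k r c x (Insert.insert p P) l m| / (K ^ l * (m : ℝ) ^ (1 / 8 : ℝ))}
  have hS : BddAbove S := by
    refine ⟨x + c, ?_⟩
    rintro z ⟨l, m, hm, rfl⟩
    rw [div_le_iff₀ (hpos l hm)]
    exact ht l m hm
  have hs : DeviationBound k r c x K (Insert.insert p P) (sSup S) := fun l m hm => by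
    rw [← div_le_iff₀ (hpos l hm)]
    exact le_csSup hS ⟨l, m, hm, rfl⟩
  have hle : sSup S ≤ M + τ * sSup S := by
    refine csSup_le ⟨_, 0, 1, le_rfl, rfl⟩ ?_
    rintro z ⟨l, m, hm, rfl⟩
    rw [div_le_iff₀ (hpos l hm)]
    have h1 := abs_levelDeviation_sub_le hp hpP hr hx hs l hm
    have h2 := h l m hm
    have h3 := abs_sub_abs_le_abs_sub (levelDeviation k r c x (Insert.insert p P) l m)
      (levelDeviation k r c x P l m)
    rw [abs_sub_comm] at h1
    linarith
  have hle' : sSup S ≤ M / (1 - τ) := by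
    rw [le_div_iff₀ (by linarith)]
    linarith
  intro l m hm
  exact (hs l m hm).trans (mul_le_mul_of_nonneg_right hle' (hpos l hm).le)

lemma DeviationBound.of_union {P S : Finset ℕ} (hS : ∀ p ∈ S, p.Prime) (hd : Disjoint S P) {k : ℕ}
    {r c x K M : ℝ} (hr : 0 ≤ r) (hx : 0 ≤ x) (h : DeviationBound k r c x K (S ∪ P) M) :
    DeviationBound k r c x K P ((∏ p ∈ S, (1 + K / ((p : ℝ) ^ (7 / 8 : ℝ) - 1))) * M) := by
  induction S using Finset.induction_on generalizing M with
  | empty => simpa using h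
  | insert q S hq ih =>
    rw [disjoint_insert_left] at hd
    rw [insert_union] at h
    have h1 := h.of_insert (hS q (mem_insert_self q S))
      (by rw [mem_union]; tauto) hr hx
    have h2 := ih (fun p hp => hS p (mem_insert_of_mem hp)) hd.2 h1
    rw [prod_insert hq, mul_comm (1 + _), mul_assoc]
    exact h2

lemma DeviationBound.union {P S : Finset ℕ} (hP : ∀ p ∈ P, p.Prime) (hS : ∀ p ∈ S, p.Prime)
    (hd : Disjoint S P) {k : ℕ} {r c x K M : ℝ} (hr : 0 ≤ r) (hrK : r ≤ K) (hK : 1 ≤ K)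
    (hc : 0 ≤ c) (hx : 0 ≤ x) (hτ : ∀ p ∈ S, K / ((p : ℝ) ^ (7 / 8 : ℝ) - 1) < 1)
    (h : DeviationBound k r c x K P M) :
    DeviationBound k r c x K (S ∪ P)
      (M * ∏ p ∈ S, (1 - K / ((p : ℝ) ^ (7 / 8 : ℝ) - 1))⁻¹) := by
  induction S using Finset.induction_on with
  | empty => simpa using h
  | insert q S hq ih =>
    rw [disjoint_insert_left] at hd
    have hS' : ∀ p ∈ S, p.Prime := fun p hp => hS p (mem_insert_of_mem hp)
    have h1 := ih hS' hd.2 (fun p hp => hτ p (mem_insert_of_mem hp))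
    have hSP : ∀ p ∈ S ∪ P, p.Prime := fun p hp => (mem_union.1 hp).elim (hS' p) (hP p)
    have h2 := h1.insert hSP (hS q (mem_insert_self q S)) (by rw [mem_union]; tauto) hr hrK hK hc hx
      (hτ q (mem_insert_self q S))
    rw [insert_union, prod_insert hq, mul_comm (_⁻¹), ← mul_assoc, ← div_eq_mul_inv]
    exact h2

lemma one_le_one_sub_rpow_rpow {R : ℝ} (hR : 0 < R) {p : ℕ} (hp : p.Prime) :
    1 ≤ (1 - (p : ℝ) ^ (-(3 : ℝ) / 4)) ^ (-R) := by
  have hp1 : (1 : ℝ) < p := by exact_mod_cast hp.one_lt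
  have h1 : (p : ℝ) ^ (-(3 : ℝ) / 4) < 1 := rpow_lt_one_of_one_lt_of_neg hp1 (by norm_num)
  have h2 : 0 < (p : ℝ) ^ (-(3 : ℝ) / 4) := rpow_pos_of_pos (by linarith) _
  exact one_le_rpow_of_pos_of_le_one_of_nonpos (by linarith) (by linarith) (by linarith)

lemma inv_one_sub_le_one_sub_rpow {R K : ℝ} (hR : 0 < R) (hK : 4 ≤ K) {p : ℕ}
    (hp : (4 * K + 4 * K / R) ^ 8 ≤ (p : ℝ)) :
    K / ((p : ℝ) ^ (7 / 8 : ℝ) - 1) < 1 ∧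
    (1 - K / ((p : ℝ) ^ (7 / 8 : ℝ) - 1))⁻¹ ≤ (1 - (p : ℝ) ^ (-(3 : ℝ) / 4)) ^ (-R) := by
  have ha : 0 < 4 * K + 4 * K / R := by positivity
  have hp0 : (0 : ℝ) < p := lt_of_lt_of_le (by positivity) hp
  have hs : 4 * K + 4 * K / R ≤ (p : ℝ) ^ (1 / 8 : ℝ) := by
    calc 4 * K + 4 * K / R = ((4 * K + 4 * K / R) ^ 8) ^ (1 / 8 : ℝ) := by
          rw [← rpow_natCast, ← rpow_mul ha.le]; norm_num
      _ ≤ _ := by gcongr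
  have e7 : (p : ℝ) ^ (7 / 8 : ℝ) = ((p : ℝ) ^ (1 / 8 : ℝ)) ^ 7 := by
    rw [← rpow_natCast, ← rpow_mul hp0.le]; norm_num
  have e6 : (p : ℝ) ^ (-(3 : ℝ) / 4) = 1 / ((p : ℝ) ^ (1 / 8 : ℝ)) ^ 6 := by
    rw [← rpow_natCast, ← rpow_mul hp0.le, one_div, ← rpow_neg hp0.le]; norm_num
  rw [e7, e6]
  set s := (p : ℝ) ^ (1 / 8 : ℝ)
  have hKR : 0 < 4 * K / R := by positivity
  have hs4 : 4 * K ≤ s := by linarith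
  have hs1 : 16 ≤ s := by linarith
  have hsR : 4 * K ≤ s * R := by
    rw [← div_le_iff₀ hR]; linarith
  have hs0 : 0 < s := by linarith
  have h7 : s ≤ s ^ 7 := le_self_pow₀ (by linarith) (by norm_num)
  have h6 : s ≤ s ^ 6 := le_self_pow₀ (by linarith) (by norm_num)
  set u := 1 / s ^ 6 with hu
  have hu0 : 0 < u := by positivity
  have hu1 : u ≤ 1 / 16 := by
    rw [hu]; exact one_div_le_one_div_of_le (by norm_num) (by linarith)
  set τ := K / (s ^ 7 - 1) with hτ
  have hτ0 : 0 ≤ τ := div_nonneg (by linarith) (by linarith)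
  have hτ1 : τ ≤ 2 * K / s * u := by
    calc τ ≤ K / (s ^ 7 / 2) := by rw [hτ]; gcongr; linarith
      _ = _ := by rw [hu]; field_simp
  have hτ2 : τ ≤ R / 2 * u := by
    refine hτ1.trans ?_
    gcongr ?_ * u
    rw [div_le_iff₀ hs0]; linarith
  have hτ3 : τ ≤ 1 / 2 * u := by
    refine hτ1.trans ?_
    gcongr ?_ * u
    rw [div_le_iff₀ hs0]; linarith
  refine ⟨by linarith, ?_⟩
  calc (1 - τ)⁻¹ ≤ 1 + 2 * τ := by
        rw [inv_le_comm₀ (by linarith) (by linarith), inv_le_iff_one_le_mul₀ (by linarith)]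
        nlinarith
    _ ≤ R * u + 1 := by linarith
    _ ≤ exp (R * u) := add_one_le_exp _
    _ ≤ exp (log (1 - u) * -R) := by
        have := log_le_sub_one_of_pos (show 0 < 1 - u by linarith)
        exact exp_le_exp.2 (by nlinarith)
    _ = _ := by rw [rpow_def_of_pos (by linarith)]

lemma prod_sdiff_le_prod {f : ℕ → ℝ} (P Q : Finset ℕ) (hf : ∀ p ∈ P, 1 ≤ f p) :
    ∏ p ∈ P \ Q, f p ≤ ∏ p ∈ P, f p := by
  rw [← prod_inter_mul_prod_sdiff P Q f]
  refine le_mul_of_one_le_left (prod_nonneg fun p hp => ?_) ?_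
  · linarith [hf p (mem_sdiff.1 hp).1]
  · exact prod_induction _ (1 ≤ ·) (fun _ _ => one_le_mul_of_one_le_of_one_le) le_rfl
      fun p hp => hf p (mem_inter.1 hp).1

lemma levelCount_anti {P Q : Finset ℕ} (h : P ⊆ Q) (k : ℕ) (x : ℝ) :
    levelCount Q k x ≤ levelCount P k x := by
  unfold levelCount levelSet
  refine Nat.cast_le.2 (card_le_card fun n hn => ?_)
  rw [mem_filter] at hn ⊢
  exact ⟨hn.1, hn.2.1.mono_right h, hn.2.2⟩

theorem exists_abs_levelCount_sub_le (R : ℝ) (hR : 0 < R) : ∃ C D₀ : ℝ, 0 < C ∧ 1 ≤ D₀ ∧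
    ∀ (x : ℝ) (k : ℕ), 2 ≤ x → D₀ ≤ log (log x) → 1 ≤ k → (k : ℝ) ≤ R * log (log x) →
    ∃ c : ℝ, ∀ P : Finset ℕ, (∀ p ∈ P, p.Prime) →
      |levelCount P k x - c / localFactor ((k - 1) / log (log x)) P| ≤
        C * (∏ p ∈ P, (1 - (p : ℝ) ^ (-(3 : ℝ) / 4)) ^ (-R)) * levelCount ∅ k x / log (log x) := by
  set K := 4 * (R + 1) with hK
  obtain ⟨p₀, hp₀⟩ := exists_nat_ge ((4 * K + 4 * K / R) ^ 8)
  set E := (range (p₀ + 1)).filter Nat.Prime with hE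
  have hEp : ∀ p ∈ E, p.Prime := fun p hp => (mem_filter.1 hp).2
  obtain ⟨C, D₀, hC, hD₀, hmain⟩ := exists_abs_mul_shiftedCount_sub_le R hR hEp
  have hf : ∀ p ∈ E, 1 ≤ 1 + K / ((p : ℝ) ^ (7 / 8 : ℝ) - 1) := fun p hp => by
    have hp1 : (1 : ℝ) < p := by exact_mod_cast (hEp p hp).one_lt
    have h1 : 1 < (p : ℝ) ^ (7 / 8 : ℝ) := one_lt_rpow hp1 (by norm_num)
    have : 0 ≤ K / ((p : ℝ) ^ (7 / 8 : ℝ) - 1) := div_nonneg (by positivity) (by linarith)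
    linarith
  set G := ∏ p ∈ E, (1 + K / ((p : ℝ) ^ (7 / 8 : ℝ) - 1)) with hG
  have hG0 : 0 < G := prod_pos fun p hp => by linarith [hf p hp]
  refine ⟨G * C, D₀, by positivity, hD₀, fun x k hx hD hk hkR => ?_⟩
  obtain ⟨hV, hdev⟩ := hmain x k hx hD hk hkR
  have hx0 : 0 ≤ x := by linarith
  set D := log (log x)
  have hD0 : 0 < D := by linarith
  set V := levelCount E k x with hVd
  have hr0 : 0 ≤ ((k : ℝ) - 1) / D := by
    have : (1 : ℝ) ≤ k := by exact_mod_cast hk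
    exact div_nonneg (by linarith) hD0.le
  have hrR : ((k : ℝ) - 1) / D ≤ R := by rw [div_le_iff₀ hD0]; linarith
  set r := ((k : ℝ) - 1) / D with hr
  have hbE := one_le_localFactor hr0 hEp
  have hbase : DeviationBound k r (V * localFactor r E) x K E (C * V / D) := fun l m hm => by
    have h1 := hdev m l (by exact_mod_cast hm)
    rw [levelDeviation, mul_div_cancel_right₀ _ (by linarith), mul_comm V]
    exact h1.trans (le_of_eq (by ring))
  refine ⟨V * localFactor r E, fun P hP => ?_⟩
  have hc0 : 0 ≤ V * localFactor r E := by positivity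
  have h1 : DeviationBound k r (V * localFactor r E) x K (E ∩ P)
      ((∏ p ∈ E \ P, (1 + K / ((p : ℝ) ^ (7 / 8 : ℝ) - 1))) * (C * V / D)) := by
    refine DeviationBound.of_union (fun p hp => hEp p (mem_sdiff.1 hp).1)
      (disjoint_sdiff_inter E P) hr0 hx0 ?_
    rwa [sdiff_union_inter]
  have hbig : ∀ p ∈ P \ E, (4 * K + 4 * K / R) ^ 8 ≤ (p : ℝ) := fun p hp => by
    obtain ⟨hpP, hpE⟩ := mem_sdiff.1 hp
    refine hp₀.trans (Nat.cast_le.2 ?_)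
    by_contra h
    exact hpE (mem_filter.2 ⟨mem_range.2 (by omega), hP p hpP⟩)
  have hK4 : 4 ≤ K := by rw [hK]; linarith
  have h2 := h1.union (S := P \ E) (fun p hp => hEp p (mem_inter.1 hp).1)
    (fun p hp => hP p (mem_sdiff.1 hp).1) (by rw [inter_comm]; exact disjoint_sdiff_inter P E)
    hr0 (by linarith) (by linarith) hc0 hx0
    (fun p hp => (inv_one_sub_le_one_sub_rpow hR hK4 (hbig p hp)).1)
  rw [inter_comm, sdiff_union_inter] at h2
  have h3 := h2 0 1 le_rfl
  simp only [levelDeviation, shiftedCount, Nat.cast_one, one_mul, zero_le, if_true, tsub_zero,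
    div_one, pow_zero, mul_one, one_rpow] at h3
  refine h3.trans ?_
  have h4 : ∏ p ∈ P \ E, (1 - K / ((p : ℝ) ^ (7 / 8 : ℝ) - 1))⁻¹ ≤
      ∏ p ∈ P, (1 - (p : ℝ) ^ (-(3 : ℝ) / 4)) ^ (-R) := by
    refine le_trans (prod_le_prod (fun p hp => ?_) fun p hp =>
      (inv_one_sub_le_one_sub_rpow hR hK4 (hbig p hp)).2)
      (prod_sdiff_le_prod P E fun p hp => one_le_one_sub_rpow_rpow hR (hP p hp))
    have := (inv_one_sub_le_one_sub_rpow hR hK4 (hbig p hp)).1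
    exact inv_nonneg.2 (by linarith)
  have h5 := prod_sdiff_le_prod E P hf
  have h6 : 0 ≤ ∏ p ∈ P \ E, (1 - K / ((p : ℝ) ^ (7 / 8 : ℝ) - 1))⁻¹ := prod_nonneg fun p hp => by
    have := (inv_one_sub_le_one_sub_rpow hR hK4 (hbig p hp)).1
    exact inv_nonneg.2 (by linarith)
  have h7 : V ≤ levelCount ∅ k x := levelCount_anti (empty_subset E) k x
  have h8 : 0 ≤ levelCount ∅ k x := levelCount_nonneg ..
  calc _ ≤ G * (C * levelCount ∅ k x / D) *
        ∏ p ∈ P, (1 - (p : ℝ) ^ (-(3 : ℝ) / 4)) ^ (-R) := by gcongr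
    _ = _ := by ring

lemma card_filter_coprime_eq_levelCount {d : ℕ} (hd : d ≠ 0) (k : ℕ) (x : ℝ) :
    (#((Icc 1 ⌊x⌋₊).filter fun n => Nat.Coprime n d ∧ n.primeFactors.card = k) : ℝ) =
      levelCount d.primeFactors k x := by
  rw [levelCount, levelSet]
  congr 2
  refine filter_congr fun n hn => ?_
  rw [Nat.disjoint_primeFactors (by have := (mem_Icc.1 hn).1; omega) hd]

lemma pik_eq_levelCount (k : ℕ) (x : ℝ) : (pik k x : ℝ) = levelCount ∅ k x := by
  simp [pik, levelCount, levelSet]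

/-- Selberg–Delange type estimate: uniformly for `x ≥ 2`, `d ≥ 1`,
`1 ≤ k ≤ R log log x` with `r := (k−1)/log log x ≤ R`,
`#{n ≤ x : (n,d)=1, ω(n)=k} = π_k(x)/𝔟_r(d) + O(B_R(d) π_k(x)/log log x)`. -/
theorem stmt_19 (R : ℝ) (hR : 0 < R) :
    ∃ C : ℝ, 0 < C ∧ ∀ (x : ℝ) (d k : ℕ), 2 ≤ x → 1 ≤ d → 1 ≤ k →
      (k : ℝ) ≤ R * Real.log (Real.log x) →
      ((k : ℝ) - 1) / Real.log (Real.log x) ≤ R →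
      |((((Finset.Icc 1 ⌊x⌋₊).filter
            (fun n => Nat.Coprime n d ∧ n.primeFactors.card = k)).card : ℝ))
          - (pik k x : ℝ) / bR (((k : ℝ) - 1) / Real.log (Real.log x)) d|
        ≤ C * BR R d * (pik k x : ℝ) / Real.log (Real.log x) := by
  obtain ⟨C, D₀, hC, hD₀, hmain⟩ := exists_abs_levelCount_sub_le R hR
  refine ⟨2 * C + D₀, by positivity, fun x d k hx hd hk hkR _ => ?_⟩
  rw [card_filter_coprime_eq_levelCount (by omega), pik_eq_levelCount]
  have hk1 : (1 : ℝ) ≤ k := by exact_mod_cast hk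
  set D := log (log x)
  have hD : 0 < D := by
    by_contra h
    push Not at h
    nlinarith
  have hr0 : 0 ≤ ((k : ℝ) - 1) / D := div_nonneg (by linarith) hD.le
  have hP : ∀ p ∈ d.primeFactors, p.Prime := fun p hp => Nat.prime_of_mem_primeFactors hp
  have hb : 1 ≤ bR (((k : ℝ) - 1) / D) d := one_le_localFactor hr0 hP
  have hB : 1 ≤ BR R d := prod_induction _ (1 ≤ ·) (fun _ _ => one_le_mul_of_one_le_of_one_le) le_rfl
    fun p hp => one_le_one_sub_rpow_rpow hR (hP p hp)
  have hπ0 : 0 ≤ levelCount ∅ k x := levelCount_nonneg ..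
  set π' := levelCount ∅ k x
  set b := bR (((k : ℝ) - 1) / D) d
  rcases lt_or_ge D D₀ with h | h
  · calc _ ≤ π' := abs_sub_le_of_nonneg_of_le (levelCount_nonneg ..)
          (levelCount_anti (empty_subset _) k x) (by positivity) (div_le_self hπ0 hb)
      _ ≤ (2 * C + D₀) * BR R d * π' / D := by
          rw [le_div_iff₀ hD, mul_comm π' D]
          gcongr
          calc D ≤ (2 * C + D₀) * 1 := by linarith
            _ ≤ _ := by gcongr
  · obtain ⟨c, hc⟩ := hmain x k hx h hk hkR
    have h1 : |levelCount d.primeFactors k x - c / b| ≤ C * BR R d * π' / D := hc d.primeFactors hP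
    have h2 := hc ∅ (by simp)
    simp only [localFactor, prod_empty, div_one, mul_one] at h2
    have h3 : |π' / b - c / b| ≤ C * BR R d * π' / D := by
      rw [← sub_div, abs_div, abs_of_pos (show 0 < b by linarith)]
      calc |π' - c| / b ≤ |π' - c| := div_le_self (abs_nonneg _) hb
        _ ≤ C * 1 * π' / D := by rw [mul_one]; exact h2
        _ ≤ _ := by gcongr
    have h4 := abs_sub_le (levelCount d.primeFactors k x) (c / b) (π' / b)
    rw [abs_sub_comm (c / b)] at h4
    have h5 : 0 ≤ D₀ * BR R d * π' / D := by positivity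
    have h6 : (2 * C + D₀) * BR R d * π' / D = C * BR R d * π' / D + C * BR R d * π' / D +
      D₀ * BR R d * π' / D := by ring
    linarith
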